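/- Let n ≥ 0 be an integer and 0 ≤ m ≤ ⌊n/2⌋. There is a homeomorphism γ : ℝ → Γ_{n,m} (onto Γ_{n,m} with its subspace topology) whose first coordinate b(t) has the following end behavior: if n is odd, or if n is even and m < n/2, then b(t) → +∞ as t → +∞ and as t → −∞; if n is even and m = n/2, then (after replacing t by −t if necessary) b(t) → +∞ as t → +∞ and b(t) → −∞ as t → −∞. -/

import Mathlib

open Complex Filter Polynomial

/-- The quasi-exactly solvable candidate eigenfunction `p(z) exp(z³/3 - b z)`. -/
noncomputable def qesFun (b : ℂ) (p : Polynomial ℂ) : ℂ → ℂ :=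
  fun z => p.eval z * Complex.exp (z ^ 3 / 3 - b * z)

/-- `y` satisfies the quartic ODE `-y'' + (z⁴ - 2 b z² + 2 J z) y = λ y`. -/
def SatisfiesQuarticODE (J b lam : ℂ) (y : ℂ → ℂ) : Prop :=
  ∀ z : ℂ,
    -(deriv (deriv y) z) + (z ^ 4 - 2 * b * z ^ 2 + 2 * J * z) * y z = lam * y z

/-- `y` is an eigenfunction of `L_J(b)` with eigenvalue `λ`:
an entire function, not identically zero, satisfying the ODE and tending to `0`
along the rays `arg z = ±π/3`. -/
def IsQuarticEigenfunction (J b lam : ℂ) (y : ℂ → ℂ) : Prop :=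
  Differentiable ℂ y ∧ y ≠ 0 ∧ SatisfiesQuarticODE J b lam y ∧
  Tendsto (fun r : ℝ => y (r * Complex.exp (Complex.I * (Real.pi / 3))))
    atTop (nhds 0) ∧
  Tendsto (fun r : ℝ => y (r * Complex.exp (-Complex.I * (Real.pi / 3))))
    atTop (nhds 0)

/-- `λ` is an eigenvalue of `L_J(b)`. -/
def IsQuarticEigenvalue (J b lam : ℂ) : Prop :=
  ∃ y : ℂ → ℂ, IsQuarticEigenfunction J b lam y

/-- `p` witnesses that `(b, λ)` lies in the QES spectral locus of `L_J`. -/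
def QESWitness (J b lam : ℂ) (p : Polynomial ℂ) : Prop :=
  p ≠ 0 ∧ SatisfiesQuarticODE J b lam (qesFun b p)

/-- The quasi-exactly solvable part of the spectral locus of `L_J`. -/
def qesSpectralLocus (J : ℂ) : Set (ℂ × ℂ) :=
  {q : ℂ × ℂ | ∃ p : Polynomial ℂ, QESWitness J q.1 q.2 p}

/-- The real QES spectral locus of `L_J`. -/
def qesRealLocus (J : ℂ) : Set (ℝ × ℝ) :=
  {q : ℝ × ℝ | ((q.1 : ℂ), (q.2 : ℂ)) ∈ qesSpectralLocus J}

/-- `Γ_{n,m}`: points of the real QES spectral locus of `L_{n+1}` whose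
polynomial has exactly `n - 2m` (distinct) real zeros. -/
def qesGamma (n m : ℕ) : Set (ℝ × ℝ) :=
  {q : ℝ × ℝ | ∃ p : Polynomial ℂ, QESWitness ((n : ℂ) + 1) q.1 q.2 p ∧
    {z : ℂ | p.eval z = 0 ∧ z.im = 0}.ncard = n - 2 * m}



namespace QES

section Gen
variable {K : Type*} [Field K]

/-- The moment functional: `X^k ↦ m k`. -/
noncomputable def Lf (m : ℕ → K) : K[X] →ₗ[K] K :=
  Polynomial.lsum (fun k => (m k) • (LinearMap.id : K →ₗ[K] K))

theorem Lf_monomial (m : ℕ → K) (k : ℕ) (a : K) : Lf m (monomial k a) = m k * a := by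
  simp [Lf, Polynomial.lsum_apply, Polynomial.sum_monomial_index]

theorem Lf_X_pow (m : ℕ → K) (k : ℕ) : Lf m (X ^ k) = m k := by
  rw [← Polynomial.monomial_one_right_eq_X_pow, Lf_monomial, mul_one]

theorem Lf_one (m : ℕ → K) : Lf m 1 = m 0 := by
  simpa using Lf_X_pow m 0

theorem Lf_X (m : ℕ → K) : Lf m X = m 1 := by
  simpa using Lf_X_pow m 1

theorem Lf_C_mul (m : ℕ → K) (a : K) (P : K[X]) : Lf m (C a * P) = a * Lf m P := by
  rw [← Polynomial.smul_eq_C_mul, map_smul, smul_eq_mul]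

theorem Lf_eq_sum (m : ℕ → K) (P : K[X]) (N : ℕ) (h : P.natDegree < N) :
    Lf m P = ∑ k ∈ Finset.range N, P.coeff k * m k := by
  conv_lhs => rw [P.as_sum_range' N h, map_sum]
  refine Finset.sum_congr rfl fun k _ => ?_
  rw [Lf_monomial, mul_comm]

theorem Lf_add_mom (m m' : ℕ → K) (P : K[X]) : Lf (m + m') P = Lf m P + Lf m' P := by
  rw [Lf_eq_sum _ _ _ (Nat.lt_succ_self _), Lf_eq_sum _ _ _ (Nat.lt_succ_self _),
    Lf_eq_sum _ _ _ (Nat.lt_succ_self _), ← Finset.sum_add_distrib]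
  refine Finset.sum_congr rfl fun k _ => ?_
  simp [mul_add]

theorem Lf_smul_mom (c : K) (m : ℕ → K) (P : K[X]) : Lf (c • m) P = c * Lf m P := by
  rw [Lf_eq_sum _ _ _ (Nat.lt_succ_self _), Lf_eq_sum _ _ _ (Nat.lt_succ_self _),
    Finset.mul_sum]
  refine Finset.sum_congr rfl fun k _ => ?_
  simp; ring

theorem Lf_neg_mom (m : ℕ → K) (P : K[X]) : Lf (-m) P = - Lf m P := by
  rw [← neg_one_smul K m, Lf_smul_mom]; ring

/-- moment recursion -/
def Rec (b : K) (m : ℕ → K) : Prop :=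
  ∀ k : ℕ, (k : K) * m (k - 1) + 2 * m (k + 2) - 2 * b * m k = 0

noncomputable def Dop (b : K) (Q : K[X]) : K[X] := derivative Q + 2 * (X ^ 2 - C b) * Q

theorem Rec.Lf_Dop {b : K} {m : ℕ → K} (h : Rec b m) (Q : K[X]) : Lf m (Dop b Q) = 0 := by
  induction Q using Polynomial.induction_on' with
  | add p q hp hq =>
    have : Dop b (p + q) = Dop b p + Dop b q := by simp [Dop]; ring
    rw [this, map_add, hp, hq, add_zero]
  | monomial k a =>
    have : Dop b (monomial k a) = C a * (monomial (k-1) (k:K) + C 2 * X^(k+2) - C (2 * b) * X^k) := by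
      rw [Dop, derivative_monomial, ← C_mul_X_pow_eq_monomial, ← C_mul_X_pow_eq_monomial,
        ← C_mul_X_pow_eq_monomial]
      simp only [C_mul, map_ofNat]
      ring
    rw [this, Lf_C_mul, map_sub, map_add, Lf_monomial, Lf_C_mul, Lf_C_mul, Lf_X_pow, Lf_X_pow]
    have := h k
    linear_combination a * this

noncomputable def Top (n : ℕ) (b : K) (P : K[X]) : K[X] :=
  derivative (derivative P) + 2 * (X ^ 2 - C b) * derivative P - 2 * (n : K[X]) * X * P

theorem Top_add (n : ℕ) (b : K) (P Q : K[X]) : Top n b (P + Q) = Top n b P + Top n b Q := by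
  simp [Top]; ring

theorem Top_smul (n : ℕ) (b : K) (c : K) (P : K[X]) : Top n b (c • P) = c • Top n b P := by
  simp [Top, smul_eq_C_mul]; ring

noncomputable def TopL (n : ℕ) (b : K) : K[X] →ₗ[K] K[X] where
  toFun := Top n b
  map_add' := Top_add n b
  map_smul' := Top_smul n b

theorem Top_symm (n : ℕ) (b : K) (u v : K[X]) :
    u * Top n b v - v * Top n b u = Dop b (u * derivative v - derivative u * v) := by
  simp [Top, Dop]; ring

theorem Rec.Lf_symm {b : K} {m : ℕ → K} (h : Rec b m) (n : ℕ) (u v : K[X]) :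
    Lf m (u * Top n b v) = Lf m (v * Top n b u) := by
  have := h.Lf_Dop (u * derivative v - derivative u * v)
  rw [← Top_symm n, map_sub] at this
  exact sub_eq_zero.mp this

theorem Top_coeff_succ (n : ℕ) (b : K) (P : K[X]) (k : ℕ) :
    (Top n b P).coeff (k + 1) = (k + 3) * (k + 2) * P.coeff (k + 3)
      - 2 * b * (k + 2) * P.coeff (k + 2) + 2 * (k - n) * P.coeff k := by
  have h : Top n b P = derivative (derivative P) + C 2 * (X * (X * derivative P))
      - C (2 * b) * derivative P - C (2 * (n : K)) * (X * P) := by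
    simp only [Top, C_mul, map_ofNat, map_natCast]; ring
  rw [h]
  simp only [coeff_sub, coeff_add, coeff_C_mul, coeff_X_mul, coeff_derivative]
  rcases k with _ | k
  · simp [Polynomial.mul_coeff_zero]; ring
  · simp only [coeff_X_mul, coeff_derivative]; push_cast; ring

theorem Top_coeff_zero (n : ℕ) (b : K) (P : K[X]) :
    (Top n b P).coeff 0 = 2 * P.coeff 2 - 2 * b * P.coeff 1 := by
  have h : Top n b P = derivative (derivative P) + C 2 * (X * (X * derivative P))
      - C (2 * b) * derivative P - C (2 * (n : K)) * (X * P) := by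
    simp only [Top, C_mul, map_ofNat, map_natCast]; ring
  rw [h]
  simp only [coeff_sub, coeff_add, coeff_derivative, Polynomial.mul_coeff_zero, coeff_C_zero,
    coeff_X_zero]
  push_cast; ring

theorem Top_natDegree_le (n : ℕ) (b : K) (P : K[X]) (h : P.natDegree ≤ n) :
    (Top n b P).natDegree ≤ n := by
  rw [natDegree_le_iff_coeff_eq_zero] at h ⊢
  intro k hk
  obtain ⟨k, rfl⟩ : ∃ j, k = j + 1 := ⟨k - 1, by omega⟩
  rw [Top_coeff_succ, h (k+3) (by omega), h (k+2) (by omega)]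
  rcases Nat.lt_or_ge n k with h1 | h1
  · rw [h k h1]; ring
  · have : k = n := by omega
    subst this; ring

/-- Monic eigenpolynomials -/
def Eig (n : ℕ) (b μ : K) (P : K[X]) : Prop :=
  P.Monic ∧ P.natDegree = n ∧ Top n b P + C μ * P = 0

variable [CharZero K]

theorem eig_degree {n : ℕ} {b μ : K} {P : K[X]} (hP : P ≠ 0)
    (h : Top n b P + C μ * P = 0) : P.natDegree = n := by
  have h1 := congrArg (fun q => q.coeff (P.natDegree + 1)) h
  simp only [coeff_add, coeff_C_mul, Top_coeff_succ, coeff_zero] at h1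
  rw [coeff_eq_zero_of_natDegree_lt (n := P.natDegree + 3) (by omega),
    coeff_eq_zero_of_natDegree_lt (n := P.natDegree + 2) (by omega),
    coeff_eq_zero_of_natDegree_lt (n := P.natDegree + 1) (by omega)] at h1
  have h2 : P.coeff P.natDegree ≠ 0 := by simpa using hP
  have h3 : (2:K) * ((P.natDegree : K) - n) = 0 := by
    have : (2:K) * ((P.natDegree : K) - n) * P.coeff P.natDegree = 0 := by
      linear_combination h1
    exact (mul_eq_zero.mp this).resolve_right h2
  have h4 : ((P.natDegree : K) - n) = 0 := (mul_eq_zero.mp h3).resolve_left two_ne_zero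
  exact_mod_cast sub_eq_zero.mp h4

theorem eig_normalize {n : ℕ} {b μ : K} {P : K[X]} (hP : P ≠ 0)
    (h : Top n b P + C μ * P = 0) : Eig n b μ (C P.leadingCoeff⁻¹ * P) := by
  have hl : P.leadingCoeff ≠ 0 := leadingCoeff_ne_zero.mpr hP
  refine ⟨?_, ?_, ?_⟩
  · rw [Monic, leadingCoeff_mul, leadingCoeff_C, inv_mul_cancel₀ hl]
  · rw [natDegree_C_mul (inv_ne_zero hl)]; exact eig_degree hP h
  · have := Top_smul n b P.leadingCoeff⁻¹ P
    rw [smul_eq_C_mul, smul_eq_C_mul] at this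
    rw [this]
    linear_combination C P.leadingCoeff⁻¹ * h

theorem Eig.unique {n : ℕ} {b μ : K} {P Q : K[X]} (hP : Eig n b μ P) (hQ : Eig n b μ Q) :
    P = Q := by
  by_contra hne
  have h0 : P - Q ≠ 0 := sub_ne_zero.mpr hne
  have h1 : Top n b (P - Q) + C μ * (P - Q) = 0 := by
    have : Top n b (P - Q) = Top n b P - Top n b Q := by simp [Top]; ring
    rw [this]
    linear_combination hP.2.2 - hQ.2.2
  have h2 := eig_degree h0 h1
  have h3 : (P - Q).coeff n = 0 := by
    have a : P.coeff n = 1 := by have := hP.1.coeff_natDegree; rwa [hP.2.1] at this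
    have c : Q.coeff n = 1 := by have := hQ.1.coeff_natDegree; rwa [hQ.2.1] at this
    rw [coeff_sub, a, c, sub_self]
  apply h0
  rw [← leadingCoeff_eq_zero, leadingCoeff, h2, h3]

theorem Eig.simple {n : ℕ} {b μ : K} {P : K[X]} (h : Eig n b μ P) (z : K)
    (hz : P.eval z = 0) : (derivative P).eval z ≠ 0 := by
  intro hz'
  have hP : P ≠ 0 := h.1.ne_zero
  have hP' : derivative P ≠ 0 := by
    intro h0
    have := derivative_eq_zero.mp h0
    rw [eq_C_of_natDegree_eq_zero this] at hz hP
    simp at hz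
    rw [hz] at hP; simp at hP
  have r1 := derivative_rootMultiplicity_of_root (p := P) (t := z) hz
  have r1' : 0 < (derivative P).rootMultiplicity z := (rootMultiplicity_pos hP').mpr hz'
  have r2 := derivative_rootMultiplicity_of_root (p := derivative P) (t := z) hz'
  set r := P.rootMultiplicity z with hr
  have hd2 : derivative (derivative P) = - (2 * (X ^ 2 - C b) * derivative P - 2 * (n : K[X]) * X * P + C μ * P) := by
    have := h.2.2
    rw [Top] at this
    linear_combination this
  have hdvd1 : (X - C z) ^ (r - 1) ∣ derivative P := by
    rw [← r1]; exact pow_rootMultiplicity_dvd _ _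
  have hdvd2 : (X - C z) ^ (r - 1) ∣ P :=
    (pow_dvd_pow _ (Nat.sub_le _ _)).trans (pow_rootMultiplicity_dvd _ _)
  have hdvd : (X - C z) ^ (r - 1) ∣ derivative (derivative P) := by
    rw [hd2]
    refine (dvd_neg).mpr (dvd_add (dvd_sub ?_ ?_) ?_)
    · exact hdvd1.mul_left _
    · exact hdvd2.mul_left _
    · exact hdvd2.mul_left _
  have hP'' : derivative (derivative P) ≠ 0 := by
    intro h0
    have := derivative_eq_zero.mp h0
    rw [eq_C_of_natDegree_eq_zero this] at hz' hP'
    simp at hz'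
    rw [hz'] at hP'; simp at hP'
  have := (le_rootMultiplicity_iff hP'').mpr hdvd
  omega

theorem ST1 {n : ℕ} {b μ : K} {P : K[X]} (h : Eig n b μ P) {m : ℕ → K} (hm : Rec b m)
    (h0 : Lf m P = 0) (Q : K[X]) (hQ : Q.natDegree ≤ n) : Lf m (P * Q) = 0 := by
  have key : ∀ k ≤ n, Lf m (P * X ^ k) = 0 := by
    intro k
    induction k using Nat.strong_induction_on with
    | _ k ih =>
      intro hk
      rcases k with _ | k
      · simpa using h0
      · have h1 := hm.Lf_symm n P (X ^ k)
        have hT : Top n b P = - (C μ * P) := by linear_combination h.2.2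
        rw [hT] at h1
        have h2 : Lf m (X ^ k * -(C μ * P)) = 0 := by
          have : X ^ k * -(C μ * P) = C (-μ) * (P * X ^ k) := by simp; ring
          rw [this, Lf_C_mul, ih k (by omega) (by omega), mul_zero]
        rw [h2] at h1
        have h3 : P * Top n b (X ^ k) = C ((k * ((k - 1 : ℕ) : K))) * (P * X ^ (k - 1 - 1))
            - C (2 * b * k) * (P * X ^ (k - 1)) + C (2 * ((k : K) - n)) * (P * X ^ (k + 1)) := by
          have e : (k : K[X]) * (X ^ 2 * X ^ (k - 1)) = (k : K[X]) * X ^ (k + 1) := by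
            rcases k with _ | k
            · simp
            · rw [Nat.add_sub_cancel]; ring
          simp only [Top, derivative_X_pow, derivative_mul, derivative_natCast, C_mul, C_sub,
            map_natCast, map_ofNat, zero_mul, zero_add]
          linear_combination (2 * P) * e
        rw [h3, map_add, map_sub, Lf_C_mul, Lf_C_mul, Lf_C_mul, ih (k-1) (by omega) (by omega),
          ih (k-1-1) (by omega) (by omega), mul_zero, mul_zero, sub_zero, zero_add] at h1
        refine (mul_eq_zero.mp h1).resolve_left ?_
        refine mul_ne_zero two_ne_zero (sub_ne_zero.mpr ?_)
        intro h; have : k = n := by exact_mod_cast h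
        omega
  rw [Q.as_sum_range' (n+1) (by omega), Finset.mul_sum, map_sum]
  refine Finset.sum_eq_zero fun k hk => ?_
  rw [← C_mul_X_pow_eq_monomial, mul_left_comm, Lf_C_mul,
    key k (by simp at hk; omega), mul_zero]

end Gen
end QES


namespace QES

theorem Lf_ker_of_pow {K : Type*} [Field K] {n : ℕ} {m : ℕ → K} {w : K[X]}
    (h : ∀ k ≤ n, Lf m (w * X ^ k) = 0) (Q : K[X]) (hQ : Q.natDegree ≤ n) :
    Lf m (w * Q) = 0 := by
  rw [Q.as_sum_range' (n+1) (by omega), Finset.mul_sum, map_sum]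
  refine Finset.sum_eq_zero fun k hk => ?_
  rw [← C_mul_X_pow_eq_monomial, mul_left_comm, Lf_C_mul,
    h k (by simp at hk; omega), mul_zero]

/-- quotient by a root -/
noncomputable def rq (P : ℂ[X]) (z : ℂ) : ℂ[X] := P /ₘ (X - C z)

theorem rq_mul {P : ℂ[X]} {z : ℂ} (hz : P.eval z = 0) : (X - C z) * rq P z = P :=
  mul_divByMonic_eq_iff_isRoot.mpr hz

theorem rq_natDegree (P : ℂ[X]) (z : ℂ) : (rq P z).natDegree = P.natDegree - 1 := by
  rw [rq, natDegree_divByMonic _ (monic_X_sub_C z), natDegree_X_sub_C]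

noncomputable def kap {K : Type*} [Field K] (m : ℕ → K) (P : K[X]) : K := -2 * Lf m (X * P ^ 2)

section
variable {n : ℕ} {b μ : ℂ} {P : ℂ[X]} {m : ℕ → ℂ}

theorem Eig.card_roots (h : Eig n b μ P) : P.roots.toFinset.card = n := by
  have h1 : P.roots.card = n := by
    rw [← h.2.1]; exact splits_iff_card_roots.mp (IsAlgClosed.splits P)
  rw [Multiset.toFinset_card_of_nodup, h1]
  rw [Multiset.nodup_iff_count_le_one]
  intro z
  rw [count_roots]
  by_contra hc
  push Not at hc
  have := (one_lt_rootMultiplicity_iff_isRoot h.1.ne_zero).mp hc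
  exact h.simple z this.1 this.2

theorem Eig.pos_of_root (h : Eig n b μ P) {z : ℂ} (hz : P.eval z = 0) : 0 < n := by
  rcases Nat.eq_zero_or_pos n with h0 | h0
  · have := h.2.1
    rw [h0] at this
    have h1 := h.1.natDegree_eq_zero.mp this
    rw [h1] at hz; simp at hz
  · exact h0

theorem mem_rts (h : Eig n b μ P) {z : ℂ} : z ∈ P.roots.toFinset ↔ P.eval z = 0 := by
  rw [Multiset.mem_toFinset, mem_roots h.1.ne_zero]; rfl

theorem rq_orth (h : Eig n b μ P) (hk : ∀ Q : ℂ[X], Q.natDegree ≤ n → Lf m (P * Q) = 0)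
    {z w : ℂ} (hz : P.eval z = 0) (hw : P.eval w = 0) (hne : z ≠ w) :
    Lf m (rq P z * rq P w) = 0 := by
  have h1 : C (z - w) * (rq P z * rq P w) = P * rq P z - P * rq P w := by
    have e1 := rq_mul hz
    have e2 := rq_mul hw
    rw [C_sub]
    linear_combination rq P z * e2 - rq P w * e1
  have h2 : Lf m (C (z - w) * (rq P z * rq P w)) = 0 := by
    rw [h1, map_sub, hk _ (by rw [rq_natDegree, h.2.1]; omega),
      hk _ (by rw [rq_natDegree, h.2.1]; omega), sub_zero]
  rw [Lf_C_mul] at h2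
  exact (mul_eq_zero.mp h2).resolve_left (sub_ne_zero.mpr hne)

theorem rq_sq (h : Eig n b μ P) (hm : Rec b m)
    (hk : ∀ Q : ℂ[X], Q.natDegree ≤ n → Lf m (P * Q) = 0)
    {z : ℂ} (hz : P.eval z = 0) : Lf m (rq P z * rq P z) = kap m P := by
  have hn := h.pos_of_root hz
  have h1 := hm.Lf_Dop (P * rq P z)
  have e1 := rq_mul hz
  have e2 : derivative P = rq P z + (X - C z) * derivative (rq P z) := by
    conv_lhs => rw [← e1]
    simp
  have e3 : Dop b (P * rq P z) = rq P z * rq P z + C 2 * (P * derivative (rq P z))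
      + C 2 * (X * P ^ 2) + C (2 * z) * (P * (X * rq P z)) - C (2 * b) * (P * rq P z) := by
    simp only [Dop, derivative_mul, C_mul, map_ofNat]
    rw [e2]
    linear_combination (derivative (rq P z) + 2 * X * P) * e1
  have d1 : (rq P z).natDegree ≤ n := by rw [rq_natDegree, h.2.1]; omega
  have d2 : (derivative (rq P z)).natDegree ≤ n :=
    (natDegree_derivative_le _).trans (by omega)
  have d3 : (X * rq P z).natDegree ≤ n := by
    refine natDegree_mul_le.trans ?_
    rw [natDegree_X, rq_natDegree, h.2.1]; omega
  rw [e3, map_sub, map_add, map_add, map_add, Lf_C_mul, Lf_C_mul, Lf_C_mul, Lf_C_mul,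
    hk _ d1, hk _ d2, hk _ d3] at h1
  rw [kap]
  linear_combination h1

theorem rq_eval_self (h : Eig n b μ P) {z : ℂ} (hz : P.eval z = 0) : (rq P z).eval z ≠ 0 := by
  have := h.simple z hz
  have e2 : derivative P = rq P z + (X - C z) * derivative (rq P z) := by
    conv_lhs => rw [← rq_mul hz]
    simp
  rw [e2] at this
  simpa using this

theorem rq_eval_ne {z w : ℂ} (hz : P.eval z = 0) (hw : P.eval w = 0) (hne : z ≠ w) :
    (rq P z).eval w = 0 := by
  have := rq_mul hz
  have h2 : ((X - C z) * rq P z).eval w = 0 := by rw [this, hw]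
  rw [eval_mul] at h2
  refine (mul_eq_zero.mp h2).resolve_left ?_
  simpa using sub_ne_zero.mpr hne.symm

theorem lagr (h : Eig n b μ P) (U : ℂ[X]) (hU : U.degree < n) :
    U = ∑ z ∈ P.roots.toFinset, C (U.eval z / (rq P z).eval z) * rq P z := by
  refine eq_of_degrees_lt_of_eval_finset_eq P.roots.toFinset (by rw [h.card_roots]; exact hU) ?_ ?_
  · rw [h.card_roots]
    refine (degree_sum_le _ _).trans_lt ?_
    rw [Finset.sup_lt_iff]
    · intro z hz
      have hn := h.pos_of_root ((mem_rts h).mp hz)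
      refine lt_of_le_of_lt degree_le_natDegree ?_
      have d := natDegree_C_mul_le (eval z U / eval z (rq P z)) (rq P z)
      rw [rq_natDegree, h.2.1] at d
      exact_mod_cast (by omega)
    · exact WithBot.bot_lt_coe n
  · intro w hw
    rw [eval_finsetSum, Finset.sum_eq_single w]
    · have := rq_eval_self h ((mem_rts h).mp hw)
      simp [this]
    · intro z hz hzw
      rw [eval_mul, rq_eval_ne ((mem_rts h).mp hz) ((mem_rts h).mp hw) hzw, mul_zero]
    · intro h'; exact absurd hw h'

theorem deg_sub_lead (h : Eig n b μ P) (w : ℂ[X]) (hw : w.natDegree ≤ n) :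
    (w - C (w.coeff n) * P).degree < n := by
  rw [degree_lt_iff_coeff_zero]
  intro k hk
  rcases hk.eq_or_lt with e | e
  · have : P.coeff n = 1 := by have := h.1.coeff_natDegree; rwa [h.2.1] at this
    rw [← e]; simp [this]
  · rw [coeff_sub, coeff_C_mul, coeff_eq_zero_of_natDegree_lt (by omega),
      coeff_eq_zero_of_natDegree_lt (p := P) (by rw [h.2.1]; omega)]; ring

theorem kap_ne (h : Eig n b μ P) (hm : Rec b m)
    (hk : ∀ Q : ℂ[X], Q.natDegree ≤ n → Lf m (P * Q) = 0)
    (h01 : ¬ (m 0 = 0 ∧ m 1 = 0)) : kap m P ≠ 0 := by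
  intro hkap
  rcases Nat.eq_zero_or_pos n with hn | hn
  · have h1 : P = 1 := h.1.natDegree_eq_zero.mp (by rw [h.2.1, hn])
    apply h01
    have a := hk 1 (by simp)
    rw [h1, one_mul, Lf_one] at a
    refine ⟨a, ?_⟩
    rw [kap, h1, one_pow, mul_one, Lf_X] at hkap
    simpa using hkap
  · have key : ∀ z w : ℂ, P.eval z = 0 → P.eval w = 0 → Lf m (rq P z * rq P w) = 0 := by
      intro z w hz hw
      by_cases e : z = w
      · subst e; rw [rq_sq h hm hk hz, hkap]
      · exact rq_orth h hk hz hw e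
    have key2 : ∀ (z : ℂ) (U : ℂ[X]), P.eval z = 0 → U.natDegree ≤ n → Lf m (rq P z * U) = 0 := by
      intro z U hz hU
      have e : U = C (U.coeff n) * P + (U - C (U.coeff n) * P) := by ring
      rw [e, mul_add, map_add]
      have e1 : rq P z * (C (U.coeff n) * P) = C (U.coeff n) * (P * rq P z) := by ring
      rw [e1, Lf_C_mul, hk _ (by rw [rq_natDegree, h.2.1]; omega), mul_zero, zero_add,
        lagr h _ (deg_sub_lead h U hU), Finset.mul_sum, map_sum]
      refine Finset.sum_eq_zero fun w hw => ?_
      rw [mul_left_comm, Lf_C_mul, key z w hz ((mem_rts h).mp hw), mul_zero]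
    have key3 : ∀ (U : ℂ[X]), U.natDegree ≤ n → Lf m U = 0 := by
      intro U hU
      have e := lagr h 1 (by rw [degree_one]; exact_mod_cast hn)
      rw [← one_mul U, e, Finset.sum_mul, map_sum]
      refine Finset.sum_eq_zero fun w hw => ?_
      rw [mul_assoc, Lf_C_mul, key2 w U ((mem_rts h).mp hw) hU, mul_zero]
    apply h01
    rw [← Lf_one m, ← Lf_X m]
    exact ⟨key3 _ (by simp), key3 _ (by rw [natDegree_X]; omega)⟩

theorem ker_eq (h : Eig n b μ P) (hm : Rec b m)
    (hk : ∀ Q : ℂ[X], Q.natDegree ≤ n → Lf m (P * Q) = 0)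
    (h01 : ¬ (m 0 = 0 ∧ m 1 = 0)) (w : ℂ[X]) (hw : w.natDegree ≤ n)
    (hwk : ∀ Q : ℂ[X], Q.natDegree ≤ n → Lf m (w * Q) = 0) : w = C (w.coeff n) * P := by
  have hkap := kap_ne h hm hk h01
  set U := w - C (w.coeff n) * P with hU
  have hUd := deg_sub_lead h w hw
  have hL := lagr h U hUd
  have hz : ∀ z ∈ P.roots.toFinset, U.eval z / (rq P z).eval z = 0 := by
    intro z hz
    have hz' := (mem_rts h).mp hz
    have d1 : (rq P z).natDegree ≤ n := by rw [rq_natDegree, h.2.1]; omega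
    have h1 : Lf m (U * rq P z) = 0 := by
      rw [hU, sub_mul, map_sub, hwk _ d1, mul_assoc, Lf_C_mul, hk _ d1]; ring
    rw [hL, Finset.sum_mul, map_sum, Finset.sum_eq_single z] at h1
    · rw [mul_assoc, Lf_C_mul, rq_sq h hm hk hz'] at h1
      exact (mul_eq_zero.mp h1).resolve_right hkap
    · intro y hy hyz
      rw [mul_assoc, Lf_C_mul, rq_orth h hk ((mem_rts h).mp hy) hz' hyz, mul_zero]
    · intro h'; exact absurd hz h'
  have : U = 0 := by
    rw [hL]
    refine Finset.sum_eq_zero fun z hz' => ?_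
    rw [hz z hz', C_0, zero_mul]
  rw [hU] at this
  exact sub_eq_zero.mp this

end

/-- complexified moments -/
noncomputable def cm (m : ℕ → ℝ) : ℕ → ℂ := fun k => (m k : ℂ)

theorem Lf_cm (m : ℕ → ℝ) (Q : ℝ[X]) : Lf (cm m) (Q.map ofRealHom) = (Lf m Q : ℂ) := by
  rw [Lf_eq_sum _ _ (Q.natDegree + 1) (Nat.lt_succ_of_le natDegree_map_le),
    Lf_eq_sum _ _ _ (Nat.lt_succ_self _)]
  simp [cm]

theorem Rec.cm {b : ℝ} {m : ℕ → ℝ} (h : Rec b m) : Rec (b : ℂ) (cm m) := by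
  intro k
  have := h k
  simp only [QES.cm]
  exact_mod_cast this

theorem Top_map (n : ℕ) (b : ℝ) (P : ℝ[X]) :
    (Top n b P).map ofRealHom = Top n (b : ℂ) (P.map ofRealHom) := by
  simp [Top, derivative_map]

theorem Eig.map {n : ℕ} {b μ : ℝ} {P : ℝ[X]} (h : Eig n b μ P) :
    Eig n (b : ℂ) (μ : ℂ) (P.map ofRealHom) := by
  refine ⟨h.1.map _, ?_, ?_⟩
  · rw [natDegree_map]; exact h.2.1
  · have := congrArg (Polynomial.map ofRealHom) h.2.2
    simpa [Top_map] using this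

theorem Eig.of_map {n : ℕ} {b μ : ℝ} {P : ℝ[X]}
    (h : Eig n (b : ℂ) (μ : ℂ) (P.map ofRealHom)) : Eig n b μ P := by
  have inj : Function.Injective (Polynomial.map ofRealHom) :=
    Polynomial.map_injective _ ofRealHom.injective
  refine ⟨(Polynomial.monic_map_iff).mp h.1, ?_, ?_⟩
  · rw [← h.2.1, natDegree_map]
  · apply inj
    simpa [Top_map] using h.2.2

theorem ST2 {n : ℕ} {b : ℝ} {m : ℕ → ℝ} (hm : Rec b m) (h01 : ¬ (m 0 = 0 ∧ m 1 = 0))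
    (w : ℝ[X]) (hw0 : w ≠ 0) (hwd : w.natDegree ≤ n)
    (hw : ∀ Q : ℝ[X], Q.natDegree ≤ n → Lf m (w * Q) = 0) :
    ∃ μ P, Eig n b μ P ∧ Lf m P = 0 := by
  have hmC := hm.cm
  set M := cm m with hM
  -- the complex kernel
  let S : Submodule ℂ ℂ[X] :=
    { carrier := {u | u ∈ degreeLT ℂ (n+1) ∧ ∀ Q : ℂ[X], Q.natDegree ≤ n → Lf M (u * Q) = 0}
      add_mem' := by
        rintro u v ⟨hu, hu'⟩ ⟨hv, hv'⟩
        refine ⟨add_mem hu hv, fun Q hQ => ?_⟩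
        rw [add_mul, map_add, hu' Q hQ, hv' Q hQ, add_zero]
      zero_mem' := ⟨zero_mem _, fun Q _ => by simp⟩
      smul_mem' := by
        rintro c u ⟨hu, hu'⟩
        refine ⟨Submodule.smul_mem _ c hu, fun Q hQ => ?_⟩
        rw [smul_mul_assoc, map_smul, hu' Q hQ, smul_zero] }
  have hdeg : ∀ u : ℂ[X], u ∈ degreeLT ℂ (n+1) ↔ u.natDegree ≤ n := by
    intro u
    rw [mem_degreeLT, natDegree_le_iff_degree_le, ← Order.lt_succ_iff]
    rfl
  have hSle : S ≤ degreeLT ℂ (n+1) := fun u hu => hu.1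
  have : FiniteDimensional ℂ (degreeLT ℂ (n+1)) := inferInstance
  have : FiniteDimensional ℂ S := Submodule.finiteDimensional_of_le hSle
  have hwS : w.map ofRealHom ∈ S := by
    refine ⟨(hdeg _).mpr (natDegree_map_le.trans hwd), fun Q hQ => ?_⟩
    refine Lf_ker_of_pow (n := n) (fun k hk => ?_) Q hQ
    have : w.map ofRealHom * X ^ k = (w * X ^ k).map ofRealHom := by simp
    rw [this, Lf_cm, hw _ (by rw [natDegree_X_pow]; exact hk)]; simp
  have hwne : w.map ofRealHom ≠ 0 := by
    rwa [Ne, Polynomial.map_eq_zero]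
  have : Nontrivial S := ⟨⟨⟨_, hwS⟩, 0, fun h => hwne (congrArg Subtype.val h)⟩⟩
  have hinv : ∀ u ∈ S, TopL n (b : ℂ) u ∈ S := by
    rintro u ⟨hu, hu'⟩
    refine ⟨(hdeg _).mpr (Top_natDegree_le n _ u ((hdeg _).mp hu)), fun Q hQ => ?_⟩
    have := hmC.Lf_symm n Q u
    change Lf M (Top n (b:ℂ) u * Q) = 0
    rw [mul_comm, this]
    exact hu' _ (Top_natDegree_le n _ Q hQ)
  obtain ⟨c, hc⟩ := Module.End.exists_eigenvalue ((TopL n (b : ℂ)).restrict hinv)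
  obtain ⟨⟨u, huS⟩, hu⟩ := hc.exists_hasEigenvector
  have hu0 : u ≠ 0 := fun h => hu.2 (Subtype.ext h)
  have hu1 : Top n (b:ℂ) u = c • u := congrArg Subtype.val hu.apply_eq_smul
  have hE : Eig n (b:ℂ) (-c) (C u.leadingCoeff⁻¹ * u) := by
    refine eig_normalize hu0 ?_
    rw [hu1, smul_eq_C_mul, C_neg]; ring
  set P := C u.leadingCoeff⁻¹ * u with hPdef
  have hPk : ∀ Q : ℂ[X], Q.natDegree ≤ n → Lf M (P * Q) = 0 := by
    intro Q hQ
    rw [hPdef, mul_assoc, Lf_C_mul, huS.2 Q hQ, mul_zero]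
  have h01C : ¬ (M 0 = 0 ∧ M 1 = 0) := by
    simpa [hM, cm] using h01
  have hwP := ker_eq hE hmC hPk h01C (w.map ofRealHom) ((hdeg _).mp hwS.1) hwS.2
  set a := w.coeff n with ha
  have haC : (w.map ofRealHom).coeff n = (a : ℂ) := by simp [ha]
  rw [haC] at hwP
  have ha0 : a ≠ 0 := by
    intro h0; rw [h0] at hwP; simp at hwP; exact hw0 hwP
  have hPreal : P = (C a⁻¹ * w).map ofRealHom := by
    rw [Polynomial.map_mul, hwP, map_C, ← mul_assoc, ← C_mul]
    have : (ofRealHom a⁻¹ : ℂ) * (a : ℂ) = 1 := by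
      simp [ha0]
    rw [this, C_1, one_mul]
  set W := C a⁻¹ * w with hW
  -- eigenvalue is real
  have hmu : (c.im) = 0 := by
    have h1 := congrArg (fun q => q.coeff n) hE.2.2
    rw [hPreal, ← Top_map] at h1
    have h2 : W.coeff n = 1 := by
      rw [hW, coeff_C_mul, ← ha, inv_mul_cancel₀ ha0]
    simp only [coeff_add, coeff_C_mul, coeff_map, h2, coeff_zero, map_one, mul_one] at h1
    have := congrArg Complex.im h1
    simpa using this
  have hcr : -c = ((-c.re : ℝ) : ℂ) := by
    apply Complex.ext <;> simp [hmu]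
  rw [hPreal, hcr] at hE
  refine ⟨-c.re, W, hE.of_map, ?_⟩
  have := hPk 1 (by simp)
  rw [mul_one, hPreal, Lf_cm] at this
  exact_mod_cast this

/-- 1-dimensionality of the kernel -/
theorem ker_unique {n : ℕ} {b μ μ' : ℝ} {P P' : ℝ[X]} {m : ℕ → ℝ} (hm : Rec b m)
    (h01 : ¬ (m 0 = 0 ∧ m 1 = 0)) (hP : Eig n b μ P) (hP' : Eig n b μ' P')
    (h0 : Lf m P = 0) (h0' : Lf m P' = 0) : μ = μ' := by
  have hmC := hm.cm
  have h01C : ¬ (cm m 0 = 0 ∧ cm m 1 = 0) := by simpa [cm] using h01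
  have k1 := ST1 hP.map hmC (by rw [Lf_cm, h0]; simp)
  have k2 := ST1 hP'.map hmC (by rw [Lf_cm, h0']; simp)
  have e := ker_eq hP.map hmC k1 h01C (P'.map ofRealHom) hP'.map.2.1.le k2
  have h2 : (P'.map ofRealHom).coeff n = 1 := by
    have := hP'.map.1.coeff_natDegree; rwa [hP'.map.2.1] at this
  rw [h2, C_1, one_mul] at e
  have e' : P' = P := Polynomial.map_injective _ ofRealHom.injective e
  subst e'
  have h3 : C μ * P' = C μ' * P' := by
    linear_combination hP.2.2 - hP'.2.2
  have := mul_right_cancel₀ hP.1.ne_zero h3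
  exact C_injective this

end QES


namespace QES

def PosMat {ι : Type*} [Fintype ι] (A : ι → ι → ℝ) : Prop :=
  ∀ c : ι → ℝ, c ≠ 0 → 0 < ∑ i, ∑ j, c i * c j * A i j

theorem PosMat.isOpen {ι : Type*} [Fintype ι] : IsOpen {A : ι → ι → ℝ | PosMat A} := by
  rw [isOpen_iff_eventually]
  intro A0 hA0
  have hK : IsCompact (Metric.sphere (0 : ι → ℝ) 1) := isCompact_sphere 0 1
  have h1 : ∀ᶠ A in nhds A0, ∀ c ∈ Metric.sphere (0 : ι → ℝ) 1,
      0 < ∑ i, ∑ j, c i * c j * A i j := by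
    refine hK.eventually_forall_of_forall_eventually fun c hc => ?_
    have hcont : Continuous fun z : (ι → ι → ℝ) × (ι → ℝ) =>
        ∑ i, ∑ j, z.2 i * z.2 j * z.1 i j := by fun_prop
    refine (hcont.tendsto (A0, c)).eventually_const_lt ?_
    apply hA0
    intro h0
    have h0' : c = 0 := h0
    rw [h0'] at hc; simp at hc
  filter_upwards [h1] with A hA c hc
  have hn : 0 < ‖c‖ := norm_pos_iff.mpr hc
  have h2 := hA (‖c‖⁻¹ • c) (by simp [norm_smul, hn.ne'])
  have h3 : ∑ i, ∑ j, (‖c‖⁻¹ • c) i * (‖c‖⁻¹ • c) j * A i j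
      = ‖c‖⁻¹ ^ 2 * ∑ i, ∑ j, c i * c j * A i j := by
    simp only [Finset.mul_sum, Pi.smul_apply, smul_eq_mul]
    refine Finset.sum_congr rfl fun i _ => Finset.sum_congr rfl fun j _ => ?_
    ring
  rw [h3] at h2
  exact pos_of_mul_pos_right h2 (by positivity)

theorem PosMat.comp {ι κ : Type*} [Fintype ι] [Fintype κ] {A : ι → ι → ℝ} (hA : PosMat A)
    (f : κ → ι) (hf : Function.Injective f) : PosMat (fun i j => A (f i) (f j)) := by
  classical
  intro c hc
  have h := hA (Function.extend f c 0) (by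
    intro h0
    apply hc
    funext i
    have := congrFun h0 (f i)
    rwa [hf.extend_apply] at this)
  have key : ∀ g : ι → ℝ, ∑ i, Function.extend f c 0 i * g i = ∑ i, c i * g (f i) := by
    intro g
    have h1 : ∑ i, c i * g (f i) = ∑ i ∈ Finset.univ.image f, Function.extend f c 0 i * g i := by
      rw [Finset.sum_image (fun a _ b _ h => hf h)]
      simp [hf.extend_apply]
    rw [h1]
    symm
    apply Finset.sum_subset (Finset.subset_univ _)
    intro x _ hx
    rw [Function.extend_apply']
    · simp
    · rintro ⟨a, rfl⟩
      exact hx (by simp)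
  have e : ∑ i, ∑ j, Function.extend f c 0 i * Function.extend f c 0 j * A i j
      = ∑ i, ∑ j, c i * c j * A (f i) (f j) := by
    have e1 : ∀ i, ∑ j, Function.extend f c 0 i * Function.extend f c 0 j * A i j
        = Function.extend f c 0 i * ∑ j, c j * A i (f j) := by
      intro i
      rw [← key, Finset.mul_sum]
      refine Finset.sum_congr rfl fun j _ => by ring
    rw [Finset.sum_congr rfl fun i _ => e1 i, key]
    refine Finset.sum_congr rfl fun i _ => ?_
    rw [Finset.mul_sum]
    refine Finset.sum_congr rfl fun j _ => by ring
  rwa [e] at h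

theorem posMat_diag {ι : Type*} [Fintype ι] {A : ι → ι → ℝ}
    (h0 : ∀ i j, i ≠ j → A i j = 0) (h1 : ∀ i, 0 < A i i) : PosMat A := by
  classical
  intro c hc
  have e : ∑ i, ∑ j, c i * c j * A i j = ∑ i, c i ^ 2 * A i i := by
    refine Finset.sum_congr rfl fun i _ => ?_
    rw [Finset.sum_eq_single i]
    · ring
    · intro j _ hj; rw [h0 i j hj.symm]; ring
    · simp
  rw [e]
  obtain ⟨i, hi⟩ : ∃ i, c i ≠ 0 := by
    by_contra h; push Not at h; exact hc (funext h)
  refine Finset.sum_pos' (fun j _ => mul_nonneg (sq_nonneg _) (h1 j).le) ⟨i, Finset.mem_univ _, ?_⟩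
  have := h1 i
  positivity

theorem PosMat.scale {ι : Type*} [Fintype ι] {A : ι → ι → ℝ} (hA : PosMat A) {r : ℝ} (hr : 0 < r) :
    PosMat (fun i j => r * A i j) := by
  intro c hc
  have := hA c hc
  have e : ∑ i, ∑ j, c i * c j * (r * A i j) = r * ∑ i, ∑ j, c i * c j * A i j := by
    simp only [Finset.mul_sum]
    refine Finset.sum_congr rfl fun i _ => Finset.sum_congr rfl fun j _ => by ring
  rw [e]; positivity

/-- the form of `m` on polynomials of degree `≤ n` is positive definite on some
`k`-dimensional subspace. -/
def Pge (n : ℕ) (m : ℕ → ℝ) (k : ℕ) : Prop :=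
  ∃ e : Fin k → ℝ[X], (∀ i, (e i).natDegree ≤ n) ∧ PosMat (fun i j => Lf m (e i * e j))

theorem Pge_of {ι : Type*} [Fintype ι] {n : ℕ} {m : ℕ → ℝ} {k : ℕ} (hk : k ≤ Fintype.card ι)
    (e : ι → ℝ[X]) (he : ∀ i, (e i).natDegree ≤ n)
    (hp : PosMat (fun i j => Lf m (e i * e j))) : Pge n m k := by
  have : Fintype.card (Fin k) ≤ Fintype.card ι := by simpa using hk
  obtain ⟨f⟩ := Function.Embedding.nonempty_of_card_le this
  exact ⟨fun i => e (f i), fun i => he _, hp.comp f f.injective⟩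

theorem Pge.mono {n : ℕ} {m : ℕ → ℝ} {k k' : ℕ} (h : Pge n m k) (hk : k' ≤ k) : Pge n m k' := by
  obtain ⟨e, h1, h2⟩ := h
  exact Pge_of (by simpa using hk) e h1 h2

theorem Pge.scale {n : ℕ} {m : ℕ → ℝ} {k : ℕ} (h : Pge n m k) {r : ℝ} (hr : 0 < r) :
    Pge n (r • m) k := by
  obtain ⟨e, h1, h2⟩ := h
  refine ⟨e, h1, ?_⟩
  simp only [Lf_smul_mom]
  exact h2.scale hr

theorem continuous_Lf (P : ℝ[X]) : Continuous (fun m : ℕ → ℝ => Lf m P) := by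
  have : (fun m : ℕ → ℝ => Lf m P) =
      fun m : ℕ → ℝ => ∑ k ∈ Finset.range (P.natDegree + 1), P.coeff k * m k := by
    funext m; exact Lf_eq_sum _ _ _ (Nat.lt_succ_self _)
  rw [this]; fun_prop

theorem Pge.isOpen (n k : ℕ) : IsOpen {m : ℕ → ℝ | Pge n m k} := by
  rw [isOpen_iff_mem_nhds]
  rintro m ⟨e, h1, h2⟩
  have hc : Continuous (fun m : ℕ → ℝ => fun i j => Lf m (e i * e j)) := by
    refine continuous_pi fun i => continuous_pi fun j => continuous_Lf _
  filter_upwards [hc.continuousAt.preimage_mem_nhds (PosMat.isOpen.mem_nhds h2)] with m' hm'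
  exact ⟨e, h1, hm'⟩

theorem Lf_sq_sum {ι : Type*} [Fintype ι] (m : ℕ → ℝ) (e : ι → ℝ[X]) (c : ι → ℝ) :
    Lf m ((∑ i, c i • e i) * (∑ i, c i • e i)) = ∑ i, ∑ j, c i * c j * Lf m (e i * e j) := by
  rw [Finset.sum_mul_sum, map_sum]
  refine Finset.sum_congr rfl fun i _ => ?_
  rw [map_sum]
  refine Finset.sum_congr rfl fun j _ => ?_
  rw [smul_mul_smul_comm, map_smul, smul_eq_mul]

theorem PosMat.sq {ι : Type*} [Fintype ι] {m : ℕ → ℝ} {e : ι → ℝ[X]}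
    (h : PosMat (fun i j => Lf m (e i * e j))) (c : ι → ℝ) :
    0 ≤ Lf m ((∑ i, c i • e i) * (∑ i, c i • e i)) ∧
      (Lf m ((∑ i, c i • e i) * (∑ i, c i • e i)) = 0 → c = 0) := by
  by_cases hc : c = 0
  · subst hc; simp
  · have := h c hc
    rw [Lf_sq_sum]
    exact ⟨this.le, fun h0 => absurd h0 this.ne'⟩

def KerEl (n : ℕ) (m : ℕ → ℝ) (w : ℝ[X]) : Prop :=
  ∀ Q : ℝ[X], Q.natDegree ≤ n → Lf m (w * Q) = 0

theorem mem_degreeLT' {K : Type*} [Field K] {n : ℕ} {u : K[X]} :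
    u ∈ degreeLT K (n+1) ↔ u.natDegree ≤ n := by
  rw [mem_degreeLT, natDegree_le_iff_degree_le, ← Order.lt_succ_iff]
  rfl

theorem finrank_degLT (n : ℕ) : Module.finrank ℝ (degreeLT ℝ (n+1)) = n + 1 := by
  rw [(degreeLTEquiv ℝ (n+1)).finrank_eq]; simp

theorem natDegree_lincomb {ι : Type*} [Fintype ι] {n : ℕ} (e : ι → ℝ[X])
    (he : ∀ i, (e i).natDegree ≤ n) (c : ι → ℝ) : (∑ i, c i • e i).natDegree ≤ n := by
  rw [← mem_degreeLT']
  exact Submodule.sum_mem _ fun i _ => Submodule.smul_mem _ _ (mem_degreeLT'.mpr (he i))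

theorem F0gen {n : ℕ} {m : ℕ → ℝ} {j k r : ℕ} (hj : Pge n m j) (hk : Pge n (-m) k)
    (w : Fin r → ℝ[X]) (hw : LinearIndependent ℝ w) (hwd : ∀ i, (w i).natDegree ≤ n)
    (hwk : ∀ i, KerEl n m (w i)) : j + k + r ≤ n + 1 := by
  obtain ⟨e, he, hpe⟩ := hj
  obtain ⟨f, hf, hpf⟩ := hk
  have hli : LinearIndependent ℝ (Sum.elim (Sum.elim e f) w) := by
    rw [Fintype.linearIndependent_iff]
    intro g hg
    rw [Fintype.sum_sum_type, Fintype.sum_sum_type] at hg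
    simp only [Sum.elim_inl, Sum.elim_inr] at hg
    set u := ∑ i, g (Sum.inl (Sum.inl i)) • e i with hu
    set v := ∑ i, g (Sum.inl (Sum.inr i)) • f i with hv
    set x := ∑ i, g (Sum.inr i) • w i with hx
    have hud : u.natDegree ≤ n := natDegree_lincomb e he _
    have hvd : v.natDegree ≤ n := natDegree_lincomb f hf _
    have hxk : ∀ Q : ℝ[X], Q.natDegree ≤ n → Lf m (x * Q) = 0 := by
      intro Q hQ
      rw [hx, Finset.sum_mul, map_sum]
      refine Finset.sum_eq_zero fun i _ => ?_
      rw [smul_mul_assoc, map_smul, hwk i Q hQ, smul_zero]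
    have hxe : x = -u - v := by linear_combination hg
    have h1 : Lf m (u * u) = Lf m (v * v) := by
      have a := hxk u hud
      have c := hxk v hvd
      rw [hxe] at a c
      have a' : (-u - v) * u = -(u*u) - v * u := by ring
      have c' : (-u - v) * v = -(v * u) - v * v := by ring
      rw [a', map_sub, map_neg] at a
      rw [c', map_sub, map_neg] at c
      linarith
    have hu0 : (fun i => g (Sum.inl (Sum.inl i))) = 0 ∧ (fun i => g (Sum.inl (Sum.inr i))) = 0 := by
      have hu1 := PosMat.sq hpe (fun i => g (Sum.inl (Sum.inl i)))
      have hv1 := PosMat.sq hpf (fun i => g (Sum.inl (Sum.inr i)))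
      rw [Lf_neg_mom] at hv1
      change 0 ≤ Lf m (u * u) ∧ (Lf m (u * u) = 0 → _) at hu1
      change 0 ≤ - Lf m (v * v) ∧ (- Lf m (v * v) = 0 → _) at hv1
      exact ⟨hu1.2 (by linarith [hu1.1, hv1.1]), hv1.2 (by linarith [hu1.1, hv1.1])⟩
    have hx0 : x = 0 := by
      have a : u = 0 := by
        rw [hu]; refine Finset.sum_eq_zero fun i _ => ?_
        have := congrFun hu0.1 i
        simp only [Pi.zero_apply] at this
        rw [this, zero_smul]
      have c : v = 0 := by
        rw [hv]; refine Finset.sum_eq_zero fun i _ => ?_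
        have := congrFun hu0.2 i
        simp only [Pi.zero_apply] at this
        rw [this, zero_smul]
      rw [hxe, a, c]; simp
    have hx1 := Fintype.linearIndependent_iff.mp hw _ hx0
    rintro ((i | i) | i)
    · exact congrFun hu0.1 i
    · exact congrFun hu0.2 i
    · exact hx1 i
  have hmem : ∀ i, Sum.elim (Sum.elim e f) w i ∈ degreeLT ℝ (n+1) := by
    rintro ((i | i) | i)
    · exact mem_degreeLT'.mpr (he i)
    · exact mem_degreeLT'.mpr (hf i)
    · exact mem_degreeLT'.mpr (hwd i)
  have hli' : LinearIndependent ℝ (fun i => (⟨_, hmem i⟩ : degreeLT ℝ (n+1))) :=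
    LinearIndependent.of_comp (degreeLT ℝ (n+1)).subtype hli
  have := hli'.fintype_card_le_finrank
  rw [finrank_degLT] at this
  simpa using this

theorem F0 {n : ℕ} {m : ℕ → ℝ} {j k : ℕ} (hj : Pge n m j) (hk : Pge n (-m) k) :
    j + k ≤ n + 1 :=
  F0gen (r := 0) hj hk Fin.elim0 (linearIndependent_empty_type) (fun i => i.elim0) (fun i => i.elim0)

theorem F0ker {n : ℕ} {m : ℕ → ℝ} {j k : ℕ} (hj : Pge n m j) (hk : Pge n (-m) k)
    {w : ℝ[X]} (hw0 : w ≠ 0) (hwd : w.natDegree ≤ n) (hwk : KerEl n m w) :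
    j + k ≤ n := by
  have := F0gen (r := 1) hj hk (fun _ => w)
    (LinearIndependent.of_subsingleton 0 hw0) (fun i => hwd) (fun i => hwk)
  omega

theorem F3 {n : ℕ} {m : ℕ → ℝ}
    (hnd : ∀ w : ℝ[X], w.natDegree ≤ n → KerEl n m w → w = 0) :
    ∃ j k, j + k = n + 1 ∧ Pge n m j ∧ Pge n (-m) k := by
  classical
  let B : LinearMap.BilinForm ℝ (degreeLT ℝ (n+1)) :=
    LinearMap.mk₂ ℝ (fun u v => Lf m ((u : ℝ[X]) * v))
      (fun u v w => by simp [add_mul]) (fun c u v => by simp)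
      (fun u v w => by simp [mul_add]) (fun c u v => by simp)
  have hB : ∀ u v, B u v = Lf m ((u : ℝ[X]) * v) := fun u v => rfl
  have hsymm : LinearMap.IsSymm B := ⟨fun u v => by simp [hB, mul_comm]⟩
  obtain ⟨v, hv⟩ := LinearMap.BilinForm.exists_orthogonal_basis hsymm
  have ho : ∀ i j, i ≠ j → Lf m ((v i : ℝ[X]) * v j) = 0 := fun i j hij => hv hij
  have hd : ∀ i, ((v i : degreeLT ℝ (n+1)) : ℝ[X]).natDegree ≤ n := fun i => mem_degreeLT'.mp (v i).2
  have hne : ∀ i, Lf m ((v i : ℝ[X]) * v i) ≠ 0 := by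
    intro i hi
    have h1 : ((v i : degreeLT ℝ (n+1)) : ℝ[X]) = 0 := by
      refine hnd _ (hd i) fun Q hQ => ?_
      have h2 : ∀ q : degreeLT ℝ (n+1), B (v i) q = 0 := by
        intro q
        rw [← v.sum_repr q, map_sum]
        refine Finset.sum_eq_zero fun j _ => ?_
        rw [map_smul]
        by_cases e : i = j
        · subst e; rw [hB, hi, smul_zero]
        · rw [hB, ho i j e, smul_zero]
      exact h2 ⟨Q, mem_degreeLT'.mpr hQ⟩
    exact v.ne_zero i (Subtype.ext h1)
  let J := {i // 0 < Lf m ((v i : ℝ[X]) * v i)}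
  let J' := {i // ¬ 0 < Lf m ((v i : ℝ[X]) * v i)}
  refine ⟨Fintype.card J, Fintype.card J', ?_, ?_, ?_⟩
  · have h1 := Fintype.card_subtype_compl (fun i => 0 < Lf m ((v i : ℝ[X]) * v i))
    have h2 := Fintype.card_subtype_le (fun i => 0 < Lf m ((v i : ℝ[X]) * v i))
    rw [Fintype.card_fin] at h1 h2
    have h3 := finrank_degLT n
    change Fintype.card J' = Module.finrank ℝ (degreeLT ℝ (n+1)) - Fintype.card J at h1
    change Fintype.card J ≤ Module.finrank ℝ (degreeLT ℝ (n+1)) at h2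
    omega
  · refine Pge_of le_rfl (fun i : J => ((v i.1 : degreeLT ℝ (n+1)) : ℝ[X])) (fun i => hd _) ?_
    refine posMat_diag (fun i j hij => ho _ _ (fun h => hij (Subtype.ext h))) (fun i => i.2)
  · refine Pge_of le_rfl (fun i : J' => ((v i.1 : degreeLT ℝ (n+1)) : ℝ[X])) (fun i => hd _) ?_
    refine posMat_diag (fun i j hij => ?_) (fun i => ?_)
    · rw [Lf_neg_mom, ho _ _ (fun h => hij (Subtype.ext h)), neg_zero]
    · rw [Lf_neg_mom]
      have h1 := i.2
      have h2 := hne i.1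
      have : Lf m ((v i.1 : ℝ[X]) * v i.1) < 0 := lt_of_le_of_ne (not_lt.mp h1) h2
      linarith

theorem hasDerivAt_Lf {M : ℝ → ℕ → ℝ} {d : ℕ → ℝ} {s0 : ℝ}
    (hd : ∀ k, HasDerivAt (fun s => M s k) (d k) s0) (P : ℝ[X]) :
    HasDerivAt (fun s => Lf (M s) P) (Lf d P) s0 := by
  have e : (fun s => Lf (M s) P) =
      fun s => ∑ k ∈ Finset.range (P.natDegree + 1), P.coeff k * M s k := by
    funext s; exact Lf_eq_sum _ _ _ (Nat.lt_succ_self _)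
  rw [e, Lf_eq_sum _ _ _ (Nat.lt_succ_self _)]
  exact HasDerivAt.fun_sum fun k _ => (hd k).const_mul _

theorem F4 {n : ℕ} {M : ℝ → ℕ → ℝ} {d : ℕ → ℝ} {s0 : ℝ}
    (hd : ∀ k, HasDerivAt (fun s => M s k) (d k) s0) {v : ℝ[X]} (hvd : v.natDegree ≤ n)
    (hvk : KerEl n (M s0) v) (hpos : 0 < Lf d (v * v)) {j : ℕ} (hj : Pge n (M s0) j) :
    ∀ᶠ s in nhdsWithin s0 (Set.Ioi s0), Pge n (M s) (j + 1) := by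
  obtain ⟨e, he, hp⟩ := hj
  let e' : ℝ → Option (Fin j) → ℝ[X] := fun s i =>
    Option.elim i ((Real.sqrt (s - s0))⁻¹ • v) e
  let A0 : Option (Fin j) → Option (Fin j) → ℝ := fun i k =>
    Option.elim i (Option.elim k (Lf d (v * v)) (fun _ => 0))
      (fun i => Option.elim k 0 (fun k => Lf (M s0) (e i * e k)))
  have hA0 : PosMat A0 := by
    intro c hc
    have ex : ∑ i, ∑ k, c i * c k * A0 i k = c none ^ 2 * Lf d (v * v)
        + ∑ i, ∑ k, c (some i) * c (some k) * Lf (M s0) (e i * e k) := by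
      simp only [Fintype.sum_option, A0, Option.elim, mul_zero, Finset.sum_const_zero, add_zero,
        zero_add]
      ring
    rw [ex]
    by_cases h0 : (fun i => c (some i)) = 0
    · have h1 : c none ≠ 0 := by
        intro h1; apply hc; funext i
        rcases i with _ | i
        · exact h1
        · exact congrFun h0 i
      have h2 : ∀ i, c (some i) = 0 := fun i => congrFun h0 i
      simp only [h2]
      simp
      positivity
    · have := hp _ h0
      have h2 : 0 ≤ c none ^ 2 * Lf d (v * v) := by positivity
      linarith
  have hslope : ∀ P : ℝ[X], Tendsto (fun s => (s - s0)⁻¹ * (Lf (M s) P - Lf (M s0) P))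
      (nhdsWithin s0 (Set.Ioi s0)) (nhds (Lf d P)) := by
    intro P
    have h1 := hasDerivAt_iff_tendsto_slope.mp (hasDerivAt_Lf hd P)
    have h2 := h1.mono_left (nhdsWithin_mono s0 (fun x (hx : s0 < x) => (ne_of_gt hx : x ≠ s0)))
    refine h2.congr fun s => ?_
    simp [slope, vsub_eq_sub]
  have hker0 : ∀ i, Lf (M s0) (v * e i) = 0 := fun i => hvk _ (he i)
  have hT : Tendsto (fun s => fun i k => Lf (M s) (e' s i * e' s k))
      (nhdsWithin s0 (Set.Ioi s0)) (nhds A0) := by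
    have hsq : Tendsto (fun s => Real.sqrt (s - s0)) (nhdsWithin s0 (Set.Ioi s0)) (nhds 0) := by
      have : Continuous fun s => Real.sqrt (s - s0) := by fun_prop
      have h := this.tendsto s0
      simp only [sub_self, Real.sqrt_zero] at h
      exact h.mono_left nhdsWithin_le_nhds
    have hcross : ∀ i, Tendsto (fun s => (Real.sqrt (s - s0))⁻¹ * Lf (M s) (v * e i))
        (nhdsWithin s0 (Set.Ioi s0)) (nhds 0) := by
      intro i
      have h := hsq.mul (hslope (v * e i))
      rw [zero_mul] at h
      refine h.congr' ?_
      filter_upwards [self_mem_nhdsWithin] with s hs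
      have hs' : 0 < s - s0 := sub_pos.mpr hs
      have h3 : Real.sqrt (s - s0) * (s - s0)⁻¹ = (Real.sqrt (s - s0))⁻¹ := by
        have h4 := Real.mul_self_sqrt hs'.le
        have h5 : Real.sqrt (s - s0) ≠ 0 := (Real.sqrt_pos.mpr hs').ne'
        rw [← div_eq_mul_inv, div_eq_iff hs'.ne', eq_comm, inv_mul_eq_iff_eq_mul₀ h5, h4]
      rw [hker0, sub_zero, ← mul_assoc, h3]
    rw [tendsto_pi_nhds]; intro i
    rw [tendsto_pi_nhds]; intro k
    rcases i with _ | i <;> rcases k with _ | k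
    · have h := hslope (v * v)
      rw [hvk v hvd] at h
      change Tendsto _ _ (nhds (Lf d (v * v)))
      refine h.congr' ?_
      filter_upwards [self_mem_nhdsWithin] with s hs
      have hs' : 0 < s - s0 := sub_pos.mpr hs
      change _ = Lf (M s) (((Real.sqrt (s - s0))⁻¹ • v) * ((Real.sqrt (s - s0))⁻¹ • v))
      rw [smul_mul_smul_comm, map_smul, smul_eq_mul, ← mul_inv, Real.mul_self_sqrt hs'.le, sub_zero]
    · refine (hcross k).congr fun s => ?_
      change _ = Lf (M s) (((Real.sqrt (s - s0))⁻¹ • v) * e k)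
      rw [smul_mul_assoc, map_smul, smul_eq_mul]
    · refine (hcross i).congr fun s => ?_
      change _ = Lf (M s) (e i * ((Real.sqrt (s - s0))⁻¹ • v))
      rw [mul_comm (e i), smul_mul_assoc, map_smul, smul_eq_mul]
    · exact ((hasDerivAt_Lf hd (e i * e k)).continuousAt.tendsto).mono_left nhdsWithin_le_nhds
  filter_upwards [hT (PosMat.isOpen.mem_nhds hA0)] with s hs
  refine Pge_of (by simp) (e' s) ?_ hs
  rintro (_ | i)
  · exact (natDegree_smul_le _ _).trans hvd
  · exact he i

theorem KerEl.neg {n : ℕ} {m : ℕ → ℝ} {w : ℝ[X]} (h : KerEl n m w) : KerEl n (-m) w := by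
  intro Q hQ; rw [Lf_neg_mom, h Q hQ, neg_zero]

theorem F4left {n : ℕ} {M : ℝ → ℕ → ℝ} {d : ℕ → ℝ} {s0 : ℝ}
    (hd : ∀ k, HasDerivAt (fun s => M s k) (d k) s0) {v : ℝ[X]} (hvd : v.natDegree ≤ n)
    (hvk : KerEl n (M s0) v) (hpos : 0 < Lf d (v * v)) {j : ℕ} (hj : Pge n (-M s0) j) :
    ∀ᶠ s in nhdsWithin s0 (Set.Iio s0), Pge n (-M s) (j + 1) := by
  have hd' : ∀ k, HasDerivAt (fun s => (fun s => -M (-s)) s k) (d k) (-s0) := by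
    intro k
    have h1 : HasDerivAt (fun s => M s k) (d k) (-(-s0)) := by rw [neg_neg]; exact hd k
    have h2 := (h1.comp (-s0) (hasDerivAt_neg (-s0))).neg
    have h3 : - (d k * -1) = d k := by ring
    rw [h3] at h2
    exact h2
  have := F4 hd' hvd (by simpa using hvk.neg) hpos (j := j) (by simpa using hj)
  have ht : Tendsto (fun s : ℝ => -s) (nhdsWithin s0 (Set.Iio s0)) (nhdsWithin (-s0) (Set.Ioi (-s0))) :=
    tendsto_neg_nhdsLT
  filter_upwards [ht.eventually this] with s hs
  simpa using hs

end QES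


namespace QES

/-- number of real zeros -/
noncomputable def nreal (P : ℂ[X]) : ℕ := {z : ℂ | P.eval z = 0 ∧ z.im = 0}.ncard

noncomputable def rp (q : ℂ[X]) : ℝ[X] :=
  ∑ k ∈ Finset.range (q.natDegree + 1), monomial k (q.coeff k).re

noncomputable def ip (q : ℂ[X]) : ℝ[X] :=
  ∑ k ∈ Finset.range (q.natDegree + 1), monomial k (q.coeff k).im

theorem rp_coeff (q : ℂ[X]) (k : ℕ) : (rp q).coeff k = (q.coeff k).re := by
  rw [rp, finsetSum_coeff]
  simp only [coeff_monomial]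
  rw [Finset.sum_ite_eq' (Finset.range (q.natDegree + 1)) k]
  split_ifs with h
  · rfl
  · rw [coeff_eq_zero_of_natDegree_lt (by simpa using h)]; simp

theorem ip_coeff (q : ℂ[X]) (k : ℕ) : (ip q).coeff k = (q.coeff k).im := by
  rw [ip, finsetSum_coeff]
  simp only [coeff_monomial]
  rw [Finset.sum_ite_eq' (Finset.range (q.natDegree + 1)) k]
  split_ifs with h
  · rfl
  · rw [coeff_eq_zero_of_natDegree_lt (by simpa using h)]; simp

theorem rp_natDegree (q : ℂ[X]) : (rp q).natDegree ≤ q.natDegree := by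
  rw [natDegree_le_iff_coeff_eq_zero]
  intro k hk
  rw [rp_coeff, coeff_eq_zero_of_natDegree_lt hk]; simp

theorem ip_natDegree (q : ℂ[X]) : (ip q).natDegree ≤ q.natDegree := by
  rw [natDegree_le_iff_coeff_eq_zero]
  intro k hk
  rw [ip_coeff, coeff_eq_zero_of_natDegree_lt hk]; simp

theorem rp_map (q : ℂ[X]) :
    (rp q).map ofRealHom = C (1/2 : ℂ) * (q + q.map (starRingEnd ℂ)) := by
  ext k
  rw [coeff_map, rp_coeff, coeff_C_mul, coeff_add, coeff_map]
  have := Complex.add_conj (q.coeff k)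
  rw [this]; simp

theorem ip_map (q : ℂ[X]) :
    (ip q).map ofRealHom = C (-I/2 : ℂ) * (q - q.map (starRingEnd ℂ)) := by
  ext k
  rw [coeff_map, ip_coeff, coeff_C_mul, coeff_sub, coeff_map]
  have := Complex.sub_conj (q.coeff k)
  rw [this]
  have h2 : I * I = -1 := I_mul_I
  simp
  linear_combination ((q.coeff k).im : ℂ) * h2

theorem map_conj_real (P : ℝ[X]) : (P.map ofRealHom).map (starRingEnd ℂ) = P.map ofRealHom := by
  ext k; simp

theorem eval_conj_real (P : ℝ[X]) (z : ℂ) (hz : (P.map ofRealHom).eval z = 0) :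
    (P.map ofRealHom).eval ((starRingEnd ℂ) z) = 0 := by
  have h : (P.map ofRealHom).eval ((starRingEnd ℂ) z)
      = (starRingEnd ℂ) ((P.map ofRealHom).eval z) := by
    conv_lhs => rw [← map_conj_real]
    rw [eval_map, eval₂_at_apply]
  rw [h, hz, map_zero]

theorem rq_conj (P : ℝ[X]) (z : ℂ) (hz : (P.map ofRealHom).eval z = 0) :
    (rq (P.map ofRealHom) z).map (starRingEnd ℂ) = rq (P.map ofRealHom) ((starRingEnd ℂ) z) := by
  have h1 := congrArg (Polynomial.map (starRingEnd ℂ)) (rq_mul hz)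
  rw [map_conj_real, Polynomial.map_mul, Polynomial.map_sub, map_X, map_C] at h1
  have h2 := rq_mul (eval_conj_real P z hz)
  exact mul_left_cancel₀ (X_sub_C_ne_zero _) (h1.trans h2.symm)

theorem kap_cm (m : ℕ → ℝ) (P : ℝ[X]) : kap (cm m) (P.map ofRealHom) = ((kap m P : ℝ) : ℂ) := by
  have : X * (P.map ofRealHom) ^ 2 = (X * P ^ 2).map ofRealHom := by simp
  rw [kap, this, Lf_cm, kap]; simp

section
variable {n : ℕ} {b μ : ℝ} {P : ℝ[X]} {m : ℕ → ℝ}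

theorem Lrr (h : Eig n b μ P) (hm : Rec b m)
    (h0 : Lf m P = 0) {z w : ℂ} (hz : (P.map ofRealHom).eval z = 0)
    (hw : (P.map ofRealHom).eval w = 0) :
    (z ≠ w → z ≠ (starRingEnd ℂ) w →
      Lf m (rp (rq (P.map ofRealHom) z) * rp (rq (P.map ofRealHom) w)) = 0 ∧
      Lf m (ip (rq (P.map ofRealHom) z) * ip (rq (P.map ofRealHom) w)) = 0) ∧
    (z = (starRingEnd ℂ) z →
      Lf m (rp (rq (P.map ofRealHom) z) * rp (rq (P.map ofRealHom) z)) = kap m P) ∧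
    (z ≠ (starRingEnd ℂ) z →
      Lf m (rp (rq (P.map ofRealHom) z) * rp (rq (P.map ofRealHom) z)) = kap m P / 2 ∧
      Lf m (ip (rq (P.map ofRealHom) z) * ip (rq (P.map ofRealHom) z)) = - kap m P / 2) := by
  have k1 := ST1 h.map hm.cm (by rw [Lf_cm, h0]; simp)
  have hzc := eval_conj_real P z hz
  have hwc := eval_conj_real P w hw
  have cz := rq_conj P z hz
  have cw := rq_conj P w hw
  have orth := fun (a c : ℂ) (ha : (P.map ofRealHom).eval a = 0) (hc : (P.map ofRealHom).eval c = 0) =>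
    rq_orth h.map k1 (z := a) (w := c) ha hc
  have sq := fun (a : ℂ) (ha : (P.map ofRealHom).eval a = 0) => rq_sq h.map hm.cm k1 (z := a) ha
  rw [kap_cm] at sq
  have e1 : ∀ q1 q2 : ℂ[X], ((Lf m (rp q1 * rp q2) : ℝ) : ℂ) = 1/4 *
      (Lf (cm m) (q1 * q2) + Lf (cm m) (q1 * q2.map (starRingEnd ℂ))
        + Lf (cm m) (q1.map (starRingEnd ℂ) * q2)
        + Lf (cm m) (q1.map (starRingEnd ℂ) * q2.map (starRingEnd ℂ))) := by
    intro q1 q2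
    rw [← Lf_cm, Polynomial.map_mul, rp_map, rp_map]
    have : (C (1/2 : ℂ) * (q1 + q1.map (starRingEnd ℂ))) * (C (1/2 : ℂ) * (q2 + q2.map (starRingEnd ℂ)))
      = C (1/4 : ℂ) * (q1 * q2 + q1 * q2.map (starRingEnd ℂ) + q1.map (starRingEnd ℂ) * q2
        + q1.map (starRingEnd ℂ) * q2.map (starRingEnd ℂ)) := by
      have : (C (1/4 : ℂ)) = C (1/2) * C (1/2) := by rw [← C_mul]; norm_num
      rw [this]; ring
    rw [this, Lf_C_mul]; simp only [map_add]
  have e2 : ∀ q1 q2 : ℂ[X], ((Lf m (ip q1 * ip q2) : ℝ) : ℂ) = -1/4 *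
      (Lf (cm m) (q1 * q2) - Lf (cm m) (q1 * q2.map (starRingEnd ℂ))
        - Lf (cm m) (q1.map (starRingEnd ℂ) * q2)
        + Lf (cm m) (q1.map (starRingEnd ℂ) * q2.map (starRingEnd ℂ))) := by
    intro q1 q2
    rw [← Lf_cm, Polynomial.map_mul, ip_map, ip_map]
    have : (C (-I/2 : ℂ) * (q1 - q1.map (starRingEnd ℂ))) * (C (-I/2 : ℂ) * (q2 - q2.map (starRingEnd ℂ)))
      = C (-1/4 : ℂ) * (q1 * q2 - q1 * q2.map (starRingEnd ℂ) - q1.map (starRingEnd ℂ) * q2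
        + q1.map (starRingEnd ℂ) * q2.map (starRingEnd ℂ)) := by
      have : (C (-1/4 : ℂ)) = C (-I/2) * C (-I/2) := by
        rw [← C_mul]; congr 1
        linear_combination (-1/4) * I_mul_I
      rw [this]; ring
    rw [this, Lf_C_mul]; simp only [map_add, map_sub]
  refine ⟨fun h1 h2 => ?_, fun h1 => ?_, fun h1 => ?_⟩
  · have h3 : (starRingEnd ℂ) z ≠ w := by
      intro h; apply h2; rw [← h, Complex.conj_conj]
    have h4 : (starRingEnd ℂ) z ≠ (starRingEnd ℂ) w := fun h => h1 ((starRingEnd ℂ).injective h)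
    have o1 := orth z w hz hw h1
    have o2 := orth z _ hz hwc h2
    have o3 := orth _ w hzc hw h3
    have o4 := orth _ _ hzc hwc h4
    constructor
    · have := e1 (rq (P.map ofRealHom) z) (rq (P.map ofRealHom) w)
      rw [cz, cw, o1, o2, o3, o4] at this
      simp only [add_zero, mul_zero] at this
      exact_mod_cast this
    · have := e2 (rq (P.map ofRealHom) z) (rq (P.map ofRealHom) w)
      rw [cz, cw, o1, o2, o3, o4] at this
      simp only [add_zero, mul_zero, sub_zero] at this
      exact_mod_cast this
  · have := e1 (rq (P.map ofRealHom) z) (rq (P.map ofRealHom) z)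
    rw [cz, ← h1, sq z hz] at this
    have h2 : ((Lf m (rp (rq (P.map ofRealHom) z) * rp (rq (P.map ofRealHom) z)) : ℝ) : ℂ)
      = ((kap m P : ℝ) : ℂ) := by rw [this]; ring
    exact_mod_cast h2
  · have o1 := orth z _ hz hzc h1
    have o2 := orth _ z hzc hz h1.symm
    constructor
    · have := e1 (rq (P.map ofRealHom) z) (rq (P.map ofRealHom) z)
      rw [cz, sq z hz, sq _ hzc, o1, o2] at this
      have h2 : ((Lf m (rp (rq (P.map ofRealHom) z) * rp (rq (P.map ofRealHom) z)) : ℝ) : ℂ)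
        = ((kap m P / 2 : ℝ) : ℂ) := by rw [this]; push_cast; ring
      exact_mod_cast h2
    · have := e2 (rq (P.map ofRealHom) z) (rq (P.map ofRealHom) z)
      rw [cz, sq z hz, sq _ hzc, o1, o2] at this
      have h2 : ((Lf m (ip (rq (P.map ofRealHom) z) * ip (rq (P.map ofRealHom) z)) : ℝ) : ℂ)
        = ((-kap m P / 2 : ℝ) : ℂ) := by rw [this]; push_cast; ring
      exact_mod_cast h2

theorem root_count (h : Eig n b μ P) :
    ∃ Rp Rm R0 : Finset ℂ,
      (∀ z, z ∈ Rp ↔ ((P.map ofRealHom).eval z = 0 ∧ 0 < z.im)) ∧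
      (∀ z, z ∈ R0 ↔ ((P.map ofRealHom).eval z = 0 ∧ 0 ≤ z.im)) ∧
      R0.card = nreal (P.map ofRealHom) + Rp.card ∧ nreal (P.map ofRealHom) + 2 * Rp.card = n ∧
      Rm.card = Rp.card := by
  classical
  set R := (P.map ofRealHom).roots.toFinset with hR
  have hmem : ∀ z, z ∈ R ↔ (P.map ofRealHom).eval z = 0 := fun z => mem_rts h.map
  set A := R.filter (fun z => z.im = 0) with hA
  set Bp := R.filter (fun z => 0 < z.im) with hBp
  set Bm := R.filter (fun z => z.im < 0) with hBm
  have hnA : nreal (P.map ofRealHom) = A.card := by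
    rw [nreal, ← Set.ncard_coe_finset]
    congr 1
    ext z
    simp [hA, hmem]
  have hBpm : Bm.card = Bp.card := by
    apply Finset.card_bij (fun z _ => (starRingEnd ℂ) z)
    · intro z hz
      rw [hBm, Finset.mem_filter, hmem] at hz
      rw [hBp, Finset.mem_filter, hmem]
      exact ⟨eval_conj_real P z hz.1, by simpa using hz.2⟩
    · intro z _ w _ h; exact (starRingEnd ℂ).injective h
    · intro z hz
      rw [hBp, Finset.mem_filter, hmem] at hz
      refine ⟨(starRingEnd ℂ) z, ?_, by simp⟩
      rw [hBm, Finset.mem_filter, hmem]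
      exact ⟨eval_conj_real P z hz.1, by simpa using hz.2⟩
  have hdis1 : Disjoint A Bp := by
    rw [hA, hBp, Finset.disjoint_filter]; intro z _ h1 h2; linarith
  have hdis2 : Disjoint (A ∪ Bp) Bm := by
    rw [Finset.disjoint_left]
    intro z hz hz2
    rw [hBm, Finset.mem_filter] at hz2
    rw [Finset.mem_union, hA, hBp, Finset.mem_filter, Finset.mem_filter] at hz
    rcases hz with hz | hz <;> linarith [hz.2, hz2.2]
  have hun : (A ∪ Bp) ∪ Bm = R := by
    ext z
    simp only [Finset.mem_union, hA, hBp, hBm, Finset.mem_filter]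
    constructor
    · rintro ((h | h) | h) <;> exact h.1
    · intro h
      rcases lt_trichotomy z.im 0 with h1 | h1 | h1
      · exact Or.inr ⟨h, h1⟩
      · exact Or.inl (Or.inl ⟨h, h1⟩)
      · exact Or.inl (Or.inr ⟨h, h1⟩)
  have hcard : A.card + Bp.card + Bm.card = n := by
    rw [← Finset.card_union_of_disjoint hdis1, ← Finset.card_union_of_disjoint hdis2, hun]
    exact h.map.card_roots
  refine ⟨Bp, Bm, A ∪ Bp, ?_, ?_, ?_, ?_, hBpm⟩
  · intro z; rw [hBp, Finset.mem_filter, hmem]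
  · intro z
    rw [Finset.mem_union, hA, hBp, Finset.mem_filter, Finset.mem_filter, hmem]
    constructor
    · rintro (h | h)
      · exact ⟨h.1, h.2.ge⟩
      · exact ⟨h.1, h.2.le⟩
    · rintro ⟨h1, h2⟩
      rcases h2.eq_or_lt with h3 | h3
      · exact Or.inl ⟨h1, h3.symm⟩
      · exact Or.inr ⟨h1, h3⟩
  · rw [Finset.card_union_of_disjoint hdis1, hnA]
  · rw [hnA]; omega

theorem conj_ne_of_im {z : ℂ} (h : 0 < z.im) : z ≠ (starRingEnd ℂ) z := by
  intro h1
  have := congrArg Complex.im h1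
  simp at this; linarith

theorem ST3 (h : Eig n b μ P) (hm : Rec b m) (h01 : ¬ (m 0 = 0 ∧ m 1 = 0)) (h0 : Lf m P = 0) :
    kap m P ≠ 0 ∧ ∃ m', nreal (P.map ofRealHom) + 2 * m' = n ∧
      (0 < kap m P → Pge n m (n - m') ∧ Pge n (-m) m') ∧
      (kap m P < 0 → Pge n (-m) (n - m') ∧ Pge n m m') := by
  have h01C : ¬ (cm m 0 = 0 ∧ cm m 1 = 0) := by simpa [cm] using h01
  have hk := kap_ne h.map hm.cm (ST1 h.map hm.cm (by rw [Lf_cm, h0]; simp)) h01C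
  rw [kap_cm] at hk
  refine ⟨by exact_mod_cast hk, ?_⟩
  obtain ⟨Rp, Rm, R0, hRp, hR0, c1, c2, -⟩ := root_count h
  refine ⟨Rp.card, c2, ?_⟩
  have hcard0 : n - Rp.card = Fintype.card R0 := by rw [Fintype.card_coe]; omega
  have hcardp : Rp.card = Fintype.card Rp := by rw [Fintype.card_coe]
  have hdeg : ∀ z, (rq (P.map ofRealHom) z).natDegree ≤ n := by
    intro z; rw [rq_natDegree, h.map.2.1]; omega
  have offd : ∀ z w : ℂ, (0 ≤ z.im) → 0 ≤ w.im → z ≠ w → z ≠ (starRingEnd ℂ) w := by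
    intro z w hz hw hne he
    have him := congrArg Complex.im he
    have hre := congrArg Complex.re he
    simp at him hre
    exact hne (Complex.ext hre (by linarith))
  have o0 : ∀ i j : R0, i ≠ j → Lf m (rp (rq (P.map ofRealHom) i.1) * rp (rq (P.map ofRealHom) j.1)) = 0 := by
    rintro ⟨z, hz⟩ ⟨w, hw⟩ hij
    rw [hR0] at hz hw
    have hne : z ≠ w := fun h => hij (Subtype.ext h)
    exact ((Lrr h hm h0 hz.1 hw.1).1 hne (offd z w hz.2 hw.2 hne)).1
  have d0 : ∀ i : R0, ∃ r : ℝ, 0 < r ∧ Lf m (rp (rq (P.map ofRealHom) i.1) * rp (rq (P.map ofRealHom) i.1)) = r * kap m P := by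
    rintro ⟨z, hz⟩
    rw [hR0] at hz
    rcases hz.2.eq_or_lt with h1 | h1
    · refine ⟨1, one_pos, ?_⟩
      rw [one_mul]
      refine (Lrr h hm h0 hz.1 hz.1).2.1 ?_
      apply Complex.ext
      · simp
      · simp [← h1]
    · refine ⟨1/2, by norm_num, ?_⟩
      rw [((Lrr h hm h0 hz.1 hz.1).2.2 (conj_ne_of_im h1)).1]; ring
  have op : ∀ i j : Rp, i ≠ j → Lf m (ip (rq (P.map ofRealHom) i.1) * ip (rq (P.map ofRealHom) j.1)) = 0 := by
    rintro ⟨z, hz⟩ ⟨w, hw⟩ hij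
    rw [hRp] at hz hw
    have hne : z ≠ w := fun h => hij (Subtype.ext h)
    exact ((Lrr h hm h0 hz.1 hw.1).1 hne (offd z w hz.2.le hw.2.le hne)).2
  have dp : ∀ i : Rp, Lf m (ip (rq (P.map ofRealHom) i.1) * ip (rq (P.map ofRealHom) i.1)) = - kap m P / 2 := by
    rintro ⟨z, hz⟩
    rw [hRp] at hz
    exact ((Lrr h hm h0 hz.1 hz.1).2.2 (conj_ne_of_im hz.2)).2
  constructor
  · intro hpos
    constructor
    · refine Pge_of hcard0.le (fun z : R0 => rp (rq (P.map ofRealHom) z.1))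
        (fun z => (rp_natDegree _).trans (hdeg _)) (posMat_diag o0 fun i => ?_)
      obtain ⟨r, hr, e⟩ := d0 i
      rw [e]; positivity
    · refine Pge_of hcardp.le (fun z : Rp => ip (rq (P.map ofRealHom) z.1))
        (fun z => (ip_natDegree _).trans (hdeg _)) (posMat_diag (fun i j hij => ?_) fun i => ?_)
      · rw [Lf_neg_mom, op i j hij, neg_zero]
      · rw [Lf_neg_mom, dp]; linarith
  · intro hneg
    constructor
    · refine Pge_of hcard0.le (fun z : R0 => rp (rq (P.map ofRealHom) z.1))
        (fun z => (rp_natDegree _).trans (hdeg _)) (posMat_diag (fun i j hij => ?_) fun i => ?_)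
      · rw [Lf_neg_mom, o0 i j hij, neg_zero]
      · obtain ⟨r, hr, e⟩ := d0 i
        rw [Lf_neg_mom, e]; nlinarith
    · refine Pge_of hcardp.le (fun z : Rp => ip (rq (P.map ofRealHom) z.1))
        (fun z => (ip_natDegree _).trans (hdeg _)) (posMat_diag op fun i => ?_)
      rw [dp]; linarith

end
end QES


namespace QES
open MeasureTheory

/-- `z^k e^{2 h_b(z)}` at `z = a + i w` -/
noncomputable def Jf (k : ℕ) (a b w : ℝ) : ℂ :=
  ((a : ℂ) + w * I) ^ k * cexp (2 * (((a : ℂ) + w * I) ^ 3 / 3 - b * ((a : ℂ) + w * I)))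

theorem hasDerivAt_zexp (k : ℕ) (b z : ℂ) :
    HasDerivAt (fun z : ℂ => z ^ k * cexp (2 * (z ^ 3 / 3 - b * z)))
      ((k : ℂ) * (z ^ (k - 1) * cexp (2 * (z ^ 3 / 3 - b * z)))
        + 2 * (z ^ (k + 2) * cexp (2 * (z ^ 3 / 3 - b * z)))
        - 2 * b * (z ^ k * cexp (2 * (z ^ 3 / 3 - b * z)))) z := by
  have h1 : HasDerivAt (fun z : ℂ => 2 * (z ^ 3 / 3 - b * z)) (2 * z ^ 2 - 2 * b) z := by
    have := (((hasDerivAt_pow 3 z).div_const 3).sub ((hasDerivAt_id z).const_mul b)).const_mul 2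
    refine this.congr_deriv ?_
    push_cast; simp; ring
  have := (hasDerivAt_pow k z).mul h1.cexp
  refine this.congr_deriv ?_
  ring

theorem Jf_deriv_w (k : ℕ) (a b w : ℝ) :
    HasDerivAt (fun w => Jf k a b w)
      (I * (k * Jf (k - 1) a b w + 2 * Jf (k + 2) a b w - 2 * b * Jf k a b w)) w := by
  have h1 : HasDerivAt (fun w : ℝ => (a : ℂ) + w * I) I w := by
    have := ((hasDerivAt_id (w : ℂ)).comp_ofReal.mul_const I).const_add (a : ℂ)
    simpa using this
  have := (hasDerivAt_zexp k b ((a : ℂ) + w * I)).comp w h1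
  rw [mul_comm] at this
  exact this

theorem Jf_deriv_a (k : ℕ) (a b w : ℝ) :
    HasDerivAt (fun a => Jf k a b w)
      (k * Jf (k - 1) a b w + 2 * Jf (k + 2) a b w - 2 * b * Jf k a b w) a := by
  have h1 : HasDerivAt (fun a : ℝ => (a : ℂ) + w * I) 1 a := by
    have := ((hasDerivAt_id (a : ℂ)).comp_ofReal).add_const (w * I)
    simpa using this
  have := (hasDerivAt_zexp k b ((a : ℂ) + w * I)).comp a h1
  rw [mul_one] at this
  exact this

theorem Jf_deriv_b (k : ℕ) (a b w : ℝ) :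
    HasDerivAt (fun b => Jf k a b w) (-2 * Jf (k + 1) a b w) b := by
  set z := (a : ℂ) + w * I with hz
  have h1 : HasDerivAt (fun b : ℝ => 2 * (z ^ 3 / 3 - b * z)) (-2 * z) b := by
    have := ((((hasDerivAt_id (b : ℂ)).comp_ofReal).mul_const z).const_sub (z ^ 3 / 3)).const_mul 2
    refine this.congr_deriv ?_
    ring
  have := h1.cexp.const_mul (z ^ k)
  refine this.congr_deriv ?_
  simp only [Jf, ← hz]; ring

theorem Jf_continuous_w (k : ℕ) (a b : ℝ) : Continuous (fun w => Jf k a b w) := by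
  unfold Jf; fun_prop

noncomputable def Cbd (k : ℕ) (a0 a1 B : ℝ) : ℝ :=
  k.factorial * Real.exp (a1 + 1 / (4 * a0) + 2 * a1 ^ 3 / 3 + 2 * B * a1)

theorem Jf_norm (k : ℕ) {a0 a1 B : ℝ} (h0 : 0 < a0) {a b : ℝ} (ha0 : a0 ≤ a) (ha1 : a ≤ a1)
    (hb : |b| ≤ B) (w : ℝ) : ‖Jf k a b w‖ ≤ Cbd k a0 a1 B * Real.exp (-a0 * w ^ 2) := by
  have ha : 0 < a := h0.trans_le ha0
  have hz : ‖(a : ℂ) + w * I‖ ≤ a1 + |w| := by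
    refine (norm_add_le _ _).trans ?_
    simp [abs_of_pos ha]; linarith
  have h1 : ‖(a : ℂ) + w * I‖ ^ k ≤ k.factorial * Real.exp (a1 + |w|) := by
    refine (pow_le_pow_left₀ (norm_nonneg _) hz k).trans ?_
    have := Real.pow_div_factorial_le_exp (a1 + |w|) (by have := abs_nonneg w; linarith) k
    rw [div_le_iff₀ (by positivity)] at this
    linarith
  have h2 : ‖cexp (2 * (((a : ℂ) + w * I) ^ 3 / 3 - b * ((a : ℂ) + w * I)))‖
      = Real.exp (2 * (a ^ 3 / 3 - a * w ^ 2 - b * a)) := by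
    rw [Complex.norm_exp]
    congr 1
    have : (2 * (((a : ℂ) + w * I) ^ 3 / 3 - b * ((a : ℂ) + w * I)))
      = ((2 * (a ^ 3 / 3 - a * w ^ 2 - b * a) : ℝ) : ℂ)
        + ((2 * (a ^ 2 * w - w ^ 3 / 3 - b * w) : ℝ) : ℂ) * I := by
      push_cast
      linear_combination (2 * a * w ^ 2 + (2 / 3) * w ^ 3 * I : ℂ) * Complex.I_sq
    rw [this, Complex.add_re, Complex.re_ofReal_mul, Complex.ofReal_re]; simp
  rw [Jf, norm_mul, norm_pow, h2, Cbd]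
  calc _ ≤ (k.factorial * Real.exp (a1 + |w|)) * Real.exp (2 * (a ^ 3 / 3 - a * w ^ 2 - b * a)) := by gcongr
    _ = k.factorial * Real.exp (a1 + |w| + 2 * (a ^ 3 / 3 - a * w ^ 2 - b * a)) := by
      rw [Real.exp_add (a1 + |w|)]; ring
    _ ≤ k.factorial * Real.exp ((a1 + 1 / (4 * a0) + 2 * a1 ^ 3 / 3 + 2 * B * a1) + -a0 * w ^ 2) := by
      gcongr ?_ * Real.exp ?_
      have e1 : a ^ 3 ≤ a1 ^ 3 := pow_le_pow_left₀ ha.le ha1 3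
      have e2 : |w| - a0 * w ^ 2 ≤ 1 / (4 * a0) := by
        rw [le_div_iff₀ (by positivity), ← sq_abs w]
        nlinarith [sq_nonneg (2 * a0 * |w| - 1)]
      have e3 : -b * a ≤ B * a1 := by
        have := (abs_le.mp hb).1
        nlinarith [abs_nonneg b]
      have e4 : a0 * w ^ 2 ≤ a * w ^ 2 := by gcongr
      linarith
    _ = _ := by rw [Real.exp_add]; ring

theorem Jf_bound_integrable (c : ℝ) {a0 : ℝ} (h0 : 0 < a0) (S : Set ℝ) :
    Integrable (fun w : ℝ => c * Real.exp (-a0 * w ^ 2)) (volume.restrict S) :=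
  ((integrable_exp_neg_mul_sq h0).const_mul c).restrict

theorem Jf_integrable (k : ℕ) {a : ℝ} (b : ℝ) (ha : 0 < a) (S : Set ℝ) :
    Integrable (fun w => Jf k a b w) (volume.restrict S) :=
  (Jf_bound_integrable _ ha S).mono' (Jf_continuous_w k a b).aestronglyMeasurable
    (Eventually.of_forall fun w => Jf_norm k ha le_rfl le_rfl le_rfl w)

noncomputable def VS (S : Set ℝ) (k : ℕ) (a b : ℝ) : ℂ := ∫ w in S, Jf k a b w

theorem VS_deriv_b (S : Set ℝ) (k : ℕ) {a : ℝ} (b : ℝ) (ha : 0 < a) :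
    HasDerivAt (fun b => VS S k a b) (-2 * VS S (k + 1) a b) b := by
  have := (hasDerivAt_integral_of_dominated_loc_of_deriv_le (μ := volume.restrict S)
    (F := fun b w => Jf k a b w) (F' := fun b w => -2 * Jf (k + 1) a b w) (x₀ := b)
    (s := Metric.ball b 1)
    (bound := fun w => 2 * Cbd (k + 1) a a (|b| + 1) * Real.exp (-a * w ^ 2))
    (Metric.ball_mem_nhds b one_pos)
    (Eventually.of_forall fun b' => (Jf_continuous_w k a b').aestronglyMeasurable)
    (Jf_integrable k b ha S)
    (((Jf_continuous_w (k + 1) a b).const_mul (-2)).aestronglyMeasurable)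
    (Eventually.of_forall fun w b' hb' => ?_) (Jf_bound_integrable _ ha S)
    (Eventually.of_forall fun w b' hb' => Jf_deriv_b k a b' w)).2
  · rw [integral_const_mul] at this
    exact this
  · have h1 : |b'| ≤ |b| + 1 := by
      rw [Metric.mem_ball, Real.dist_eq] at hb'
      have := abs_sub_abs_le_abs_sub b' b
      linarith
    rw [norm_mul]
    have := Jf_norm (k + 1) ha le_rfl le_rfl h1 w
    simp only [norm_neg, Complex.norm_ofNat]
    linarith

theorem VS_deriv_w (S : Set ℝ) (k : ℕ) {a : ℝ} (b : ℝ) (ha : 0 < a) :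
    ∫ w in S, (I * (k * Jf (k - 1) a b w + 2 * Jf (k + 2) a b w - 2 * b * Jf k a b w))
      = I * (k * VS S (k - 1) a b + 2 * VS S (k + 2) a b - 2 * b * VS S k a b) := by
  have i1 := (Jf_integrable (k - 1) b ha S).const_mul (k : ℂ)
  have i2 := (Jf_integrable (k + 2) b ha S).const_mul (2 : ℂ)
  have i3 := (Jf_integrable k b ha S).const_mul (2 * b : ℂ)
  rw [integral_const_mul, integral_sub (f := fun w => (k:ℂ) * Jf (k - 1) a b w + 2 * Jf (k + 2) a b w) (i1.add i2) i3, integral_add i1 i2,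
    integral_const_mul, integral_const_mul, integral_const_mul]
  rfl

theorem Jf_tendsto (k : ℕ) {a : ℝ} (b : ℝ) (ha : 0 < a) :
    Tendsto (fun w => Jf k a b w) (cocompact ℝ) (nhds 0) := by
  have h1 : Tendsto (fun w : ℝ => Cbd k a a |b| * Real.exp (-a * w ^ 2)) (cocompact ℝ) (nhds 0) := by
    have h2 : Tendsto (fun w : ℝ => a * ‖w‖ ^ 2) (cocompact ℝ) atTop :=
      ((tendsto_pow_atTop two_ne_zero).comp tendsto_norm_cocompact_atTop).const_mul_atTop ha
    have := (Real.tendsto_exp_neg_atTop_nhds_zero.comp h2).const_mul (Cbd k a a |b|)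
    simpa using this
  exact squeeze_zero_norm (fun w => Jf_norm k ha le_rfl le_rfl le_rfl w) h1

theorem Jf_int_deriv (k : ℕ) {a : ℝ} (b : ℝ) (ha : 0 < a) (S : Set ℝ) :
    IntegrableOn (fun w => I * (k * Jf (k - 1) a b w + 2 * Jf (k + 2) a b w - 2 * b * Jf k a b w)) S :=
  ((((Jf_integrable (k - 1) b ha S).const_mul (k : ℂ)).add
    ((Jf_integrable (k + 2) b ha S).const_mul (2 : ℂ))).sub
    ((Jf_integrable k b ha S).const_mul (2 * b : ℂ))).const_mul I

theorem VS_rec_univ (k : ℕ) {a : ℝ} (b : ℝ) (ha : 0 < a) :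
    k * VS Set.univ (k - 1) a b + 2 * VS Set.univ (k + 2) a b - 2 * b * VS Set.univ k a b = 0 := by
  have ht := Jf_tendsto k b ha
  rw [cocompact_eq_atBot_atTop, tendsto_sup] at ht
  have h := integral_of_hasDerivAt_of_tendsto (fun w => Jf_deriv_w k a b w)
    (by simpa [IntegrableOn] using Jf_int_deriv k b ha Set.univ) ht.1 ht.2
  have h2 := VS_deriv_w Set.univ k b ha
  rw [setIntegral_univ, h] at h2
  simpa using h2.symm

theorem VS_rec_Ioi (k : ℕ) {a : ℝ} (b : ℝ) (ha : 0 < a) :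
    I * (k * VS (Set.Ioi 0) (k - 1) a b + 2 * VS (Set.Ioi 0) (k + 2) a b
      - 2 * b * VS (Set.Ioi 0) k a b) = - Jf k a b 0 := by
  have ht := Jf_tendsto k b ha
  rw [cocompact_eq_atBot_atTop, tendsto_sup] at ht
  have h := integral_Ioi_of_hasDerivAt_of_tendsto' (a := 0) (fun w _ => Jf_deriv_w k a b w)
    (Jf_int_deriv k b ha _) ht.2
  have h2 := VS_deriv_w (Set.Ioi 0) k b ha
  rw [← h2, h]; simp

theorem VS_deriv_a (k : ℕ) {a : ℝ} (b : ℝ) (ha : 0 < a) :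
    HasDerivAt (fun a => VS Set.univ k a b) 0 a := by
  have := (hasDerivAt_integral_of_dominated_loc_of_deriv_le (μ := volume.restrict Set.univ)
    (F := fun a w => Jf k a b w)
    (F' := fun a w => k * Jf (k - 1) a b w + 2 * Jf (k + 2) a b w - 2 * b * Jf k a b w) (x₀ := a)
    (s := Set.Icc (a / 2) (2 * a))
    (bound := fun w => (k * Cbd (k - 1) (a / 2) (2 * a) |b| + 2 * Cbd (k + 2) (a / 2) (2 * a) |b|
      + 2 * |b| * Cbd k (a / 2) (2 * a) |b|) * Real.exp (-(a / 2) * w ^ 2))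
    (Icc_mem_nhds (by linarith) (by linarith))
    (Eventually.of_forall fun a' => (Jf_continuous_w k a' b).aestronglyMeasurable)
    (Jf_integrable k b ha _)
    (((((Jf_continuous_w (k - 1) a b).const_mul (k : ℂ)).add
      ((Jf_continuous_w (k + 2) a b).const_mul (2 : ℂ))).sub
      ((Jf_continuous_w k a b).const_mul (2 * b : ℂ))).aestronglyMeasurable)
    (Eventually.of_forall fun w a' ha' => ?_) (Jf_bound_integrable _ (by positivity) _)
    (Eventually.of_forall fun w a' ha' => Jf_deriv_a k a' b w)).2
  · have h2 := VS_deriv_w Set.univ k b ha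
    rw [VS_rec_univ k b ha, integral_const_mul] at h2
    simp only [mul_zero, mul_eq_zero, I_ne_zero, false_or] at h2
    rw [h2] at this
    exact this
  · have n1 := Jf_norm (k - 1) (half_pos ha) ha'.1 ha'.2 le_rfl w (b := b)
    have n2 := Jf_norm (k + 2) (half_pos ha) ha'.1 ha'.2 le_rfl w (b := b)
    have n3 := Jf_norm k (half_pos ha) ha'.1 ha'.2 le_rfl w (b := b)
    refine (norm_sub_le _ _).trans ?_
    refine (add_le_add_left (norm_add_le _ _) _).trans ?_
    simp only [norm_mul, Complex.norm_natCast, Complex.norm_ofNat, Complex.norm_real, Real.norm_eq_abs]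
    have m1 := mul_le_mul_of_nonneg_left n1 (Nat.cast_nonneg k : (0:ℝ) ≤ k)
    have m3 := mul_le_mul_of_nonneg_left n3 (by positivity : 0 ≤ 2 * |b|)
    linarith

theorem VS_indep (k : ℕ) {a : ℝ} (b : ℝ) (ha : 0 < a) :
    VS Set.univ k a b = VS Set.univ k 1 b := by
  refine isOpen_Ioi.is_const_of_deriv_eq_zero (s := Set.Ioi (0:ℝ)) isPreconnected_Ioi
    (fun x hx => (VS_deriv_a k b hx).differentiableAt.differentiableWithinAt)
    (fun x hx => (VS_deriv_a k b hx).deriv) ha (Set.mem_Ioi.mpr one_pos)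

end QES


namespace QES
open MeasureTheory

noncomputable def rf (k : ℕ) (b x : ℝ) : ℝ := x ^ k * Real.exp (2 * (x ^ 3 / 3 - b * x))

theorem rf_deriv_x (k : ℕ) (b x : ℝ) :
    HasDerivAt (fun x => rf k b x)
      (k * rf (k - 1) b x + 2 * rf (k + 2) b x - 2 * b * rf k b x) x := by
  have h1 : HasDerivAt (fun x : ℝ => 2 * (x ^ 3 / 3 - b * x)) (2 * x ^ 2 - 2 * b) x := by
    have := (((hasDerivAt_pow 3 x).div_const 3).sub ((hasDerivAt_id x).const_mul b)).const_mul 2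
    refine this.congr_deriv ?_
    push_cast; simp; ring
  have := (hasDerivAt_pow k x).mul h1.exp
  refine this.congr_deriv ?_
  simp only [rf]; ring

theorem rf_deriv_b (k : ℕ) (b x : ℝ) :
    HasDerivAt (fun b => rf k b x) (-2 * rf (k + 1) b x) b := by
  have h1 : HasDerivAt (fun b : ℝ => 2 * (x ^ 3 / 3 - b * x)) (-2 * x) b := by
    have := (((hasDerivAt_id b).mul_const x).const_sub (x ^ 3 / 3)).const_mul 2
    refine this.congr_deriv ?_
    ring
  have := h1.exp.const_mul (x ^ k)
  refine this.congr_deriv ?_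
  simp only [rf]; ring

theorem rf_continuous (k : ℕ) (b : ℝ) : Continuous (fun x => rf k b x) := by
  unfold rf; fun_prop

noncomputable def Rbd (k : ℕ) (B : ℝ) : ℝ :=
  k.factorial * Real.exp (2 + (2 / 3 + 2 * (B + 1) ^ 2 + 4 * (B + 1) ^ 3 / 3))

theorem rf_norm (k : ℕ) {b B x : ℝ} (hb : |b| ≤ B) (hx : x ≤ 1) :
    ‖rf k b x‖ ≤ Rbd k B * Real.exp x := by
  have hB : 0 ≤ B := (abs_nonneg b).trans hb
  have h1 : |x| ^ k ≤ k.factorial * Real.exp (2 - x) := by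
    have := Real.pow_div_factorial_le_exp |x| (abs_nonneg x) k
    rw [div_le_iff₀ (by positivity)] at this
    refine this.trans ?_
    rw [mul_comm]
    gcongr
    exact abs_le.mpr ⟨by linarith, by linarith⟩
  rw [rf, norm_mul, norm_pow, Real.norm_eq_abs, Real.norm_eq_abs, Real.abs_exp, Rbd]
  calc _ ≤ (k.factorial * Real.exp (2 - x)) * Real.exp (2 * (x ^ 3 / 3 - b * x)) := by gcongr
    _ = k.factorial * Real.exp ((2 - x) + 2 * (x ^ 3 / 3 - b * x)) := by
      rw [Real.exp_add (2 - x)]; ring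
    _ ≤ k.factorial * Real.exp ((2 + (2 / 3 + 2 * (B + 1) ^ 2 + 4 * (B + 1) ^ 3 / 3)) + x) := by
      gcongr ?_ * Real.exp ?_
      obtain ⟨hb1, hb2⟩ := abs_le.mp hb
      set c := B + 1 with hc
      have hc1 : 1 ≤ c := by linarith
      have hcc : c ≤ c ^ 2 := by nlinarith
      rcases le_total 0 x with h | h
      · have e1 : x ^ 3 ≤ 1 := pow_le_one₀ h hx
        have e2 : -(b + 1) * x ≤ c ^ 2 := by nlinarith
        have : 0 ≤ c ^ 3 := by positivity
        nlinarith
      · have e2 : (b + 1) * (-x) ≤ c ^ 2 * (-x) := by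
          apply mul_le_mul_of_nonneg_right _ (by linarith)
          linarith
        have e3 : 0 ≤ (-x - c) ^ 2 * (-x + 2 * c) := by
          apply mul_nonneg (sq_nonneg _); linarith
        nlinarith [sq_nonneg c]
    _ = _ := by rw [Real.exp_add _ x]; ring

theorem rf_bound_integrable (c : ℝ) :
    Integrable (fun x : ℝ => c * Real.exp x) (volume.restrict (Set.Iic 1)) :=
  (integrableOn_exp_Iic 1).const_mul c

theorem ae_Iic {p : ℝ → Prop} (h : ∀ x ≤ 1, p x) : ∀ᵐ x ∂(volume.restrict (Set.Iic (1:ℝ))), p x :=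
  (ae_restrict_iff' measurableSet_Iic).mpr (Eventually.of_forall h)

theorem rf_integrable (k : ℕ) (b : ℝ) :
    Integrable (fun x => rf k b x) (volume.restrict (Set.Iic 1)) :=
  (rf_bound_integrable _).mono' (rf_continuous k b).aestronglyMeasurable
    (ae_Iic fun _ hx => rf_norm k le_rfl hx)

noncomputable def RI (k : ℕ) (b : ℝ) : ℝ := ∫ x in Set.Iic 1, rf k b x

theorem RI_deriv (k : ℕ) (b : ℝ) : HasDerivAt (fun b => RI k b) (-2 * RI (k + 1) b) b := by
  have := (hasDerivAt_integral_of_dominated_loc_of_deriv_le (μ := volume.restrict (Set.Iic 1))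
    (F := fun b x => rf k b x) (F' := fun b x => -2 * rf (k + 1) b x) (x₀ := b)
    (s := Metric.ball b 1)
    (bound := fun x => 2 * Rbd (k + 1) (|b| + 1) * Real.exp x)
    (Metric.ball_mem_nhds b one_pos)
    (Eventually.of_forall fun b' => (rf_continuous k b').aestronglyMeasurable)
    (rf_integrable k b)
    (((rf_continuous (k + 1) b).const_mul (-2)).aestronglyMeasurable)
    (ae_Iic fun x hx b' hb' => ?_) (rf_bound_integrable _)
    (Eventually.of_forall fun x b' hb' => rf_deriv_b k b' x)).2
  · rw [integral_const_mul] at this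
    exact this
  · have h1 : |b'| ≤ |b| + 1 := by
      rw [Metric.mem_ball, Real.dist_eq] at hb'
      have := abs_sub_abs_le_abs_sub b' b
      linarith
    rw [norm_mul]
    have := rf_norm (k + 1) h1 hx
    simp only [norm_neg, Real.norm_ofNat]
    linarith

theorem rf_tendsto (k : ℕ) (b : ℝ) : Tendsto (fun x => rf k b x) atBot (nhds 0) := by
  have h1 : Tendsto (fun x : ℝ => Rbd k |b| * Real.exp x) atBot (nhds 0) := by
    simpa using Real.tendsto_exp_atBot.const_mul (Rbd k |b|)
  refine squeeze_zero_norm' ?_ h1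
  filter_upwards [eventually_le_atBot (1:ℝ)] with x hx
  exact rf_norm k le_rfl hx

theorem RI_rec (k : ℕ) (b : ℝ) :
    k * RI (k - 1) b + 2 * RI (k + 2) b - 2 * b * RI k b = rf k b 1 := by
  have i1 := (rf_integrable (k - 1) b).const_mul (k : ℝ)
  have i2 := (rf_integrable (k + 2) b).const_mul (2 : ℝ)
  have i3 := (rf_integrable k b).const_mul (2 * b : ℝ)
  have h := integral_Iic_of_hasDerivAt_of_tendsto' (a := 1) (fun x _ => rf_deriv_x k b x)
    ((i1.add i2).sub i3) (rf_tendsto k b)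
  rw [integral_sub (f := fun x => (k:ℝ) * rf (k - 1) b x + 2 * rf (k + 2) b x) (i1.add i2) i3,
    integral_add i1 i2, integral_const_mul, integral_const_mul, integral_const_mul] at h
  rw [sub_zero] at h; exact h

/-- subdominant moments -/
noncomputable def Gm (b : ℝ) (k : ℕ) : ℝ := (VS Set.univ k 1 b).re
/-- dominant moments -/
noncomputable def Em (b : ℝ) (k : ℕ) : ℝ := RI k b - (VS (Set.Ioi 0) k 1 b).im

theorem hasDerivAt_re {f : ℝ → ℂ} {f' : ℂ} {x : ℝ} (h : HasDerivAt f f' x) :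
    HasDerivAt (fun x => (f x).re) f'.re x :=
  Complex.reCLM.hasFDerivAt.comp_hasDerivAt x h

theorem hasDerivAt_im {f : ℝ → ℂ} {f' : ℂ} {x : ℝ} (h : HasDerivAt f f' x) :
    HasDerivAt (fun x => (f x).im) f'.im x :=
  Complex.imCLM.hasFDerivAt.comp_hasDerivAt x h

theorem Gm_deriv (k : ℕ) (b : ℝ) : HasDerivAt (fun b => Gm b k) (-2 * Gm b (k + 1)) b := by
  refine (hasDerivAt_re (VS_deriv_b Set.univ k b one_pos)).congr_deriv ?_
  simp [Gm]

theorem Em_deriv (k : ℕ) (b : ℝ) : HasDerivAt (fun b => Em b k) (-2 * Em b (k + 1)) b := by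
  refine ((RI_deriv k b).sub (hasDerivAt_im (VS_deriv_b (Set.Ioi 0) k b one_pos))).congr_deriv ?_
  simp [Em]; ring

theorem Gm_rec (b : ℝ) : Rec b (Gm b) := by
  intro k
  have := congrArg Complex.re (VS_rec_univ k b one_pos)
  simpa [Gm] using this

theorem Em_rec (b : ℝ) : Rec b (Em b) := by
  intro k
  have h1 := congrArg Complex.re (VS_rec_Ioi k b one_pos)
  have h2 := RI_rec k b
  have h3 : (Jf k 1 b 0).re = rf k b 1 := by
    have : Jf k 1 b 0 = ((rf k b 1 : ℝ) : ℂ) := by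
      simp [Jf, rf]
    rw [this, ofReal_re]
  rw [Complex.neg_re, h3] at h1
  simp at h1
  simp only [Em]
  linarith

end QES


namespace QES
open MeasureTheory

theorem gram_sum {N : ℕ} (S : Set ℝ) (ρ : ℝ → ℝ) (d : Fin N → ℕ)
    (hIntg : ∀ i j, IntegrableOn (fun x => x ^ (d i + d j) * ρ x) S) (c : Fin N → ℝ) :
    IntegrableOn (fun x => (∑ i, c i * x ^ d i) ^ 2 * ρ x) S ∧
    ∑ i, ∑ j, c i * c j * (∫ x in S, x ^ (d i + d j) * ρ x)
      = ∫ x in S, (∑ i, c i * x ^ d i) ^ 2 * ρ x := by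
  have e : (fun x => (∑ i, c i * x ^ d i) ^ 2 * ρ x)
      = fun x => ∑ i, ∑ j, c i * c j * (x ^ (d i + d j) * ρ x) := by
    funext x
    rw [sq, Finset.sum_mul_sum, Finset.sum_mul]
    refine Finset.sum_congr rfl fun i _ => ?_
    rw [Finset.sum_mul]
    refine Finset.sum_congr rfl fun j _ => ?_
    ring
  rw [e]
  constructor
  · refine integrable_finsetSum _ fun i _ => integrable_finsetSum _ fun j _ => (hIntg i j).const_mul _
  · rw [integral_finsetSum _ fun i _ => integrable_finsetSum _ fun j _ => (hIntg i j).const_mul _]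
    refine Finset.sum_congr rfl fun i _ => ?_
    rw [integral_finsetSum _ fun j _ => (hIntg i j).const_mul _]
    refine Finset.sum_congr rfl fun j _ => ?_
    rw [integral_const_mul]

theorem gram_pos {N : ℕ} (S : Set ℝ) (hS : MeasurableSet S) (ρ : ℝ → ℝ) (hρ : ∀ x, 0 < ρ x)
    (d : Fin N → ℕ) (hd : Function.Injective d)
    (hIntg : ∀ i j, IntegrableOn (fun x => x ^ (d i + d j) * ρ x) S)
    {α β : ℝ} (hαβ : α < β) (hsub : Set.Ioo α β ⊆ S) :
    PosMat (fun i j => ∫ x in S, x ^ (d i + d j) * ρ x) := by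
  intro c hc
  obtain ⟨h1, h2⟩ := gram_sum S ρ d hIntg c
  rw [h2]
  rw [setIntegral_pos_iff_support_of_nonneg_ae _ h1]
  · set p : ℝ[X] := ∑ i, C (c i) * X ^ d i with hp
    have hp0 : p ≠ 0 := by
      intro h0
      apply hc
      funext i
      have := congrArg (fun q => q.coeff (d i)) h0
      simp only [hp, finsetSum_coeff, coeff_C_mul, coeff_X_pow, coeff_zero] at this
      rw [Finset.sum_eq_single i] at this
      · simpa using this
      · intro j _ hj
        rw [if_neg (fun h => hj (hd h).symm), mul_zero]
      · simp
    have hev : ∀ x, p.eval x = ∑ i, c i * x ^ d i := by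
      intro x; simp [hp, eval_finsetSum]
    have hfin : (p.rootSet ℝ).Finite := p.rootSet_finite ℝ
    have h3 : Set.Ioo α β \ p.rootSet ℝ ⊆
        Function.support (fun x => (∑ i, c i * x ^ d i) ^ 2 * ρ x) ∩ S := by
      intro x hx
      refine ⟨?_, hsub hx.1⟩
      have : p.eval x ≠ 0 := by
        intro h; apply hx.2
        rw [mem_rootSet]; exact ⟨hp0, by simpa using h⟩
      rw [hev] at this
      rw [Function.mem_support]
      exact mul_ne_zero (pow_ne_zero 2 this) (hρ x).ne'
    refine lt_of_lt_of_le ?_ (measure_mono h3)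
    rw [measure_sdiff_null (hfin.measure_zero _)]
    simp [hαβ]
  · exact Eventually.of_forall fun x => mul_nonneg (sq_nonneg _) (hρ x).le

theorem Jf_norm_shift (k : ℕ) (b w : ℝ) : ‖Jf k 1 b w‖ = Real.exp (-2 * b) * ‖Jf k 1 0 w‖ := by
  have : Jf k 1 b w = cexp (2 * (-b * ((1 : ℝ) + w * I))) * Jf k 1 0 w := by
    simp only [Jf]
    rw [mul_left_comm, ← Complex.exp_add]
    congr 2
    push_cast; ring
  rw [this, norm_mul, Complex.norm_exp]
  congr 2
  simp

theorem VS_small (S : Set ℝ) (k : ℕ) (b : ℝ) :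
    ‖VS S k 1 b‖ ≤ Real.exp (-2 * b) * ∫ w in S, ‖Jf k 1 0 w‖ := by
  rw [VS]
  refine (norm_integral_le_integral_norm _).trans ?_
  rw [← integral_const_mul]
  exact (integral_congr_ae (Eventually.of_forall fun w => Jf_norm_shift k b w)).le

theorem VS_tendsto (S : Set ℝ) (k : ℕ) :
    Tendsto (fun b : ℝ => ((Real.exp (16 / 3 - 2 * b) : ℝ) : ℂ) * VS S k 1 b) atTop (nhds 0) := by
  have h1 : Tendsto (fun b : ℝ => Real.exp (16 / 3) * (∫ w in S, ‖Jf k 1 0 w‖) * Real.exp (-(4 * b)))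
      atTop (nhds 0) := by
    have := (Real.tendsto_exp_neg_atTop_nhds_zero.comp
      (tendsto_id.const_mul_atTop (by norm_num : (0:ℝ) < 4))).const_mul
        (Real.exp (16 / 3) * (∫ w in S, ‖Jf k 1 0 w‖))
    simpa using this
  refine squeeze_zero_norm (fun b => ?_) h1
  rw [norm_mul, Complex.norm_real, Real.norm_eq_abs, Real.abs_exp]
  refine (mul_le_mul_of_nonneg_left (VS_small S k b) (Real.exp_pos _).le).trans (le_of_eq ?_)
  have : Real.exp (16 / 3 - 2 * b) * Real.exp (-2 * b) = Real.exp (16/3) * Real.exp (-(4 * b)) := by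
    rw [← Real.exp_add, ← Real.exp_add]; congr 1; ring
  linear_combination (∫ w in S, ‖Jf k 1 0 w‖) * this

/-- the dominant family is eventually positive definite -/
theorem E_pos (n : ℕ) (t : ℝ) : ∀ᶠ b in atTop, Pge n (Em b + t • Gm b) (n + 1) := by
  set B0 : Fin (n+1) → Fin (n+1) → ℝ := fun i j =>
    ∫ x in Set.Icc (-2:ℝ) (-1), x ^ ((i:ℕ) + (j:ℕ)) * 1 with hB0
  have hintB : ∀ i j : Fin (n+1), IntegrableOn (fun x : ℝ => x ^ ((i:ℕ) + (j:ℕ)) * 1) (Set.Icc (-2:ℝ) (-1)) :=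
    fun i j => (by fun_prop : Continuous fun x : ℝ => x ^ ((i:ℕ) + (j:ℕ)) * 1).continuousOn.integrableOn_Icc
  have hpos : PosMat B0 := gram_pos (Set.Icc (-2:ℝ) (-1)) measurableSet_Icc (fun _ => 1)
    (fun _ => one_pos) (fun i : Fin (n+1) => (i:ℕ)) Fin.val_injective hintB
    (α := -2) (β := -1) (by norm_num) Set.Ioo_subset_Icc_self
  have hlim : Tendsto (fun b : ℝ => fun i j : Fin (n+1) => B0 i j + Real.exp (16 / 3 - 2 * b) *
      (t * Gm b (i + j) - (VS (Set.Ioi 0) (i + j) 1 b).im)) atTop (nhds B0) := by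
    rw [tendsto_pi_nhds]; intro i
    rw [tendsto_pi_nhds]; intro j
    have h1 := (Complex.continuous_re.tendsto 0).comp (VS_tendsto Set.univ (i + j))
    have h2 := (Complex.continuous_im.tendsto 0).comp (VS_tendsto (Set.Ioi 0) (i + j))
    have := ((h1.const_mul t).sub h2).const_add (B0 i j)
    simp only [Complex.zero_re, Complex.zero_im, mul_zero, sub_zero, add_zero] at this
    refine this.congr fun b => ?_
    simp only [Function.comp, Complex.re_ofReal_mul, Complex.im_ofReal_mul, Gm]
    ring
  filter_upwards [hlim (PosMat.isOpen.mem_nhds hpos), eventually_ge_atTop 0] with b hb hb0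
  refine ⟨fun i => X ^ (i:ℕ), fun i => ?_, ?_⟩
  · rw [natDegree_X_pow]; omega
  intro c hc
  have h1 := hb c hc
  have hR : ∑ i : Fin (n+1), ∑ j : Fin (n+1), c i * c j * RI (i + j) b
      ≥ Real.exp (2 * b - 16 / 3) * ∑ i, ∑ j, c i * c j * B0 i j := by
    have g1 := gram_sum (Set.Iic 1) (fun x => Real.exp (2 * (x ^ 3 / 3 - b * x)))
      (fun i : Fin (n+1) => (i:ℕ)) (fun i j => rf_integrable (i + j) b) c
    have g2 := gram_sum (Set.Icc (-2:ℝ) (-1)) (fun _ => 1)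
      (fun i : Fin (n+1) => (i:ℕ)) hintB c
    have e1 : ∑ i : Fin (n+1), ∑ j : Fin (n+1), c i * c j * RI (i + j) b
        = ∫ x in Set.Iic 1, (∑ i, c i * x ^ (i:ℕ)) ^ 2 * Real.exp (2 * (x ^ 3 / 3 - b * x)) := g1.2
    rw [e1, hB0, g2.2, ← integral_const_mul]
    have hss : Set.Icc (-2:ℝ) (-1) ⊆ Set.Iic 1 := fun x hx => by
      have := hx.2; simp only [Set.mem_Iic]; linarith
    refine le_trans ?_ (setIntegral_mono_set g1.1 (Eventually.of_forall fun x => by positivity)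
      hss.eventuallyLE)
    refine setIntegral_mono_on (g2.1.const_mul _) (g1.1.mono_set hss) measurableSet_Icc fun x hx => ?_
    rw [mul_one, mul_comm]
    apply mul_le_mul_of_nonneg_left _ (sq_nonneg _)
    rw [Real.exp_le_exp]
    have h3 : -8 ≤ x ^ 3 := by nlinarith [hx.1, hx.2, sq_nonneg (x + 2), sq_nonneg (x - 1)]
    nlinarith [hx.2]
  have e2 : ∀ i j : Fin (n+1), Lf (Em b + t • Gm b) (X ^ (i:ℕ) * X ^ (j:ℕ))
      = RI (i + j) b + (t * Gm b (i + j) - (VS (Set.Ioi 0) (i + j) 1 b).im) := by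
    intro i j
    rw [← pow_add, Lf_X_pow]
    simp [Em]; ring
  simp only [e2, mul_add, Finset.sum_add_distrib] at h1 ⊢
  have e3 : ∑ i : Fin (n+1), ∑ j : Fin (n+1), c i * c j * (Real.exp (16 / 3 - 2 * b) * (t * Gm b (i + j) - (VS (Set.Ioi 0) (i + j) 1 b).im))
    = Real.exp (16 / 3 - 2 * b) * ∑ i : Fin (n+1), ∑ j : Fin (n+1), c i * c j * (t * Gm b (i + j) - (VS (Set.Ioi 0) (i + j) 1 b).im) := by
    simp only [Finset.mul_sum]
    refine Finset.sum_congr rfl fun i _ => Finset.sum_congr rfl fun j _ => by ring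
  rw [e3] at h1
  have e4 : Real.exp (2 * b - 16 / 3) * Real.exp (16 / 3 - 2 * b) = 1 := by
    rw [← Real.exp_add, ← Real.exp_zero]; congr 1; ring
  have h5 := mul_pos (Real.exp_pos (2 * b - 16 / 3)) h1
  rw [mul_add, ← mul_assoc _ (Real.exp (16 / 3 - 2 * b)), e4, one_mul] at h5
  linarith

end QES


namespace QES
open MeasureTheory

noncomputable def Kint (N : ℕ) (η : ℝ) : ℝ :=
  ∫ x : ℝ, x ^ (2 * N) * Real.exp (-2 * x ^ 2) * Real.cos (η * x ^ 3)

theorem pow_exp_le (N : ℕ) (x : ℝ) :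
    x ^ (2 * N) * Real.exp (-2 * x ^ 2) ≤ N.factorial * Real.exp (-1 * x ^ 2) := by
  have := Real.pow_div_factorial_le_exp (x ^ 2) (sq_nonneg x) N
  rw [div_le_iff₀ (by positivity), ← pow_mul] at this
  calc _ ≤ (Real.exp (x ^ 2) * N.factorial) * Real.exp (-2 * x ^ 2) := by gcongr
    _ = _ := by
      rw [mul_comm (Real.exp _), mul_assoc, ← Real.exp_add]; congr 2; ring

theorem pow_exp_integrable (N : ℕ) :
    Integrable (fun x : ℝ => x ^ (2 * N) * Real.exp (-2 * x ^ 2)) := by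
  refine ((integrable_exp_neg_mul_sq one_pos).const_mul (N.factorial : ℝ)).mono'
    (by fun_prop : Continuous _).aestronglyMeasurable (Eventually.of_forall fun x => ?_)
  have h0 : 0 ≤ x ^ (2 * N) := (even_two_mul N).pow_nonneg x
  rw [Real.norm_of_nonneg (by positivity)]
  exact pow_exp_le N x

theorem Kint_continuous (N : ℕ) : Continuous (Kint N) := by
  refine continuous_of_dominated (bound := fun x : ℝ => x ^ (2 * N) * Real.exp (-2 * x ^ 2))
    (fun η => (by fun_prop : Continuous _).aestronglyMeasurable)
    (fun η => Eventually.of_forall fun x => ?_) (pow_exp_integrable N)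
    (Eventually.of_forall fun x => by fun_prop)
  have h0 : 0 ≤ x ^ (2 * N) := (even_two_mul N).pow_nonneg x
  rw [norm_mul, Real.norm_of_nonneg (by positivity)]
  have := Real.abs_cos_le_one (η * x ^ 3)
  exact mul_le_of_le_one_right (by positivity) this

theorem Lf_Gm (b : ℝ) {a : ℝ} (ha : 0 < a) (P : ℝ[X]) :
    Integrable (fun w : ℝ => (P.map ofRealHom).eval ((a : ℂ) + w * I) * Jf 0 a b w) ∧
    Lf (Gm b) P = (∫ w : ℝ, (P.map ofRealHom).eval ((a : ℂ) + w * I) * Jf 0 a b w).re := by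
  have hN : P.natDegree < P.natDegree + 1 := Nat.lt_succ_self _
  have e : (fun w : ℝ => (P.map ofRealHom).eval ((a : ℂ) + w * I) * Jf 0 a b w)
      = fun w : ℝ => ∑ k ∈ Finset.range (P.natDegree + 1), (P.coeff k : ℂ) * Jf k a b w := by
    funext w
    rw [eval_eq_sum_range' (n := P.natDegree + 1) (by rw [natDegree_map]; exact hN), Finset.sum_mul]
    refine Finset.sum_congr rfl fun k _ => ?_
    simp [Jf]; ring
  have hi : ∀ k, Integrable (fun w => Jf k a b w) := fun k => by
    have := Jf_integrable k b ha Set.univ; rwa [Measure.restrict_univ] at this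
  rw [e]
  constructor
  · exact integrable_finsetSum _ fun k _ => (hi k).const_mul _
  · rw [integral_finsetSum _ fun k _ => (hi k).const_mul _, Lf_eq_sum _ _ _ hN, Complex.re_sum]
    refine Finset.sum_congr rfl fun k _ => ?_
    rw [integral_const_mul, Complex.re_ofReal_mul, Gm, ← VS_indep k b ha, VS, setIntegral_univ]

theorem Lf_Gm_pow (N : ℕ) {s : ℝ} (hs : 0 < s) :
    Lf (Gm (s ^ 4)) ((C s * (X - C (s ^ 2))) ^ (2 * N))
      = (-1) ^ N * (Real.exp (-4 / 3 * s ^ 6) / s) * Kint N (2 / 3 / s ^ 3) := by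
  obtain ⟨h1, h2⟩ := Lf_Gm (s ^ 4) (a := s ^ 2) (by positivity) ((C s * (X - C (s ^ 2))) ^ (2 * N))
  rw [h2, ← Complex.reCLM_apply, ← ContinuousLinearMap.integral_comp_comm _ h1]
  have e : ∀ w : ℝ, Complex.reCLM ((((C s * (X - C (s ^ 2))) ^ (2 * N)).map ofRealHom).eval
      (((s ^ 2 : ℝ) : ℂ) + w * I) * Jf 0 (s ^ 2) (s ^ 4) w)
      = ((-1) ^ N * Real.exp (-4 / 3 * s ^ 6)) * (fun x : ℝ => x ^ (2 * N) * Real.exp (-2 * x ^ 2)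
        * Real.cos (2 / 3 / s ^ 3 * x ^ 3)) (s * w) := by
    intro w
    have e1 : (((C s * (X - C (s ^ 2))) ^ (2 * N)).map ofRealHom).eval
      (((s ^ 2 : ℝ) : ℂ) + w * I) = (((-1) ^ N * (s * w) ^ (2 * N) : ℝ) : ℂ) := by
      simp only [Polynomial.map_pow, Polynomial.map_mul, Polynomial.map_sub, map_C, map_X,
        eval_pow, eval_mul, eval_sub, eval_C, eval_X, ofRealHom_eq_coe]
      have : (s : ℂ) * ((((s ^ 2 : ℝ) : ℂ) + w * I) - ((s ^ 2 : ℝ) : ℂ)) = (s * w) * I := by ring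
      rw [this, mul_pow, pow_mul I, I_sq]; push_cast; ring
    have e2 : Jf 0 (s ^ 2) (s ^ 4) w = ((Real.exp (-4 / 3 * s ^ 6 + -2 * (s * w) ^ 2) : ℝ) : ℂ)
        * cexp (((-(2 / 3 * w ^ 3) : ℝ) : ℂ) * I) := by
      rw [Jf, pow_zero, one_mul, Complex.ofReal_exp, ← Complex.exp_add]
      congr 1
      push_cast
      linear_combination (2 * s ^ 2 * w ^ 2 + (2 / 3) * w ^ 3 * I : ℂ) * Complex.I_sq
    rw [e1, e2, Complex.reCLM_apply, Complex.re_ofReal_mul, Complex.re_ofReal_mul,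
      Complex.exp_ofReal_mul_I_re, Real.cos_neg, Real.exp_add]
    have e3 : 2 / 3 / s ^ 3 * (s * w) ^ 3 = 2 / 3 * w ^ 3 := by field_simp
    simp only [e3]; ring
  rw [integral_congr_ae (Eventually.of_forall e), integral_const_mul,
    Measure.integral_comp_mul_left (fun x : ℝ => x ^ (2 * N) * Real.exp (-2 * x ^ 2)
        * Real.cos (2 / 3 / s ^ 3 * x ^ 3)) s, abs_of_pos (by positivity), smul_eq_mul, Kint]
  field_simp

theorem G_sign_aux (n ε : ℕ) (hε : ε ≤ 1) :
    ∀ᶠ s : ℝ in atTop, Pge n (((-1 : ℝ) ^ ε) • Gm (s ^ 4)) ((n + 1) / 2) := by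
  set h := (n + 1) / 2 with hh
  have hpos : PosMat (fun i j : Fin h => Kint (i + j + ε) 0) := by
    have := gram_pos (N := h) Set.univ MeasurableSet.univ (fun x => Real.exp (-2 * x ^ 2))
      (fun x => Real.exp_pos _) (fun i => 2 * (i:ℕ) + ε)
      (fun i j hij => Fin.ext (by simpa using hij))
      (fun i j => by
        have := pow_exp_integrable (i + j + ε)
        rw [integrableOn_univ]
        have e : 2 * ((i:ℕ) + j + ε) = 2 * (i:ℕ) + ε + (2 * j + ε) := by ring
        rw [e] at this; exact this) (α := 0) (β := 1) one_pos (Set.subset_univ _)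
    convert this using 3 with i j
    rw [setIntegral_univ, Kint]
    congr 1
    funext x
    have : 2 * ((i:ℕ) + j + ε) = 2 * (i:ℕ) + ε + (2 * j + ε) := by ring
    rw [this]; simp
  have hlim : Tendsto (fun s : ℝ => fun i j : Fin h => Kint (i + j + ε) (2 / 3 / s ^ 3)) atTop
      (nhds (fun i j : Fin h => Kint (i + j + ε) 0)) := by
    rw [tendsto_pi_nhds]; intro i
    rw [tendsto_pi_nhds]; intro j
    refine ((Kint_continuous _).tendsto 0).comp ?_
    exact tendsto_const_nhds.div_atTop (tendsto_pow_atTop (by norm_num))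
  filter_upwards [hlim (PosMat.isOpen.mem_nhds hpos), eventually_gt_atTop 0] with s hs hs0
  have hs' : PosMat (fun i j : Fin h => Kint (i + j + ε) (2 / 3 / s ^ 3)) := hs
  refine ⟨fun i => C ((-1) ^ (i:ℕ)) * (C s * (X - C (s ^ 2))) ^ (2 * (i:ℕ) + ε), fun i => ?_, ?_⟩
  · have h1 : (C s * (X - C (s ^ 2))).natDegree ≤ 1 := by
      refine (natDegree_C_mul_le _ _).trans ?_
      rw [natDegree_X_sub_C]
    refine (natDegree_C_mul_le _ _).trans (natDegree_pow_le.trans ?_)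
    have := i.2
    have h2 : 2 * (i:ℕ) + ε ≤ n := by omega
    nlinarith
  · convert hs'.scale (r := Real.exp (-4 / 3 * s ^ 6) / s) (by positivity) using 3 with i j
    have e : (C ((-1) ^ (i:ℕ)) * (C s * (X - C (s ^ 2))) ^ (2 * (i:ℕ) + ε)) *
        (C ((-1) ^ (j:ℕ)) * (C s * (X - C (s ^ 2))) ^ (2 * (j:ℕ) + ε))
        = C ((-1) ^ ((i:ℕ) + j)) * (C s * (X - C (s ^ 2))) ^ (2 * ((i:ℕ) + j + ε)) := by
      rw [pow_add (-1 : ℝ), C_mul]; ring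
    rw [e, Lf_smul_mom, Lf_C_mul, Lf_Gm_pow _ hs0]
    have : (-1 : ℝ) ^ ε * ((-1) ^ ((i:ℕ) + j) * (-1) ^ ((i:ℕ) + j + ε)) = 1 := by
      rw [← pow_add, ← pow_add]
      exact Even.neg_one_pow ⟨(i:ℕ) + j + ε, by ring⟩
    linear_combination (Real.exp (-4 / 3 * s ^ 6) / s) * Kint (i + j + ε) (2 / 3 / s ^ 3) * this

theorem G_sign (n : ℕ) : ∃ᶠ b in atTop, Pge n (Gm b) ((n + 1) / 2) ∧ Pge n (-Gm b) ((n + 1) / 2) := by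
  have h : Tendsto (fun s : ℝ => s ^ 4) atTop atTop := tendsto_pow_atTop (by norm_num)
  refine h.frequently (Eventually.frequently ?_)
  filter_upwards [G_sign_aux n 0 (by norm_num), G_sign_aux n 1 le_rfl] with s h1 h2
  simp only [pow_zero, one_smul, pow_one, neg_smul] at h1 h2
  exact ⟨h1, h2⟩

theorem Rec.add {b : ℝ} {m m' : ℕ → ℝ} (h : Rec b m) (h' : Rec b m') : Rec b (m + m') := by
  intro k; have := h k; have := h' k; simp only [Pi.add_apply]; linarith

theorem Rec.smul {b : ℝ} {m : ℕ → ℝ} (h : Rec b m) (c : ℝ) : Rec b (c • m) := by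
  intro k; have := h k; simp only [Pi.smul_apply, smul_eq_mul]; linear_combination c * this

theorem rec_zero {b : ℝ} {m : ℕ → ℝ} (h : Rec b m) (h0 : m 0 = 0) (h1 : m 1 = 0) : m = 0 := by
  funext k
  induction k using Nat.strong_induction_on with
  | _ k ih =>
    match k, ih with
    | 0, _ => exact h0
    | 1, _ => exact h1
    | k + 2, ih =>
      have e := h k
      have e1 := ih (k - 1) (by omega)
      have e2 := ih k (by omega)
      simp only [Pi.zero_apply] at e1 e2 ⊢
      rw [e1, e2] at e
      linarith

theorem wronskian_ne (b : ℝ) : Em b 0 * Gm b 1 - Em b 1 * Gm b 0 ≠ 0 := by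
  have hc : ∀ x y : ℝ, Em x 0 * Gm x 1 - Em x 1 * Gm x 0 = Em y 0 * Gm y 1 - Em y 1 * Gm y 0 := by
    have hd : ∀ x, HasDerivAt (fun b => Em b 0 * Gm b 1 - Em b 1 * Gm b 0) 0 x := by
      intro x
      refine (((Em_deriv 0 x).mul (Gm_deriv 1 x)).sub ((Em_deriv 1 x).mul (Gm_deriv 0 x))).congr_deriv ?_
      have e1 := Em_rec x 0
      have e2 := Gm_rec x 0
      simp at e1 e2
      simp only [zero_add, Nat.reduceAdd]
      linear_combination (-2 * Em x 0 : ℝ) * (e2 / 2) * 2 / 2 + Gm x 0 * e1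
    exact is_const_of_deriv_eq_zero (fun x => (hd x).differentiableAt) (fun x => (hd x).deriv)
  intro hW
  obtain ⟨x, ⟨g1, g2⟩, e1⟩ := ((G_sign 1).and_eventually (E_pos 1 0)).exists
  rw [hc b x] at hW
  simp only [zero_smul, add_zero] at e1
  obtain ⟨α, β, hne, h0⟩ : ∃ α β : ℝ, ¬ (α = 0 ∧ β = 0) ∧ α • Em x + β • Gm x = 0 := by
    by_cases h : Gm x 0 = 0 ∧ Em x 0 = 0
    · by_cases h' : Gm x 1 = 0 ∧ Em x 1 = 0
      · refine ⟨1, 1, by simp, ?_⟩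
        apply rec_zero (((Em_rec x).smul 1).add ((Gm_rec x).smul 1)) <;> simp [h, h']
      · refine ⟨Gm x 1, -Em x 1, by simpa using h', ?_⟩
        apply rec_zero (((Em_rec x).smul _).add ((Gm_rec x).smul _))
        · simp [h]
        · simp; ring
    · refine ⟨Gm x 0, -Em x 0, by simpa using h, ?_⟩
      apply rec_zero (((Em_rec x).smul _).add ((Gm_rec x).smul _))
      · simp; ring
      · simp; linarith
  have hker : ∀ m : ℕ → ℝ, m = 0 → KerEl 1 m 1 := by
    rintro m rfl Q _
    have := Lf_smul_mom (0:ℝ) 0 (1 * Q)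
    simpa using this
  have hE : Em x ≠ 0 := by
    intro hE
    have e2 : Pge 1 (-Em x) 2 := by rw [hE, neg_zero, ← hE]; exact e1
    have := F0 e1 e2
    omega
  have hG : Gm x ≠ 0 := by
    intro hG
    have := F0ker g1 g2 one_ne_zero (by simp) (hker _ hG)
    omega
  have hβ : β ≠ 0 := by
    intro hβ
    rw [hβ, zero_smul, add_zero] at h0
    rcases smul_eq_zero.mp h0 with h | h
    · exact hne ⟨h, hβ⟩
    · exact hE h
  have hα : α ≠ 0 := by
    intro hα
    rw [hα, zero_smul, zero_add] at h0
    rcases smul_eq_zero.mp h0 with h | h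
    · exact hne ⟨hα, h⟩
    · exact hG h
  have hEG : -Em x = (β / α) • Gm x := by
    funext k
    have := congrFun h0 k
    simp at this
    simp
    field_simp
    linarith
  have e2 : Pge 1 (-Em x) 1 := by
    rcases lt_or_gt_of_ne (div_ne_zero hβ hα) with h | h
    · have : -Em x = (-(β / α)) • (-Gm x) := by rw [hEG]; simp
      rw [this]; exact g2.scale (by linarith)
    · rw [hEG]; exact g1.scale h
  have := F0 e1 e2
  omega

end QES


namespace QES

theorem qesFun_deriv (b : ℂ) (p : ℂ[X]) :
    deriv (qesFun b p) = qesFun b (derivative p + (X ^ 2 - C b) * p) := by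
  funext z
  have h1 : HasDerivAt (fun z : ℂ => z ^ 3 / 3 - b * z) (z ^ 2 - b) z := by
    have := (((hasDerivAt_pow 3 z).div_const 3).sub ((hasDerivAt_id z).const_mul b))
    refine this.congr_deriv ?_
    push_cast; simp
  have := (p.hasDerivAt z).mul h1.cexp
  refine (this.congr_deriv ?_).deriv
  simp [qesFun]; ring

theorem witness_iff (n : ℕ) (b lam : ℂ) (p : ℂ[X]) :
    QESWitness ((n : ℂ) + 1) b lam p ↔ p ≠ 0 ∧ Top n b p + C (b ^ 2 + lam) * p = 0 := by
  rw [QESWitness, SatisfiesQuarticODE]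
  refine and_congr_right fun _ => ?_
  have key : ∀ z, (-(deriv (deriv (qesFun b p)) z) + (z ^ 4 - 2 * b * z ^ 2 + 2 * ((n : ℂ) + 1) * z) * qesFun b p z
      - lam * qesFun b p z) = -((Top n b p + C (b ^ 2 + lam) * p).eval z * cexp (z ^ 3 / 3 - b * z)) := by
    intro z
    rw [qesFun_deriv, qesFun_deriv]
    simp [qesFun, Top]
    ring
  constructor
  · intro h
    refine Polynomial.funext fun z => ?_
    have h1 := key z
    rw [h z, sub_self] at h1
    simpa [Complex.exp_ne_zero] using h1.symm
  · intro h z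
    have h1 := key z
    rw [h, eval_zero, zero_mul, neg_zero] at h1
    exact sub_eq_zero.mp h1

theorem eig_real {n : ℕ} {b μ : ℝ} {p : ℂ[X]} (h : Eig n (b : ℂ) (μ : ℂ) p) :
    (rp p).map ofRealHom = p := by
  have h2 : Eig n (b : ℂ) (μ : ℂ) (p.map (starRingEnd ℂ)) := by
    refine ⟨h.1.map _, ?_, ?_⟩
    · rw [natDegree_map]; exact h.2.1
    · have := congrArg (Polynomial.map (starRingEnd ℂ)) h.2.2
      simpa [Top, derivative_map] using this
  rw [rp_map, h2.unique h, ← two_mul, ← mul_assoc, ← C_ofNat, ← C_mul]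
  norm_num

theorem mem_gamma_iff (n m : ℕ) (q : ℝ × ℝ) :
    q ∈ qesGamma n m ↔ ∃ P : ℝ[X], Eig n q.1 (q.1 ^ 2 + q.2) P ∧
      nreal (P.map ofRealHom) = n - 2 * m := by
  constructor
  · rintro ⟨p, hp, hc⟩
    rw [witness_iff] at hp
    have h1 := eig_normalize hp.1 hp.2
    have h2 : Eig n ((q.1 : ℝ) : ℂ) ((q.1 ^ 2 + q.2 : ℝ) : ℂ) (C p.leadingCoeff⁻¹ * p) := by
      push_cast; exact h1
    have h3 := eig_real h2
    refine ⟨rp (C p.leadingCoeff⁻¹ * p), ?_, ?_⟩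
    · apply Eig.of_map; rw [h3]; exact h2
    · rw [h3, ← hc, nreal]
      congr 1
      ext z
      simp [hp.1]
  · rintro ⟨P, hP, hc⟩
    refine ⟨P.map ofRealHom, ?_, hc⟩
    rw [witness_iff]
    have h := hP.map
    push_cast at h
    exact ⟨h.1.ne_zero, h.2.2⟩

theorem eig_coeff_zero {n : ℕ} {b μ : ℝ} {P : ℝ[X]} (h : Eig n b μ P) :
    2 * P.coeff 2 - 2 * b * P.coeff 1 + μ * P.coeff 0 = 0 := by
  have := congrArg (fun q => q.coeff 0) h.2.2
  simpa only [coeff_add, coeff_C_mul, Top_coeff_zero, coeff_zero] using this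

theorem eig_coeff_succ {n : ℕ} {b μ : ℝ} {P : ℝ[X]} (h : Eig n b μ P) (k : ℕ) :
    ((k : ℝ) + 3) * (k + 2) * P.coeff (k + 3)
      - 2 * b * (k + 2) * P.coeff (k + 2) + 2 * (k - n) * P.coeff k + μ * P.coeff (k + 1) = 0 := by
  have := congrArg (fun q => q.coeff (k + 1)) h.2.2
  simpa only [coeff_add, coeff_C_mul, Top_coeff_succ, coeff_zero] using this

theorem mu_bound {n : ℕ} {b μ : ℝ} {P : ℝ[X]} (h : Eig n b μ P) :
    |μ| ≤ ((n : ℝ) + 2) ^ 2 + 2 * (n + 1) + 2 * (n + 1) * |b| := by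
  obtain ⟨k, hk, hmax⟩ := Finset.exists_max_image (Finset.range (n + 1)) (fun k => |P.coeff k|)
    ⟨0, by simp⟩
  have hlead : P.coeff n = 1 := by
    have := h.1.coeff_natDegree; rwa [h.2.1] at this
  have hall : ∀ j, |P.coeff j| ≤ |P.coeff k| := by
    intro j
    by_cases hj : j ∈ Finset.range (n + 1)
    · exact hmax j hj
    · rw [coeff_eq_zero_of_natDegree_lt (by rw [h.2.1]; simpa using hj)]; simp
  have hpos : 0 < |P.coeff k| := by
    have := hall n; rw [hlead] at this; simp at this; linarith
  set c := |P.coeff k| with hc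
  have hkn : (k : ℝ) ≤ n := by
    have : k ≤ n := by simpa [Nat.lt_succ_iff] using hk
    exact_mod_cast this
  suffices hs : |μ| * c ≤ (((n : ℝ) + 2) ^ 2 + 2 * (n + 1) + 2 * (n + 1) * |b|) * c from
    le_of_mul_le_mul_right hs hpos
  rw [hc, ← abs_mul, ← hc]
  have hb := abs_nonneg b
  have hn0 : (0:ℝ) ≤ n := Nat.cast_nonneg n
  rcases k with _ | k
  · have e : μ * P.coeff 0 = 2 * b * P.coeff 1 - 2 * P.coeff 2 := by linarith [eig_coeff_zero h]
    rw [e]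
    refine (abs_sub _ _).trans ?_
    rw [abs_mul, abs_mul, abs_mul, abs_two]
    have h1 := mul_le_mul_of_nonneg_left (hall 1) (by positivity : 0 ≤ 2 * |b|)
    have h2 := hall 2
    have h3 : 0 ≤ (n:ℝ) * c := by positivity
    have h4 : 0 ≤ (n:ℝ) * |b| * c := by positivity
    nlinarith
  · have e : μ * P.coeff (k + 1) = 2 * b * (k + 2) * P.coeff (k + 2)
        - ((k : ℝ) + 3) * (k + 2) * P.coeff (k + 3) + 2 * (n - k) * P.coeff k := by
      linarith [eig_coeff_succ h k]
    push_cast at hkn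
    have hk0 : (0:ℝ) ≤ k := Nat.cast_nonneg k
    rw [e]
    refine (abs_add_le _ _).trans ?_
    refine (add_le_add_left (abs_sub _ _) _).trans ?_
    rw [abs_mul, abs_mul (2 * b), abs_mul 2 b, abs_two, abs_mul (((k:ℝ) + 3) * (k + 2)), abs_mul (2 * ((n:ℝ) - k)),
      abs_of_nonneg (by linarith : (0:ℝ) ≤ k + 2),
      abs_of_nonneg (by positivity : (0:ℝ) ≤ ((k:ℝ) + 3) * (k + 2)),
      abs_of_nonneg (by linarith : (0:ℝ) ≤ 2 * ((n:ℝ) - k))]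
    have h1 : 2 * |b| * (k + 2) * |P.coeff (k + 2)| ≤ 2 * |b| * (n + 1) * c :=
      mul_le_mul (mul_le_mul_of_nonneg_left (by linarith) (by positivity)) (hall _) (abs_nonneg _)
        (by positivity)
    have h2 : ((k:ℝ) + 3) * (k + 2) * |P.coeff (k + 3)| ≤ (n + 2) * (n + 2) * c :=
      mul_le_mul (mul_le_mul (by linarith) (by linarith) (by linarith) (by linarith)) (hall _)
        (abs_nonneg _) (by positivity)
    have h3 : 2 * ((n:ℝ) - k) * |P.coeff k| ≤ 2 * (n + 1) * c :=
      mul_le_mul (by linarith) (hall _) (abs_nonneg _) (by positivity)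
    linarith

theorem coeff_fun (n k : ℕ) : ∃ g : ℝ × ℝ → ℝ, Continuous g ∧
    ∀ b μ P, Eig n b μ P → P.coeff k = g (b, μ) := by
  obtain h | h := lt_or_ge n k
  · exact ⟨fun _ => 0, continuous_const, fun b μ P hP =>
      coeff_eq_zero_of_natDegree_lt (by rw [hP.2.1]; exact h)⟩
  · obtain ⟨j, rfl⟩ := Nat.exists_eq_add_of_le' h
    clear h
    induction j using Nat.strong_induction_on generalizing k with
    | _ j ih =>
      rcases j with _ | j
      · refine ⟨fun _ => 1, continuous_const, fun b μ P hP => ?_⟩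
        have := hP.1.coeff_natDegree; rw [hP.2.1] at this; simpa using this
      · have ih' : ∀ i, i < 3 → ∃ g : ℝ × ℝ → ℝ, Continuous g ∧
            ∀ b μ P, Eig (j + 1 + k) b μ P → P.coeff (k + 1 + i) = g (b, μ) := by
          intro i hi
          by_cases hij : i ≤ j
          · have := ih (j - i) (by omega) (k + 1 + i)
            have e : j - i + (k + 1 + i) = j + 1 + k := by omega
            rwa [e] at this
          · refine ⟨fun _ => 0, continuous_const, fun b μ P hP =>
              coeff_eq_zero_of_natDegree_lt (by rw [hP.2.1]; omega)⟩
        obtain ⟨g0, c0, h0⟩ := ih' 0 (by norm_num)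
        obtain ⟨g1, c1, h1⟩ := ih' 1 (by norm_num)
        obtain ⟨g2, c2, h2⟩ := ih' 2 (by norm_num)
        refine ⟨fun q => (((k : ℝ) + 3) * (k + 2) * g2 q - 2 * q.1 * (k + 2) * g1 q + q.2 * g0 q)
          / (2 * (j + 1)), by fun_prop, fun b μ P hP => ?_⟩
        have e := eig_coeff_succ hP k
        simp only
        rw [← h0 b μ P hP, ← h1 b μ P hP, ← h2 b μ P hP]
        push_cast at e
        rw [eq_div_iff (by positivity)]
        linarith

theorem eig_limit {ι : Type*} {l : Filter ι} [l.NeBot] {n : ℕ} {b μ : ι → ℝ} {P : ι → ℝ[X]}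
    {b' μ' : ℝ} (h : ∀ᶠ i in l, Eig n (b i) (μ i) (P i)) (hb : Tendsto b l (nhds b'))
    (hμ : Tendsto μ l (nhds μ')) :
    ∃ P', Eig n b' μ' P' ∧ ∀ k, Tendsto (fun i => (P i).coeff k) l (nhds (P'.coeff k)) := by
  choose g hg hgP using coeff_fun n
  have hlim : ∀ k, Tendsto (fun i => (P i).coeff k) l (nhds (g k (b', μ'))) := by
    intro k
    refine (((hg k).tendsto (b', μ')).comp (hb.prodMk_nhds hμ)).congr' ?_
    filter_upwards [h] with i hi
    exact (hgP k _ _ _ hi).symm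
  have hg0 : ∀ k, n < k → g k (b', μ') = 0 := by
    intro k hk
    refine tendsto_nhds_unique (hlim k) (tendsto_const_nhds.congr' ?_)
    filter_upwards [h] with i hi
    exact (coeff_eq_zero_of_natDegree_lt (by rw [hi.2.1]; exact hk)).symm
  have hg1 : g n (b', μ') = 1 := by
    refine tendsto_nhds_unique (hlim n) (tendsto_const_nhds.congr' ?_)
    filter_upwards [h] with i hi
    have := hi.1.coeff_natDegree; rw [hi.2.1] at this; exact this.symm
  set P' : ℝ[X] := ∑ k ∈ Finset.range (n + 1), monomial k (g k (b', μ')) with hP'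
  have hc : ∀ k, P'.coeff k = g k (b', μ') := by
    intro k
    rw [hP', finsetSum_coeff]
    simp only [coeff_monomial]
    rw [Finset.sum_ite_eq' (Finset.range (n + 1)) k]
    split_ifs with h
    · rfl
    · exact (hg0 k (by simpa using h)).symm
  have hdeg : P'.natDegree = n := by
    apply le_antisymm
    · rw [natDegree_le_iff_coeff_eq_zero]
      intro k hk; rw [hc, hg0 k hk]
    · exact le_natDegree_of_ne_zero (by rw [hc, hg1]; norm_num)
  refine ⟨P', ⟨?_, hdeg, ?_⟩, fun k => by rw [hc]; exact hlim k⟩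
  · rw [Monic, leadingCoeff, hdeg, hc, hg1]
  · ext k
    rcases k with _ | k
    · rw [coeff_add, coeff_C_mul, Top_coeff_zero, coeff_zero, hc, hc, hc]
      have h1 := ((((hlim 2).const_mul 2).sub ((hb.const_mul 2).mul (hlim 1))).add (hμ.mul (hlim 0)))
      refine tendsto_nhds_unique h1 (tendsto_const_nhds.congr' ?_)
      filter_upwards [h] with i hi
      exact (eig_coeff_zero hi).symm
    · rw [coeff_add, coeff_C_mul, Top_coeff_succ, coeff_zero, hc, hc, hc, hc]
      have h1 := ((((hlim (k + 3)).const_mul (((k:ℝ) + 3) * (k + 2))).sub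
        (((hb.const_mul 2).mul_const ((k:ℝ) + 2)).mul (hlim (k + 2)))).add
        ((hlim k).const_mul (2 * ((k:ℝ) - n)))).add (hμ.mul (hlim (k + 1)))
      refine tendsto_nhds_unique h1 (tendsto_const_nhds.congr' ?_)
      filter_upwards [h] with i hi
      exact (eig_coeff_succ hi k).symm

end QES


namespace QES

noncomputable def wt (b x : ℝ) : ℝ := Real.exp (2 * (x ^ 3 / 3 - b * x))

theorem wt_pos (b x : ℝ) : 0 < wt b x := Real.exp_pos _

theorem wt_deriv (b : ℝ) (q : ℝ[X]) (x : ℝ) :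
    HasDerivAt (fun x => q.eval x * wt b x) ((Dop b q).eval x * wt b x) x := by
  have h1 : HasDerivAt (fun x : ℝ => 2 * (x ^ 3 / 3 - b * x)) (2 * x ^ 2 - 2 * b) x := by
    have := (((hasDerivAt_pow 3 x).div_const 3).sub ((hasDerivAt_id x).const_mul b)).const_mul 2
    refine this.congr_deriv ?_
    push_cast; simp; ring
  refine ((q.hasDerivAt x).mul h1.exp).congr_deriv ?_
  simp [Dop, wt]; ring

theorem wt_tendsto (b : ℝ) (q : ℝ[X]) :
    Tendsto (fun x => q.eval x * wt b x) atBot (nhds 0) := by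
  have e : (fun x => q.eval x * wt b x)
      = fun x => ∑ k ∈ Finset.range (q.natDegree + 1), q.coeff k * rf k b x := by
    funext x
    rw [eval_eq_sum_range, Finset.sum_mul]
    refine Finset.sum_congr rfl fun k _ => ?_
    rw [rf, wt]; ring
  rw [e]
  have := tendsto_finsetSum (Finset.range (q.natDegree + 1))
    (fun k _ => (rf_tendsto k b).const_mul (q.coeff k))
  simpa using this

theorem mono_flow {f f' : ℝ → ℝ} (hd : ∀ x, HasDerivAt f (f' x) x) (h0 : ∀ x, 0 ≤ f' x)
    (hl : Tendsto f atBot (nhds 0)) : (∀ x, 0 ≤ f x) ∧ ∀ x0, f x0 = 0 → ∀ x < x0, f' x = 0 := by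
  have hmono : Monotone f := monotone_of_deriv_nonneg (fun x => (hd x).differentiableAt)
    (fun x => by rw [(hd x).deriv]; exact h0 x)
  have hn : ∀ x, 0 ≤ f x := fun x => hmono.le_of_tendsto hl x
  refine ⟨hn, fun x0 hx0 x hx => ?_⟩
  have : f =ᶠ[nhds x] fun _ => 0 := by
    filter_upwards [Iio_mem_nhds hx] with y hy
    exact le_antisymm ((hmono (le_of_lt hy)).trans hx0.le) (hn y)
  exact (hd x).unique ((hasDerivAt_const x (0:ℝ)).congr_of_eventuallyEq this)

theorem eig_eval {n : ℕ} {b μ : ℝ} {P : ℝ[X]} (h : Eig n b μ P) (x : ℝ) :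
    (derivative (derivative P)).eval x + 2 * (x ^ 2 - b) * (derivative P).eval x
      - 2 * n * x * P.eval x + μ * P.eval x = 0 := by
  have := congrArg (fun q => q.eval x) h.2.2
  simpa [Top] using this

theorem exists_lt_eval_ne {P : ℝ[X]} (hP : P ≠ 0) (x0 : ℝ) : ∃ x < x0, P.eval x ≠ 0 := by
  by_contra hcon
  push Not at hcon
  apply hP
  apply Polynomial.eq_zero_of_infinite_isRoot
  exact (Set.Iio_infinite x0).mono fun x hx => hcon x hx

theorem no_zero_of_pos {n : ℕ} {b μ : ℝ} {P : ℝ[X]} (h : Eig n b μ P)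
    (hV : ∀ x : ℝ, 0 < (x ^ 2 - b) ^ 2 + 2 * (n + 1) * x - μ) (x0 : ℝ) : P.eval x0 ≠ 0 := by
  intro hx0
  set q : ℝ[X] := P * derivative P + (X ^ 2 - C b) * (P * P) with hq
  have hD : ∀ x, (Dop b q).eval x = ((derivative P).eval x + (x ^ 2 - b) * P.eval x) ^ 2
      + ((x ^ 2 - b) ^ 2 + 2 * (n + 1) * x - μ) * (P.eval x) ^ 2 := by
    intro x
    have e := eig_eval h x
    simp only [hq, Dop]
    simp
    linear_combination (P.eval x) * e
  have hm := mono_flow (wt_deriv b q) (fun x => by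
    rw [hD]
    have := hV x
    have := wt_pos b x
    positivity) (wt_tendsto b q)
  obtain ⟨x, hx, hxP⟩ := exists_lt_eval_ne h.1.ne_zero x0
  have h1 := hm.2 x0 (by simp [hq, hx0]) x hx
  rw [hD] at h1
  have h2 := hV x
  have h3 := wt_pos b x
  have h4 : 0 < (P.eval x) ^ 2 := by positivity
  have h5 := mul_pos h2 h4
  have h6 : 0 < (((derivative P).eval x + (x ^ 2 - b) * P.eval x) ^ 2
      + ((x ^ 2 - b) ^ 2 + 2 * (n + 1) * x - μ) * (P.eval x) ^ 2) * wt b x := by positivity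
  linarith

theorem no_zero_neg (n : ℕ) : ∃ B0 : ℝ, ∀ b ≤ B0, ∀ μ P, Eig n b μ P → ∀ x : ℝ, P.eval x ≠ 0 := by
  set K1 : ℝ := ((n : ℝ) + 2) ^ 2 + 2 * (n + 1) with hK1
  set K2 : ℝ := 2 * ((n:ℝ) + 1) with hK2
  have hK10 : 0 ≤ K1 := by positivity
  have hK20 : 0 ≤ K2 := by positivity
  refine ⟨-(1 + K1 + K2 + ((n:ℝ) + 1) ^ 2), fun b hb μ P h => no_zero_of_pos h fun x => ?_⟩
  have h1 := mu_bound h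
  have hb0 : b < 0 := by nlinarith [sq_nonneg ((n:ℝ) + 1)]
  rw [abs_of_neg hb0] at h1
  have h2 := (abs_le.mp h1).2
  obtain ⟨β, rfl⟩ : ∃ β, b = -β := ⟨-b, by ring⟩
  have hβ : 1 + K1 + K2 + ((n:ℝ) + 1) ^ 2 ≤ β := by linarith
  have hβ1 : 1 ≤ β := by nlinarith [sq_nonneg ((n:ℝ) + 1)]
  have e1 : β * (1 + K1 + K2 + ((n:ℝ) + 1) ^ 2) ≤ β * β := by gcongr
  have e2 : μ ≤ K1 + K2 * β := by simpa using h2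
  have e3 : K1 ≤ β * K1 := by nlinarith
  have e4 : ((n:ℝ) + 1) ^ 2 ≤ β * ((n:ℝ) + 1) ^ 2 := by nlinarith [sq_nonneg ((n:ℝ) + 1)]
  have e5 : 0 ≤ (x + (n + 1)) ^ 2 := sq_nonneg _
  have e6 : x ^ 2 ≤ β * x ^ 2 := by nlinarith [sq_nonneg x]
  have e7 : 0 ≤ x ^ 4 := by positivity
  nlinarith

theorem nreal_zero_iff {n : ℕ} {b μ : ℝ} {P : ℝ[X]} (h : Eig n b μ P) :
    nreal (P.map ofRealHom) = 0 ↔ ∀ x : ℝ, P.eval x ≠ 0 := by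
  have hfin : {z : ℂ | (P.map ofRealHom).eval z = 0 ∧ z.im = 0}.Finite := by
    refine ((P.map ofRealHom).roots.toFinset.finite_toSet).subset fun z hz => ?_
    simp only [Finset.mem_coe, Multiset.mem_toFinset]
    rw [mem_roots h.map.1.ne_zero]; exact hz.1
  have hev : ∀ x : ℝ, (P.map ofRealHom).eval (x : ℂ) = ((P.eval x : ℝ) : ℂ) := by
    intro x
    have := Polynomial.eval₂_at_apply (p := P) ofRealHom x
    rw [← eval_map] at this
    exact this
  rw [nreal, Set.ncard_eq_zero hfin, Set.eq_empty_iff_forall_notMem]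
  constructor
  · intro h1 x hx
    exact h1 x ⟨by rw [hev, hx]; simp, by simp⟩
  · rintro h1 z ⟨hz1, hz2⟩
    have : z = ((z.re : ℝ) : ℂ) := by apply Complex.ext <;> simp [hz2]
    rw [this, hev] at hz1
    exact h1 z.re (by exact_mod_cast hz1)

theorem pos_of_no_zero {n : ℕ} {b μ : ℝ} {P : ℝ[X]} (h : Eig n b μ P)
    (h0 : ∀ x : ℝ, P.eval x ≠ 0) (x : ℝ) : 0 < P.eval x := by
  by_contra hneg
  have hx : P.eval x < 0 := lt_of_le_of_ne (not_lt.mp hneg) (h0 x)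
  by_cases hn : n = 0
  · have : P = 1 := h.1.natDegree_eq_zero.mp (h.2.1.trans hn)
    rw [this] at hx; simp at hx; linarith
  · have ht : Tendsto (fun x => P.eval x) atTop atTop := by
      apply Polynomial.tendsto_atTop_of_leadingCoeff_nonneg
      · exact natDegree_pos_iff_degree_pos.mp (by rw [h.2.1]; omega)
      · rw [h.1.leadingCoeff]; exact zero_le_one
    obtain ⟨y, hy⟩ := (ht.eventually_gt_atTop 0).exists
    obtain ⟨z, hz⟩ := mem_range_of_exists_le_of_exists_ge P.continuous ⟨x, hx.le⟩ ⟨y, hy.le⟩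
    exact h0 z hz

theorem ratio_tendsto {p q : ℝ[X]} (hp : p.Monic) (hq : q.Monic) (hd : p.natDegree = q.natDegree) :
    Tendsto (fun x => q.eval x / p.eval x) atTop (nhds 1) ∧
    Tendsto (fun x => q.eval x / p.eval x) atBot (nhds 1) := by
  constructor
  · have := Polynomial.div_tendsto_atTop_leadingCoeff_div_of_degree_eq q p
      (by rw [degree_eq_natDegree hp.ne_zero, degree_eq_natDegree hq.ne_zero, hd])
    rw [hp.leadingCoeff, hq.leadingCoeff] at this
    simpa using this
  · have hX : (-X : ℝ[X]).natDegree = 1 := by simp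
    have e : ∀ r : ℝ[X], r.Monic → (r.comp (-X)).leadingCoeff = (-1) ^ r.natDegree := by
      intro r hr
      rw [leadingCoeff_comp (by rw [hX]; norm_num), hr.leadingCoeff]; simp
    have hne : ∀ r : ℝ[X], r.Monic → r.comp (-X) ≠ 0 := by
      intro r hr h0
      have := e r hr
      rw [h0] at this
      simp at this
      exact pow_ne_zero _ (by norm_num : (-1:ℝ) ≠ 0) this.symm
    have := Polynomial.div_tendsto_atTop_leadingCoeff_div_of_degree_eq (q.comp (-X)) (p.comp (-X))
      (by rw [degree_eq_natDegree (hne p hp), degree_eq_natDegree (hne q hq), natDegree_comp,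
            natDegree_comp, hd])
    rw [e p hp, e q hq, hd, div_self (by simp)] at this
    have h2 := this.comp tendsto_neg_atBot_atTop
    refine h2.congr fun x => ?_
    simp

theorem zero_unique_aux {n : ℕ} {b μ1 μ2 : ℝ} {p q : ℝ[X]} (hp : Eig n b μ1 p) (hq : Eig n b μ2 q)
    (hp0 : ∀ x : ℝ, p.eval x ≠ 0) (hq0 : ∀ x : ℝ, q.eval x ≠ 0) : ¬ μ2 < μ1 := by
  intro hlt
  have hpp := pos_of_no_zero hp hp0
  have hqp := pos_of_no_zero hq hq0
  have hD : ∀ x, (Dop b (p * derivative q - derivative p * q)).eval x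
      = (μ1 - μ2) * (p.eval x * q.eval x) := by
    intro x
    have e1 := eig_eval hp x
    have e2 := eig_eval hq x
    simp only [Dop]
    simp
    linear_combination (p.eval x) * e2 - (q.eval x) * e1
  have hD0 : ∀ x, 0 < (Dop b (p * derivative q - derivative p * q)).eval x * wt b x := by
    intro x
    rw [hD]
    have := wt_pos b x
    have := hpp x
    have := hqp x
    have : 0 < μ1 - μ2 := by linarith
    positivity
  have hm := mono_flow (wt_deriv b _) (fun x => (hD0 x).le) (wt_tendsto b _)
  have hpos : ∀ x, 0 < p.eval x * (derivative q).eval x - (derivative p).eval x * q.eval x := by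
    intro x
    have h1 := hm.1 x
    have h2 : (p * derivative q - derivative p * q).eval x * wt b x ≠ 0 := by
      intro h
      have := hm.2 x h (x - 1) (by linarith)
      have := hD0 (x - 1)
      linarith
    have h3 := lt_of_le_of_ne h1 h2.symm
    have h4 := pos_of_mul_pos_left h3 (wt_pos b x).le
    simpa using h4
  have hmono : StrictMono (fun x => q.eval x / p.eval x) := by
    refine strictMono_of_deriv_pos fun x => ?_
    have := ((q.hasDerivAt x).div (p.hasDerivAt x) (hp0 x)).deriv
    have e : deriv (fun x => q.eval x / p.eval x) x = _ := this
    rw [e]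
    apply div_pos
    · linarith [hpos x]
    · have := hpp x; positivity
  obtain ⟨t1, t2⟩ := ratio_tendsto hp.1 hq.1 (hp.2.1.trans hq.2.1.symm)
  have l1 := hmono.monotone.ge_of_tendsto t1 1
  have l2 := hmono.monotone.le_of_tendsto t2 0
  have l3 := hmono (zero_lt_one (α := ℝ))
  simp only at l1 l2 l3
  linarith

theorem zero_unique {n : ℕ} {b μ1 μ2 : ℝ} {p q : ℝ[X]} (hp : Eig n b μ1 p) (hq : Eig n b μ2 q)
    (hp0 : ∀ x : ℝ, p.eval x ≠ 0) (hq0 : ∀ x : ℝ, q.eval x ≠ 0) : μ1 = μ2 :=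
  le_antisymm (not_lt.mp (zero_unique_aux hp hq hp0 hq0)) (not_lt.mp (zero_unique_aux hq hp hq0 hp0))

end QES


namespace QES

noncomputable def Mp (α β b : ℝ) : ℕ → ℝ := α • Em b + β • Gm b

theorem Mp_apply (α β b : ℝ) (k : ℕ) : Mp α β b k = α * Em b k + β * Gm b k := by
  simp [Mp]

theorem Mp_rec (α β b : ℝ) : Rec b (Mp α β b) := ((Em_rec b).smul α).add ((Gm_rec b).smul β)

theorem Mp_neg (α β b : ℝ) : Mp (-α) (-β) b = - Mp α β b := by
  funext k; simp [Mp]; ring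

theorem Mp_smul (r α β b : ℝ) : Mp (r * α) (r * β) b = r • Mp α β b := by
  funext k; simp [Mp]; ring

theorem Mp_h01 {α β : ℝ} (h : ¬ (α = 0 ∧ β = 0)) (b : ℝ) : ¬ (Mp α β b 0 = 0 ∧ Mp α β b 1 = 0) := by
  rintro ⟨h0, h1⟩
  rw [Mp_apply] at h0 h1
  have w := wronskian_ne b
  apply h
  constructor
  · have : α * (Em b 0 * Gm b 1 - Em b 1 * Gm b 0) = 0 := by
      linear_combination Gm b 1 * h0 - Gm b 0 * h1
    exact (mul_eq_zero.mp this).resolve_right w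
  · have : β * (Em b 0 * Gm b 1 - Em b 1 * Gm b 0) = 0 := by
      linear_combination Em b 0 * h1 - Em b 1 * h0
    exact (mul_eq_zero.mp this).resolve_right w

theorem Mp_deriv (α β b : ℝ) (k : ℕ) :
    HasDerivAt (fun b => Mp α β b k) (-2 * Mp α β b (k + 1)) b := by
  have h := ((Em_deriv k b).const_mul α).add ((Gm_deriv k b).const_mul β)
  have e : (fun b => Mp α β b k) = (fun b => α * Em b k + β * Gm b k) := by
    funext b; exact Mp_apply _ _ _ _
  rw [e]
  refine h.congr_deriv ?_
  rw [Mp_apply]; ring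

theorem Em_cont (k : ℕ) : Continuous (fun b => Em b k) :=
  continuous_iff_continuousAt.mpr fun b => (Em_deriv k b).continuousAt

theorem Gm_cont (k : ℕ) : Continuous (fun b => Gm b k) :=
  continuous_iff_continuousAt.mpr fun b => (Gm_deriv k b).continuousAt

theorem Mp_cont {X : Type*} [TopologicalSpace X] {f g h : X → ℝ} (hf : Continuous f)
    (hg : Continuous g) (hh : Continuous h) : Continuous (fun x => Mp (f x) (g x) (h x)) := by
  refine continuous_pi fun k => ?_
  simp only [Mp_apply]
  exact (hf.mul ((Em_cont k).comp hh)).add (hg.mul ((Gm_cont k).comp hh))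

theorem Lf_shift (m : ℕ → ℝ) (P : ℝ[X]) : Lf (fun k => -2 * m (k + 1)) P = -2 * Lf m (X * P) := by
  induction P using Polynomial.induction_on' with
  | add p q hp hq => rw [map_add, hp, hq, mul_add, map_add]; ring
  | monomial k a =>
    rw [Lf_monomial, X_mul_monomial, Lf_monomial]; ring

theorem Lf_kap (m : ℕ → ℝ) (P : ℝ[X]) : Lf (fun k => -2 * m (k + 1)) (P * P) = kap m P := by
  rw [Lf_shift, kap, sq]

def Kap (n : ℕ) (L : ℕ → ℝ) (k : ℕ) : Prop := Pge n L k ∧ Pge n (-L) k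
def Dfn (n : ℕ) (L : ℕ → ℝ) (k : ℕ) : Prop := Pge n L k ∨ Pge n (-L) k

theorem Pge.isOpen_neg (n k : ℕ) : IsOpen {m : ℕ → ℝ | Pge n (-m) k} :=
  (Pge.isOpen n k).preimage continuous_neg

theorem Kap.isOpen (n k : ℕ) : IsOpen {L | Kap n L k} :=
  (Pge.isOpen n k).inter (Pge.isOpen_neg n k)

theorem Dfn.isOpen (n k : ℕ) : IsOpen {L | Dfn n L k} :=
  (Pge.isOpen n k).union (Pge.isOpen_neg n k)

theorem Kap.neg {n k : ℕ} {L : ℕ → ℝ} (h : Kap n L k) : Kap n (-L) k :=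
  ⟨h.2, by rw [neg_neg]; exact h.1⟩

theorem Dfn.neg {n k : ℕ} {L : ℕ → ℝ} (h : Dfn n L k) : Dfn n (-L) k :=
  h.elim (fun h => Or.inr (by rw [neg_neg]; exact h)) Or.inl

theorem Kap.mono {n k k' : ℕ} {L : ℕ → ℝ} (h : Kap n L k) (hk : k' ≤ k) : Kap n L k' :=
  ⟨h.1.mono hk, h.2.mono hk⟩

theorem Dfn.mono {n k k' : ℕ} {L : ℕ → ℝ} (h : Dfn n L k) (hk : k' ≤ k) : Dfn n L k' :=
  h.imp (fun h => h.mono hk) (fun h => h.mono hk)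

theorem Kap.scale {n k : ℕ} {L : ℕ → ℝ} (h : Kap n L k) {r : ℝ} (hr : r ≠ 0) : Kap n (r • L) k := by
  rcases lt_or_gt_of_ne hr with h0 | h0
  · have h1 := h.1.scale (neg_pos.mpr h0)
    have h2 := h.2.scale (neg_pos.mpr h0)
    rw [smul_neg, neg_smul, neg_neg] at h2
    rw [neg_smul] at h1
    exact ⟨h2, h1⟩
  · have h1 := h.1.scale h0
    have h2 := h.2.scale h0
    rw [smul_neg] at h2
    exact ⟨h1, h2⟩

theorem Dfn.not_Kap {n j k : ℕ} {L : ℕ → ℝ} (h : Dfn n L j) (hjk : n + 1 < j + k) : ¬ Kap n L k := by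
  rintro ⟨h1, h2⟩
  rcases h with h | h
  · have := F0 h h2; omega
  · have := F0 h1 h; omega

/-- dichotomy -/
theorem dich {n : ℕ} {b : ℝ} {L : ℕ → ℝ} (hL : Rec b L) (h01 : ¬ (L 0 = 0 ∧ L 1 = 0)) :
    (∃ j k, j + k = n + 1 ∧ Pge n L j ∧ Pge n (-L) k) ∨ ∃ μ P, Eig n b μ P ∧ Lf L P = 0 := by
  by_cases h : ∀ w : ℝ[X], w.natDegree ≤ n → KerEl n L w → w = 0
  · exact Or.inl (F3 h)
  · push Not at h
    obtain ⟨w, h1, h2, h3⟩ := h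
    exact Or.inr (ST2 hL h01 w h3 h1 h2)

theorem degen_pos {n m' : ℕ} {α β b μ : ℝ} {P : ℝ[X]} (h : Eig n b μ P)
    (h0 : Lf (Mp α β b) P = 0) (hk : 0 < kap (Mp α β b) P)
    (hp : Pge n (Mp α β b) (n - m')) (hn : Pge n (-Mp α β b) m') :
    (∀ᶠ s in nhdsWithin b (Set.Ioi b), Pge n (Mp α β s) (n - m' + 1)) ∧
    (∀ᶠ s in nhdsWithin b (Set.Iio b), Pge n (Mp α β s) (n - m') ∧ Pge n (-Mp α β s) (m' + 1)) := by
  have hker : KerEl n (Mp α β b) P := fun Q hQ => ST1 h (Mp_rec _ _ _) h0 Q hQ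
  have hpos : 0 < Lf (fun k => -2 * Mp α β b (k + 1)) (P * P) := by rw [Lf_kap]; exact hk
  refine ⟨F4 (Mp_deriv α β b) h.2.1.le hker hpos hp, ?_⟩
  have h1 := F4left (Mp_deriv α β b) h.2.1.le hker hpos hn
  have hc : Continuous (fun s => Mp α β s) := Mp_cont continuous_const continuous_const continuous_id
  have h2 : ∀ᶠ s in nhds b, Pge n (Mp α β s) (n - m') :=
    ((Pge.isOpen n (n-m')).preimage hc).mem_nhds hp
  exact (h2.filter_mono nhdsWithin_le_nhds).and h1

theorem degen {n : ℕ} {α β b μ : ℝ} {P : ℝ[X]} (hαβ : ¬ (α = 0 ∧ β = 0)) (h : Eig n b μ P)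
    (h0 : Lf (Mp α β b) P = 0) :
    ∃ m', nreal (P.map ofRealHom) + 2 * m' = n ∧
      ((Pge n (Mp α β b) (n - m') ∧ Pge n (-Mp α β b) m') ∨
       (Pge n (-Mp α β b) (n - m') ∧ Pge n (Mp α β b) m')) ∧
      (∀ᶠ s in nhdsWithin b (Set.Ioi b), Dfn n (Mp α β s) (n - m' + 1)) ∧
      (∀ k, k ≤ n - m' → k ≤ m' + 1 → ∀ᶠ s in nhdsWithin b (Set.Iio b), Kap n (Mp α β s) k) := by
  obtain ⟨hk, m', hm', hp, hn⟩ := ST3 h (Mp_rec α β b) (Mp_h01 hαβ b) h0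
  refine ⟨m', hm', ?_⟩
  rcases lt_or_gt_of_ne hk with hk | hk
  · obtain ⟨h1, h2⟩ := hn hk
    refine ⟨Or.inr ⟨h1, h2⟩, ?_⟩
    have h0' : Lf (Mp (-α) (-β) b) P = 0 := by rw [Mp_neg, Lf_neg_mom, h0, neg_zero]
    have hk' : 0 < kap (Mp (-α) (-β) b) P := by
      rw [Mp_neg, kap, Lf_neg_mom]; rw [kap] at hk; linarith
    obtain ⟨a1, a2⟩ := degen_pos (m' := m') h h0' hk' (by rw [Mp_neg]; exact h1)
      (by rw [Mp_neg, neg_neg]; exact h2)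
    refine ⟨a1.mono fun s hs => ?_, fun k k1 k2 => a2.mono fun s hs => ?_⟩
    · rw [Mp_neg] at hs; exact Or.inr hs
    · rw [Mp_neg, neg_neg] at hs; exact ⟨hs.2.mono k2, hs.1.mono k1⟩
  · obtain ⟨h1, h2⟩ := hp hk
    refine ⟨Or.inl ⟨h1, h2⟩, ?_⟩
    obtain ⟨a1, a2⟩ := degen_pos (m' := m') h h0 hk h1 h2
    exact ⟨a1.mono fun s hs => Or.inl hs,
      fun k k1 k2 => a2.mono fun s hs => ⟨hs.1.mono k1, hs.2.mono k2⟩⟩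

section leaf
variable {n m : ℕ} {α β : ℝ}

theorem leaf_cont (α β : ℝ) : Continuous (fun s => Mp α β s) :=
  Mp_cont continuous_const continuous_const continuous_id

theorem right_step (hαβ : ¬ (α = 0 ∧ β = 0)) {b : ℝ} (hb : ¬ Kap n (Mp α β b) (m + 1)) :
    ∀ᶠ s in nhdsWithin b (Set.Ioi b), Dfn n (Mp α β s) (n + 1 - m) := by
  rcases dich (n := n) (Mp_rec α β b) (Mp_h01 hαβ b) with ⟨j, k, hjk, hj, hk⟩ | ⟨μ, P, hP, h0⟩
  · have hD : Dfn n (Mp α β b) (n + 1 - m) := by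
      by_cases h1 : m + 1 ≤ j
      · by_cases h2 : m + 1 ≤ k
        · exact absurd ⟨hj.mono h1, hk.mono h2⟩ hb
        · exact Or.inl (hj.mono (by omega))
      · exact Or.inr (hk.mono (by omega))
    have : ∀ᶠ s in nhds b, Dfn n (Mp α β s) (n + 1 - m) :=
      ((Dfn.isOpen n _).preimage (leaf_cont α β)).mem_nhds hD
    exact this.filter_mono nhdsWithin_le_nhds
  · obtain ⟨m', hm', hs, hr, -⟩ := degen hαβ hP h0
    have : m' ≤ m := by
      by_contra hlt
      apply hb
      rcases hs with ⟨h1, h2⟩ | ⟨h1, h2⟩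
      · exact ⟨h1.mono (by omega), h2.mono (by omega)⟩
      · exact ⟨h2.mono (by omega), h1.mono (by omega)⟩
    exact hr.mono fun s hs => hs.mono (by omega)

theorem up_ray (hmn : m ≤ n) (hαβ : ¬ (α = 0 ∧ β = 0)) {b b' : ℝ} (hb : ¬ Kap n (Mp α β b) (m + 1))
    (hbb : b ≤ b') : ¬ Kap n (Mp α β b') (m + 1) := by
  set s : Set ℝ := {b | ¬ Kap n (Mp α β b) (m + 1)} with hs
  have hcl : IsClosed s :=
    (((Kap.isOpen n (m+1)).preimage (leaf_cont α β)).isClosed_compl)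
  have := IsClosed.Icc_subset_of_forall_exists_gt (s := s) (a := b) (b := b')
    (hcl.inter isClosed_Icc) hb (by
      rintro x ⟨hx, hx2⟩ y hy
      have h1 := right_step (n := n) (m := m) hαβ hx
      have h2 : ∀ᶠ z in nhdsWithin x (Set.Ioi x), z ∈ Set.Ioc x y := Ioc_mem_nhdsGT hy
      obtain ⟨z, hz1, hz2⟩ := (h1.and h2).exists
      exact ⟨z, hz1.not_Kap (by omega), hz2⟩)
  exact this ⟨hbb, le_rfl⟩

theorem degen_eq (hαβ : ¬ (α = 0 ∧ β = 0)) {b : ℝ} (hb : ¬ Kap n (Mp α β b) (m + 1))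
    (hD : ¬ Dfn n (Mp α β b) (n + 1 - m)) :
    ∃ μ P, Eig n b μ P ∧ Lf (Mp α β b) P = 0 ∧ nreal (P.map ofRealHom) + 2 * m = n := by
  rcases dich (n := n) (Mp_rec α β b) (Mp_h01 hαβ b) with ⟨j, k, hjk, hj, hk⟩ | ⟨μ, P, hP, h0⟩
  · exfalso
    apply hD
    by_cases h1 : m + 1 ≤ j
    · by_cases h2 : m + 1 ≤ k
      · exact absurd ⟨hj.mono h1, hk.mono h2⟩ hb
      · exact Or.inl (hj.mono (by omega))
    · exact Or.inr (hk.mono (by omega))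
  · obtain ⟨m', hm', hs, hr, -⟩ := degen hαβ hP h0
    have h1 : m' ≤ m := by
      by_contra hlt
      apply hb
      rcases hs with ⟨h1, h2⟩ | ⟨h1, h2⟩
      · exact ⟨h1.mono (by omega), h2.mono (by omega)⟩
      · exact ⟨h2.mono (by omega), h1.mono (by omega)⟩
    have h2 : m ≤ m' := by
      by_contra hlt
      apply hD
      rcases hs with ⟨h1, h2⟩ | ⟨h1, h2⟩
      · exact Or.inl (h1.mono (by omega))
      · exact Or.inr (h1.mono (by omega))
    have : m' = m := le_antisymm h1 h2
    subst this
    exact ⟨μ, P, hP, h0, hm'⟩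

theorem degen_conv (hmn : 2 * m < n) (hαβ : ¬ (α = 0 ∧ β = 0)) {b μ : ℝ} {P : ℝ[X]}
    (hP : Eig n b μ P) (h0 : Lf (Mp α β b) P = 0) (hr : nreal (P.map ofRealHom) + 2 * m = n) :
    ¬ Kap n (Mp α β b) (m + 1) ∧
      ∀ᶠ s in nhdsWithin b (Set.Iio b), Kap n (Mp α β s) (m + 1) := by
  obtain ⟨m', hm', hs, -, hl⟩ := degen hαβ hP h0
  obtain rfl : m' = m := by omega
  refine ⟨?_, hl _ (by omega) (by omega)⟩
  have hker : KerEl n (Mp α β b) P := fun Q hQ => ST1 hP (Mp_rec _ _ _) h0 Q hQ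
  rintro ⟨k1, k2⟩
  rcases hs with ⟨h1, h2⟩ | ⟨h1, h2⟩
  · have := F0ker h1 k2 hP.1.ne_zero hP.2.1.le hker
    omega
  · have := F0ker k1 h1 hP.1.ne_zero hP.2.1.le hker
    omega

theorem strict_ray (hmn : 2 * m < n) (hαβ : ¬ (α = 0 ∧ β = 0)) {b b' : ℝ}
    (hb : ¬ Kap n (Mp α β b) (m + 1)) (hbb : b < b') : Dfn n (Mp α β b') (n + 1 - m) := by
  by_contra hD
  obtain ⟨μ, P, hP, h0, hr⟩ := degen_eq hαβ (up_ray (by omega) hαβ hb hbb.le) hD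
  obtain ⟨-, h1⟩ := degen_conv hmn hαβ hP h0 hr
  have h2 : ∀ᶠ z in nhdsWithin b' (Set.Iio b'), z ∈ Set.Ioo b b' := Ioo_mem_nhdsLT hbb
  obtain ⟨z, hz1, hz2⟩ := (h1.and h2).exists
  exact up_ray (by omega) hαβ hb hz2.1.le hz1

end leaf

theorem G_kap {n m : ℕ} (hmn : 2 * m < n) (b : ℝ) : Kap n (Mp 0 1 b) (m + 1) := by
  by_contra hb
  obtain ⟨b', hb', h1, h2⟩ := frequently_atTop.mp (G_sign n) b
  refine up_ray (by omega) (by simp) hb hb' ?_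
  have : Mp 0 1 b' = Gm b' := by simp [Mp]
  rw [this]
  exact ⟨h1.mono (by omega), h2.mono (by omega)⟩

theorem pencil (b : ℝ) {V W : Set (ℕ → ℝ)} (hV : IsOpen V) (hW : IsOpen W)
    (hdisj : ∀ L ∈ V, L ∉ W) (hneg : ∀ L ∈ V, -L ∈ W)
    (hcov : ∀ α β : ℝ, ¬ (α = 0 ∧ β = 0) → Mp α β b ∈ V ∨ Mp α β b ∈ W) (φ : ℝ) :
    Mp (Real.cos φ) (Real.sin φ) b ∈ W := by
  set f : ℝ → ℕ → ℝ := fun φ => Mp (Real.cos φ) (Real.sin φ) b with hf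
  have hc : Continuous f := Mp_cont Real.continuous_cos Real.continuous_sin continuous_const
  have hcov' : ∀ φ, f φ ∈ V ∨ f φ ∈ W := fun φ => hcov _ _ (by
    rintro ⟨h1, h2⟩
    have := Real.sin_sq_add_cos_sq φ
    rw [h1, h2] at this; norm_num at this)
  by_contra hφ
  have hφV : f φ ∈ V := (hcov' φ).resolve_right hφ
  have hclopen : IsClopen (f ⁻¹' V) := by
    refine ⟨⟨?_⟩, hV.preimage hc⟩
    have : (f ⁻¹' V)ᶜ = f ⁻¹' W := by
      ext x
      constructor
      · intro hx; exact (hcov' x).resolve_left hx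
      · intro hx hx'; exact hdisj _ hx' hx
    rw [this]; exact hW.preimage hc
  have huniv := hclopen.eq_univ ⟨φ, hφV⟩
  have h1 : f (φ + Real.pi) ∈ V := by
    have : φ + Real.pi ∈ f ⁻¹' V := by rw [huniv]; trivial
    exact this
  have h2 : f (φ + Real.pi) = - f φ := by
    simp only [hf, Real.cos_add_pi, Real.sin_add_pi]
    exact Mp_neg _ _ _
  exact hdisj _ h1 (h2 ▸ hneg _ hφV)

theorem kap_neg (n : ℕ) : ∃ B0 : ℝ, ∀ b ≤ B0, ∀ φ : ℝ,
    Kap n (Mp (Real.cos φ) (Real.sin φ) b) ((n + 1) / 2) := by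
  obtain ⟨B0, hB⟩ := no_zero_neg n
  refine ⟨B0, fun b hb => ?_⟩
  set h := (n + 1) / 2 with hh
  have key : ∀ φ, Mp (Real.cos φ) (Real.sin φ) b ∈
      ({L | Kap n L h} ∪ {L | Pge n (-L) (n + 2 - h)} : Set (ℕ → ℝ)) := by
    apply pencil b (V := {L | Pge n L (n + 2 - h)}) (Pge.isOpen _ _)
      ((Kap.isOpen n h).union (Pge.isOpen_neg _ _))
    · rintro L hL (h1 | h1)
      · have := F0 hL h1.2; omega
      · have := F0 hL h1; omega
    · intro L hL
      right
      simpa using hL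
    · intro α β hαβ
      rcases dich (n := n) (Mp_rec α β b) (Mp_h01 hαβ b) with ⟨j, k, hjk, hj, hk⟩ | ⟨μ, P, hP, h0⟩
      · by_cases h1 : h ≤ j
        · by_cases h2 : h ≤ k
          · exact Or.inr (Or.inl ⟨hj.mono h1, hk.mono h2⟩)
          · exact Or.inl (hj.mono (by omega))
        · exact Or.inr (Or.inr (hk.mono (by omega)))
      · have hz := (nreal_zero_iff hP).mpr (hB b hb μ P hP)
        obtain ⟨m', hm', hs, -, -⟩ := degen hαβ hP h0
        right; left
        rcases hs with ⟨h1, h2⟩ | ⟨h1, h2⟩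
        · exact ⟨h1.mono (by omega), h2.mono (by omega)⟩
        · exact ⟨h2.mono (by omega), h1.mono (by omega)⟩
  intro φ
  rcases key φ with h1 | h1
  · exact h1
  · exfalso
    have h2 := key (φ + Real.pi)
    rw [Real.cos_add_pi, Real.sin_add_pi, Mp_neg] at h2
    rcases h2 with h2 | h2
    · have h3 := F0 h1 h2.2; omega
    · have h3 := F0 h1 h2; omega

end QES


namespace QES

theorem mu_cont {n : ℕ} {β μ : ℝ → ℝ} {P : ℝ → ℝ[X]} (hβ : Continuous β)
    (hE : ∀ t, Eig n (β t) (μ t) (P t))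
    (hlim : ∀ (t0 : ℝ) (U : Ultrafilter ℝ) (μ' : ℝ) (P' : ℝ[X]), (U : Filter ℝ) ≤ nhds t0 →
      Eig n (β t0) μ' P' → (∀ k, Tendsto (fun t => (P t).coeff k) U (nhds (P'.coeff k))) →
      μ' = μ t0) : Continuous μ := by
  rw [continuous_iff_continuousAt]
  intro t0
  rw [ContinuousAt, tendsto_iff_ultrafilter]
  intro U hU
  have hβU : Tendsto β U (nhds (β t0)) := (hβ.tendsto t0).mono_left hU
  set R : ℝ := ((n : ℝ) + 2) ^ 2 + 2 * (n + 1) + 2 * (n + 1) * (|β t0| + 1) with hR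
  have hbd : ∀ᶠ t in (U : Filter ℝ), |β t| < |β t0| + 1 :=
    (hβU.abs).eventually_lt_const (by linarith)
  have hmem : ∀ᶠ t in (U : Filter ℝ), μ t ∈ Set.Icc (-R) R := by
    filter_upwards [hbd] with t ht
    have h1 := mu_bound (hE t)
    have h2 : 2 * ((n:ℝ) + 1) * |β t| ≤ 2 * (n + 1) * (|β t0| + 1) := by gcongr
    exact abs_le.mp (h1.trans (by rw [hR]; linarith))
  obtain ⟨μ', -, hμ'⟩ := isCompact_Icc.ultrafilter_le_nhds (U.map μ) (by
    rw [le_principal_iff]; exact hmem)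
  have hμt : Tendsto μ U (nhds μ') := hμ'
  obtain ⟨P', hP', hco⟩ := eig_limit (l := (U : Filter ℝ)) (Eventually.of_forall hE) hβU hμt
  rw [← hlim t0 U μ' P' hU hP' hco]
  exact hμt

theorem tendsto_Lf {l : Filter ℝ} {n : ℕ} {M : ℝ → ℕ → ℝ} {M' : ℕ → ℝ} {P : ℝ → ℝ[X]} {P' : ℝ[X]}
    (hd : ∀ t, (P t).natDegree = n) (hd' : P'.natDegree = n) (hM : Tendsto M l (nhds M'))
    (hco : ∀ k, Tendsto (fun t => (P t).coeff k) l (nhds (P'.coeff k))) :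
    Tendsto (fun t => Lf (M t) (P t)) l (nhds (Lf M' P')) := by
  have e : (fun t => Lf (M t) (P t)) = fun t => ∑ k ∈ Finset.range (n + 1), (P t).coeff k * M t k := by
    funext t; exact Lf_eq_sum _ _ _ (by rw [hd]; exact Nat.lt_succ_self _)
  rw [e, Lf_eq_sum M' P' (n + 1) (by rw [hd']; exact Nat.lt_succ_self _)]
  refine tendsto_finsetSum _ fun k _ => (hco k).mul ?_
  exact (tendsto_pi_nhds.mp hM) k

theorem homeo_of {S : Set (ℝ × ℝ)} {f : ℝ → ℝ × ℝ} (hf : Continuous f) (hi : Function.Injective f)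
    (ht : Tendsto (fun t => |(f t).1|) (cocompact ℝ) atTop) (hr : Set.range f = S) :
    ∃ γ : ℝ ≃ₜ ↥S, ∀ t, (γ t : ℝ × ℝ) = f t := by
  have hp : IsProperMap f := by
    rw [isProperMap_iff_tendsto_cocompact]
    refine ⟨hf, ?_⟩
    rw [← Metric.cobounded_eq_cocompact (α := ℝ × ℝ), ← tendsto_norm_atTop_iff_cobounded]
    refine tendsto_atTop_mono (fun t => ?_) ht
    rw [← Real.norm_eq_abs]; exact norm_fst_le (f t)
  have hemb : Topology.IsEmbedding f :=
    (Topology.IsClosedEmbedding.of_continuous_injective_isClosedMap hf hi hp.isClosedMap).isEmbedding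
  exact ⟨hemb.toHomeomorph.trans (Homeomorph.setCongr hr), fun t => rfl⟩

theorem beta_exists {n m : ℕ} (hmn : 2 * m < n) :
    ∃ β : ℝ → ℝ, ∀ t b, ¬ Kap n (Mp 1 t b) (m + 1) ↔ β t ≤ b := by
  obtain ⟨B0, hB0⟩ := kap_neg n
  have h1 : ∀ t : ℝ, ¬ ((1:ℝ) = 0 ∧ t = 0) := fun t h => one_ne_zero h.1
  have key : ∀ t, ∃ β : ℝ, ∀ b, ¬ Kap n (Mp 1 t b) (m + 1) ↔ β ≤ b := by
    intro t
    set s : Set ℝ := {b | ¬ Kap n (Mp 1 t b) (m + 1)} with hs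
    have hcl : IsClosed s := (((Kap.isOpen n (m+1)).preimage (leaf_cont 1 t)).isClosed_compl)
    have hne : s.Nonempty := by
      obtain ⟨b, hb⟩ := (E_pos n t).exists
      refine ⟨b, ?_⟩
      have : Mp 1 t b = Em b + t • Gm b := by simp [Mp]
      rw [← this] at hb
      have hD : Dfn n (Mp 1 t b) (n + 1) := Or.inl hb
      exact hD.not_Kap (by omega)
    have hbd : BddBelow s := by
      refine ⟨B0, fun b hb => ?_⟩
      by_contra hlt
      apply hb
      have hk := hB0 b (not_le.mp hlt).le (Real.arctan t)
      have hr : 0 < Real.sqrt (1 + t ^ 2) := by positivity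
      have := (hk.mono (k' := m + 1) (by omega)).scale hr.ne'
      rw [← Mp_smul, Real.cos_arctan, Real.sin_arctan] at this
      have e1 : Real.sqrt (1 + t ^ 2) * (1 / Real.sqrt (1 + t ^ 2)) = 1 := by field_simp
      have e2 : Real.sqrt (1 + t ^ 2) * (t / Real.sqrt (1 + t ^ 2)) = t := by field_simp
      rwa [e1, e2] at this
    refine ⟨sInf s, fun b => ⟨fun hb => csInf_le hbd hb, fun hb => ?_⟩⟩
    exact up_ray (by omega) (h1 t) (hcl.csInf_mem hne hbd) hb
  choose β hβ using key
  exact ⟨β, hβ⟩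

theorem case_lt {n m : ℕ} (hmn : 2 * m < n) :
    ∃ γ : ℝ ≃ₜ ↥(qesGamma n m),
      Tendsto (fun t : ℝ => ((γ t : ℝ × ℝ)).1) atTop atTop ∧
        Tendsto (fun t : ℝ => ((γ t : ℝ × ℝ)).1) atBot atTop := by
  obtain ⟨β, hβ⟩ := beta_exists hmn
  have h1 : ∀ t : ℝ, ¬ ((1:ℝ) = 0 ∧ t = 0) := fun t h => one_ne_zero h.1
  have hKap : ∀ t b, Kap n (Mp 1 t b) (m + 1) ↔ b < β t := fun t b => by
    rw [← not_iff_not, hβ, not_lt]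
  have hct : ∀ b, Continuous (fun t => Mp 1 t b) := fun b =>
    Mp_cont continuous_const continuous_id continuous_const
  -- the degenerate point on each leaf
  have hpt : ∀ t, ∃ μ P, Eig n (β t) μ P ∧ Lf (Mp 1 t (β t)) P = 0 ∧
      nreal (P.map ofRealHom) + 2 * m = n := by
    intro t
    refine degen_eq (h1 t) ((hβ t _).mpr le_rfl) fun hD => ?_
    have h2 : ∀ᶠ s in nhds (β t), Dfn n (Mp 1 t s) (n + 1 - m) :=
      ((Dfn.isOpen n _).preimage (leaf_cont 1 t)).mem_nhds hD
    obtain ⟨s, hs1, hs2⟩ := ((h2.filter_mono nhdsWithin_le_nhds).and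
      (self_mem_nhdsWithin : Set.Iio (β t) ∈ nhdsWithin (β t) (Set.Iio (β t)))).exists
    exact hs1.not_Kap (k := m + 1) (by omega) ((hKap t s).mpr hs2)
  choose μ P hE hL hr using hpt
  have huniq : ∀ t b μ' P', Eig n b μ' P' → Lf (Mp 1 t b) P' = 0 →
      nreal (P'.map ofRealHom) + 2 * m = n → b = β t := by
    intro t b μ' P' hE' hL' hr'
    obtain ⟨a1, a2⟩ := degen_conv hmn (h1 t) hE' hL' hr'
    refine le_antisymm ?_ ((hβ t b).mp a1)
    by_contra hlt
    have h2 : ∀ᶠ z in nhdsWithin b (Set.Iio b), z ∈ Set.Ioo (β t) b := Ioo_mem_nhdsLT (not_le.mp hlt)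
    obtain ⟨z, hz1, hz2⟩ := (a2.and h2).exists
    exact absurd ((hKap t z).mp hz1) (not_lt.mpr hz2.1.le)
  -- continuity of β
  have hβc : Continuous β := by
    rw [continuous_iff_continuousAt]
    intro t0
    refine tendsto_order.mpr ⟨fun a ha => ?_, fun a ha => ?_⟩
    · have : ∀ᶠ t in nhds t0, Kap n (Mp 1 t a) (m + 1) :=
        ((Kap.isOpen n _).preimage (hct a)).mem_nhds ((hKap t0 a).mpr ha)
      exact this.mono fun t ht => (hKap t a).mp ht
    · obtain ⟨c, hc1, hc2⟩ := exists_between ha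
      have hD := strict_ray hmn (h1 t0) ((hβ t0 _).mpr le_rfl) hc1
      have : ∀ᶠ t in nhds t0, Dfn n (Mp 1 t c) (n + 1 - m) :=
        ((Dfn.isOpen n _).preimage (hct c)).mem_nhds hD
      exact this.mono fun t ht =>
        lt_of_le_of_lt ((hβ t c).mp (ht.not_Kap (by omega))) hc2
  -- behaviour at infinity
  have hinf : ∀ l : Filter ℝ, Tendsto (fun t : ℝ => t⁻¹) l (nhds 0) → (∀ᶠ t in l, t ≠ 0) →
      Tendsto β l atTop := by
    intro l hl hne
    rw [tendsto_atTop]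
    intro N
    have hc : Continuous (fun a : ℝ => Mp a 1 N) :=
      Mp_cont continuous_id continuous_const continuous_const
    have h2 : ∀ᶠ a in nhds (0:ℝ), Kap n (Mp a 1 N) (m + 1) :=
      ((Kap.isOpen n _).preimage hc).mem_nhds (G_kap hmn N)
    filter_upwards [hl.eventually h2, hne] with t ht ht0
    have := ht.scale ht0
    rw [← Mp_smul, mul_inv_cancel₀ ht0, mul_one] at this
    exact ((hKap t N).mp this).le
  have htop : Tendsto β atTop atTop := hinf _ tendsto_inv_atTop_zero (eventually_ne_atTop 0)
  have hbot : Tendsto β atBot atTop := hinf _ tendsto_inv_atBot_zero (eventually_ne_atBot 0)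
  -- continuity of μ
  have hμc : Continuous μ := by
    refine mu_cont hβc hE fun t0 U μ' P' hU hE' hco => ?_
    have hM : Tendsto (fun t => Mp 1 t (β t)) U (nhds (Mp 1 t0 (β t0))) :=
      ((Mp_cont continuous_const continuous_id hβc).tendsto t0).mono_left hU
    have h2 := tendsto_Lf (fun t => (hE t).2.1) hE'.2.1 hM hco
    simp only [hL] at h2
    have h3 : Lf (Mp 1 t0 (β t0)) P' = 0 := (tendsto_nhds_unique h2 tendsto_const_nhds)
    exact ker_unique (Mp_rec _ _ _) (Mp_h01 (h1 t0) _) hE' (hE t0) h3 (hL t0)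
  have hG : ∀ b μ' P', Eig n b μ' P' → nreal (P'.map ofRealHom) + 2 * m = n → Lf (Gm b) P' ≠ 0 := by
    intro b μ' P' hE' hr' h0
    have : Mp 0 1 b = Gm b := by simp [Mp]
    exact (degen_conv hmn (by simp : ¬ ((0:ℝ) = 0 ∧ (1:ℝ) = 0)) hE' (by rw [this]; exact h0) hr').1
      (G_kap hmn b)
  have hLf : ∀ t b (P' : ℝ[X]), Lf (Mp 1 t b) P' = Lf (Em b) P' + t * Lf (Gm b) P' := by
    intro t b P'
    rw [Mp, Lf_add_mom, Lf_smul_mom, Lf_smul_mom, one_mul]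
  let f : ℝ → ℝ × ℝ := fun t => (β t, μ t - β t ^ 2)
  have hf : Continuous f := hβc.prodMk (hμc.sub (hβc.pow 2))
  have hi : Function.Injective f := by
    intro s t hst
    have e1 : β s = β t := congrArg Prod.fst hst
    have e2 : μ s - β s ^ 2 = μ t - β t ^ 2 := congrArg Prod.snd hst
    have e3 : μ s = μ t := by rw [e1] at e2; linarith
    have hs := hE s
    rw [e1, e3] at hs
    have e4 : P s = P t := hs.unique (hE t)
    have l1 := hL s
    have l2 := hL t
    rw [e1, e4, hLf] at l1
    rw [hLf] at l2
    have : (s - t) * Lf (Gm (β t)) (P t) = 0 := by linear_combination l1 - l2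
    exact sub_eq_zero.mp ((mul_eq_zero.mp this).resolve_right (hG _ _ _ (hE t) (hr t)))
  have hrange : Set.range f = qesGamma n m := by
    ext q
    rw [mem_gamma_iff]
    constructor
    · rintro ⟨t, rfl⟩
      refine ⟨P t, ?_, ?_⟩
      · have : β t ^ 2 + (μ t - β t ^ 2) = μ t := by ring
        simp only [f, this]; exact hE t
      · have := hr t; omega
    · rintro ⟨P', hE', hr'⟩
      have hr'' : nreal (P'.map ofRealHom) + 2 * m = n := by omega
      have hg := hG _ _ _ hE' hr''
      set t := - Lf (Em q.1) P' / Lf (Gm q.1) P' with ht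
      have h0 : Lf (Mp 1 t q.1) P' = 0 := by rw [hLf, ht]; field_simp; ring
      have hb := huniq t _ _ _ hE' h0 hr''
      refine ⟨t, ?_⟩
      have hEt := hE t
      have hLt := hL t
      rw [← hb] at hEt hLt
      have := ker_unique (Mp_rec _ _ _) (Mp_h01 (h1 t) _) hEt hE' hLt h0
      apply Prod.ext
      · exact hb.symm
      · change μ t - β t ^ 2 = q.2
        rw [this, ← hb]; ring
  have hco : Tendsto (fun t => |(f t).1|) (cocompact ℝ) atTop := by
    rw [cocompact_eq_atBot_atTop, tendsto_sup]
    exact ⟨tendsto_abs_atTop_atTop.comp hbot, tendsto_abs_atTop_atTop.comp htop⟩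
  obtain ⟨γ, hγ⟩ := homeo_of hf hi hco hrange
  refine ⟨γ, ?_, ?_⟩
  · simp only [hγ]; exact htop
  · simp only [hγ]; exact hbot

theorem case_eq (m : ℕ) :
    ∃ γ : ℝ ≃ₜ ↥(qesGamma (2 * m) m), ∀ t, ((γ t : ℝ × ℝ)).1 = t := by
  have hex : ∀ b : ℝ, ∃ μ P, Eig (2 * m) b μ P ∧ ∀ x : ℝ, P.eval x ≠ 0 := by
    intro b
    by_contra hcon
    push Not at hcon
    have key : ∀ φ, Mp (Real.cos φ) (Real.sin φ) b ∈ {L : ℕ → ℝ | Pge (2 * m) (-L) (m + 1)} := by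
      apply pencil b (V := {L | Pge (2 * m) L (m + 1)}) (Pge.isOpen _ _) (Pge.isOpen_neg _ _)
      · intro L hL hL'
        have := F0 hL hL'; omega
      · intro L hL
        simpa using hL
      · intro α β hαβ
        rcases dich (n := 2 * m) (Mp_rec α β b) (Mp_h01 hαβ b) with
          ⟨j, k, hjk, hj, hk⟩ | ⟨μ, P, hP, h0⟩
        · by_cases h1 : m + 1 ≤ j
          · exact Or.inl (hj.mono h1)
          · exact Or.inr (hk.mono (by omega))
        · obtain ⟨x, hx⟩ := hcon μ P hP
          obtain ⟨m', hm', hs, -, -⟩ := degen hαβ hP h0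
          have hz : nreal (P.map ofRealHom) ≠ 0 := fun hz => (nreal_zero_iff hP).mp hz x hx
          rcases hs with ⟨h1, h2⟩ | ⟨h1, h2⟩
          · exact Or.inl (h1.mono (by omega))
          · exact Or.inr (h1.mono (by omega))
    have h1 := key 0
    have h2 := key (0 + Real.pi)
    rw [Real.cos_add_pi, Real.sin_add_pi, Mp_neg] at h2
    have := F0 h1 h2
    omega
  choose μ P hE h0 using hex
  have hμc : Continuous μ := by
    refine mu_cont (β := fun t => t) continuous_id hE fun t0 U μ' P' hU hE' hco => ?_
    refine zero_unique hE' (hE t0) (fun x hx => ?_) (h0 t0)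
    have hge : ∀ y, 0 ≤ P'.eval y := by
      intro y
      have ht : Tendsto (fun t => (P t).eval y) U (nhds (P'.eval y)) := by
        have e : (fun t => (P t).eval y) =
            fun t => ∑ k ∈ Finset.range (2 * m + 1), (P t).coeff k * y ^ k := by
          funext t
          exact eval_eq_sum_range' (by rw [(hE t).2.1]; exact Nat.lt_succ_self _) y
        rw [e, eval_eq_sum_range' (n := 2 * m + 1) (by rw [hE'.2.1]; exact Nat.lt_succ_self _) y]
        exact tendsto_finsetSum _ fun k _ => (hco k).mul_const _
      exact ge_of_tendsto' ht fun t => (pos_of_no_zero (hE t) (h0 t) y).le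
    have hmin : IsLocalMin (fun y => P'.eval y) x :=
      Eventually.of_forall fun y => by simp only [hx]; exact hge y
    exact hE'.simple x hx (hmin.hasDerivAt_eq_zero (P'.hasDerivAt x))
  let f : ℝ → ℝ × ℝ := fun t => (t, μ t - t ^ 2)
  have hf : Continuous f := continuous_id.prodMk (hμc.sub (continuous_id.pow 2))
  have hi : Function.Injective f := fun s t hst => congrArg Prod.fst hst
  have hrange : Set.range f = qesGamma (2 * m) m := by
    ext q
    rw [mem_gamma_iff]
    constructor
    · rintro ⟨t, rfl⟩
      refine ⟨P t, ?_, ?_⟩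
      · have : t ^ 2 + (μ t - t ^ 2) = μ t := by ring
        simp only [f, this]; exact hE t
      · rw [(nreal_zero_iff (hE t)).mpr (h0 t)]; omega
    · rintro ⟨P', hE', hr'⟩
      rw [Nat.sub_self, nreal_zero_iff hE'] at hr'
      have := zero_unique hE' (hE q.1) hr' (h0 q.1)
      refine ⟨q.1, Prod.ext rfl ?_⟩
      change μ q.1 - q.1 ^ 2 = q.2
      rw [← this]; ring
  have hco : Tendsto (fun t => |(f t).1|) (cocompact ℝ) atTop := by
    rw [cocompact_eq_atBot_atTop, tendsto_sup]
    exact ⟨tendsto_abs_atBot_atTop, tendsto_abs_atTop_atTop⟩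
  obtain ⟨γ, hγ⟩ := homeo_of hf hi hco hrange
  exact ⟨γ, fun t => by rw [hγ]⟩

end QES

theorem qes_gamma_end_behavior (n m : ℕ) (hm : m ≤ n / 2) :
    ∃ γ : ℝ ≃ₜ ↥(qesGamma n m),
      ((Odd n ∨ 2 * m < n) →
        Tendsto (fun t : ℝ => ((γ t : ℝ × ℝ)).1) atTop atTop ∧
        Tendsto (fun t : ℝ => ((γ t : ℝ × ℝ)).1) atBot atTop) ∧
      ((Even n ∧ 2 * m = n) →
        (Tendsto (fun t : ℝ => ((γ t : ℝ × ℝ)).1) atTop atTop ∧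
         Tendsto (fun t : ℝ => ((γ t : ℝ × ℝ)).1) atBot atBot) ∨
        (Tendsto (fun t : ℝ => ((γ t : ℝ × ℝ)).1) atTop atBot ∧
         Tendsto (fun t : ℝ => ((γ t : ℝ × ℝ)).1) atBot atTop)) := by
  by_cases h : 2 * m < n
  · obtain ⟨γ, hγ⟩ := QES.case_lt h
    exact ⟨γ, fun _ => hγ, fun h2 => absurd h2.2 (by omega)⟩
  · obtain rfl : n = 2 * m := by omega
    obtain ⟨γ, hγ⟩ := QES.case_eq m
    refine ⟨γ, fun h2 => ?_, fun _ => Or.inl ?_⟩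
    · rcases h2 with h2 | h2
      · exact absurd h2 (by simp)
      · omega
    · simp only [hγ]; exact ⟨tendsto_id, tendsto_id⟩
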